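/- arXiv:1107.1502 — 2 statements merged into one kernel-verified Lean document; each statement's English description precedes it below -/
import Mathlib

section
/- Let X be a noncompact AR which contains a closed subset homeomorphic to X × X, and let Y be a metrizable space with w(Y) ≤ w(X). Then each of the following two conditions is sufficient for Y to admit a closed embedding into X: (A) every point of Y has a neighbourhood (not necessarily open or closed) which admits a closed embedding into X; (B) Y can be covered by a locally finite collection of its closed subsets each of which admits a closed embedding into X. -/
open Cardinal

/-- A metrizable space `X` is an absolute retract (AR) for metrizable spaces: every
continuous map into `X` from a closed subset of a metrizable space extends continuously
to the whole space. -/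
def IsAbsoluteRetract (X : Type u) [TopologicalSpace X] : Prop :=
  TopologicalSpace.MetrizableSpace X ∧
  ∀ (Z : Type u) (_ : TopologicalSpace Z), TopologicalSpace.MetrizableSpace Z →
    ∀ B : Set Z, IsClosed B → ∀ f : B → X, Continuous f →
      ∃ g : Z → X, Continuous g ∧ ∀ b : B, g b = f b

/-- The topological weight of `X`: the least infinite cardinality of a base of the
topology of `X`. -/
noncomputable def tweight (X : Type*) [TopologicalSpace X] : Cardinal :=
  sInf {c : Cardinal | ℵ₀ ≤ c ∧
    ∃ B : Set (Set X), TopologicalSpace.IsTopologicalBasis B ∧ #B ≤ c}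

section

open Set Filter Topology TopologicalSpace

/-- A subset `K` of `Y` is placed in `X` when some continuous map `Y → X` restricts to a closed
embedding of `K`. -/
def IsPlaced (X : Type*) {Y : Type*} [TopologicalSpace X] [TopologicalSpace Y]
    (K : Set Y) : Prop :=
  ∃ f : Y → X, Continuous f ∧ IsClosedEmbedding (K.domRestrict f)

theorem Topology.IsClosedEmbedding.isClosed_image_inter {X Y : Type*} [TopologicalSpace X]
    [TopologicalSpace Y] {K F : Set Y} {f : Y → X} (hf : IsClosedEmbedding (K.domRestrict f))
    (hF : IsClosed F) : IsClosed (f '' (F ∩ K)) := by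
  have h := hf.isClosedMap _ (hF.preimage continuous_subtype_val)
  convert h using 1
  ext x
  constructor
  · rintro ⟨y, hy, rfl⟩
    exact ⟨⟨y, hy.2⟩, hy.1, rfl⟩
  · rintro ⟨y, hy, rfl⟩
    exact ⟨y, ⟨hy, y.2⟩, rfl⟩

theorem Topology.IsClosedEmbedding.of_comp_of_t2 {X Y Z : Type*} [TopologicalSpace X]
    [TopologicalSpace Y] [TopologicalSpace Z] [T2Space Y] {f : X → Y} {g : Y → Z}
    (hf : Continuous f) (hg : Continuous g) (hgf : IsClosedEmbedding (g ∘ f)) :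
    IsClosedEmbedding f :=
  .of_continuous_injective_isClosedMap hf hgf.injective.of_comp
    (isProperMap_of_comp_of_t2 hf hg hgf.isProperMap).isClosedMap

namespace IsAbsoluteRetract

variable {X Y : Type} [TopologicalSpace X] [TopologicalSpace Y]

theorem isPlaced [MetrizableSpace Y] (hX : IsAbsoluteRetract X) {K : Set Y} (hK : IsClosed K)
    {e : K → X} (he : IsClosedEmbedding e) : IsPlaced X K := by
  obtain ⟨g, hg, hge⟩ := hX.2 Y _ inferInstance K hK e he.continuous
  refine ⟨g, hg, ?_⟩
  convert he using 1
  exact funext hge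

theorem isPlaced_of_subset [MetrizableSpace Y] (hX : IsAbsoluteRetract X) {K N : Set Y}
    (hK : IsClosed K) (hKN : K ⊆ N) {e : N → X} (he : IsClosedEmbedding e) : IsPlaced X K := by
  have : IsClosedEmbedding (inclusion hKN) :=
    .of_comp_of_t2 (continuous_inclusion hKN) continuous_subtype_val
      hK.isClosedEmbedding_subtypeVal
  exact hX.isPlaced hK (he.comp this)

theorem isPlaced_empty [MetrizableSpace Y] (hX : IsAbsoluteRetract X) :
    IsPlaced X (∅ : Set Y) :=
  hX.isPlaced isClosed_empty (e := fun b => b.2.elim)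
    (.of_continuous_injective_isClosedMap continuous_of_discreteTopology
      (fun b => b.2.elim) (fun s _ => by simp [Set.eq_empty_of_isEmpty s]))

/-- A nontrivial absolute retract contains a path leaving its initial point for good. -/
theorem exists_path_leaving (hX : IsAbsoluteRetract X) [Nontrivial X] :
    ∃ (p : X) (w : ℝ → X), Continuous w ∧ w 0 = p ∧ ∀ t, 0 < t → t ≤ 1 → w t ≠ p := by
  obtain ⟨p, q, hpq⟩ := exists_pair_ne X
  have := hX.1
  obtain ⟨g, hg, hge⟩ := hX.2 ℝ inferInstance inferInstance {0, 1} (by simp)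
    (fun b => if (b : ℝ) = 0 then p else q) continuous_of_discreteTopology
  have h0 : g 0 = p := by simpa using hge ⟨0, by simp⟩
  have h1 : g 1 = q := by simpa using hge ⟨1, by simp⟩
  have hc : IsCompact (Icc (0 : ℝ) 1 ∩ g ⁻¹' {p}) :=
    isCompact_Icc.inter_right (isClosed_singleton.preimage hg)
  obtain ⟨s, ⟨⟨hs0, hs1⟩, hsp⟩, hs⟩ := hc.exists_isGreatest ⟨0, by simp [h0]⟩
  have hs1' : s < 1 := lt_of_le_of_ne hs1 (by rintro rfl; exact hpq (hsp.symm.trans h1))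
  refine ⟨p, fun t => g (s + t * (1 - s)), by fun_prop, by simpa using hsp, fun t ht ht1 h => ?_⟩
  have := hs ⟨⟨by nlinarith, by nlinarith⟩, h⟩
  nlinarith

theorem exists_continuous_of_isClosed [MetrizableSpace Y] (hX : IsAbsoluteRetract X)
    [Nontrivial X] {K : Set Y} (hK : IsClosed K) (hne : K.Nonempty) :
    ∃ (p : X) (u : Y → X), Continuous u ∧ (∀ y ∈ K, u y = p) ∧ ∀ y ∉ K, u y ≠ p := by
  let := metrizableSpaceMetric Y
  obtain ⟨p, w, hw, h0, h1⟩ := hX.exists_path_leaving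
  refine ⟨p, fun y => w (min 1 (Metric.infDist y K)), ?_, fun y hy => ?_, fun y hy => ?_⟩
  · exact hw.comp (continuous_const.min (Metric.continuous_infDist_pt K))
  · simp [Metric.infDist_zero_of_mem hy, h0]
  · exact h1 _ (lt_min one_pos ((hK.notMem_iff_infDist_pos hne).1 hy)) (min_le_left _ _)

theorem isPlaced_union [MetrizableSpace Y] (hX : IsAbsoluteRetract X) [Nontrivial X]
    {j : X × X → X} (hj : IsClosedEmbedding j) {K L : Set Y} (hK : IsClosed K) (hL : IsClosed L)
    (hKX : IsPlaced X K) (hLX : IsPlaced X L) : IsPlaced X (K ∪ L) := by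
  have := hX.1
  rcases K.eq_empty_or_nonempty with rfl | hne
  · simpa using hLX
  obtain ⟨f, hf, hfK⟩ := hKX
  obtain ⟨g, hg, hgL⟩ := hLX
  obtain ⟨p, u, hu, huK, hup⟩ := hX.exists_continuous_of_isClosed hK hne
  let h : Y → X × X × X := fun y => (f y, g y, u y)
  have hh : Continuous h := hf.prodMk (hg.prodMk hu)
  have hhK : IsClosedEmbedding (K.domRestrict h) :=
    .of_comp_of_t2 (hh.comp continuous_subtype_val) continuous_fst hfK
  have hhL : IsClosedEmbedding (L.domRestrict h) :=
    .of_comp_of_t2 (hh.comp continuous_subtype_val) (continuous_fst.comp continuous_snd) hgL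
  have hKL : IsClosedEmbedding ((K ∪ L).domRestrict h) := by
    refine .of_continuous_injective_isClosedMap (hh.comp continuous_subtype_val) ?_ ?_
    · rw [← injOn_iff_injective]
      have hiK := injOn_iff_injective.2 hhK.injective
      have hiL := injOn_iff_injective.2 hhL.injective
      intro x hx y hy hxy
      have hxu : u x = u y := congrArg (fun z => z.2.2) hxy
      have hiff : x ∈ K ↔ y ∈ K := by grind
      by_cases hxK : x ∈ K
      · exact hiK hxK (hiff.1 hxK) hxy
      · exact hiL (hx.resolve_left hxK) (hy.resolve_left (mt hiff.2 hxK)) hxy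
    · intro F hF
      have hF' := (hK.union hL).isClosedEmbedding_subtypeVal.isClosedMap F hF
      convert (hhK.isClosed_image_inter hF').union (hhL.isClosed_image_inter hF') using 1
      have hsub : Subtype.val '' F ⊆ K ∪ L := by
        rintro _ ⟨x, -, rfl⟩
        exact x.2
      rw [← image_union, ← inter_union_distrib_left, inter_eq_left.2 hsub, ← image_comp]
      rfl
  exact hX.isPlaced (hK.union hL) ((hj.comp (IsClosedEmbedding.id.prodMap hj)).comp hKL)

theorem isPlaced_biUnion_finset [MetrizableSpace Y] (hX : IsAbsoluteRetract X) [Nontrivial X]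
    {j : X × X → X} (hj : IsClosedEmbedding j) {ι : Type*} {C : ι → Set Y}
    (hC : ∀ i, IsClosed (C i)) (hCX : ∀ i, IsPlaced X (C i)) (s : Finset ι) :
    IsPlaced X (⋃ i ∈ s, C i) := by
  classical
  induction s using Finset.induction_on with
  | empty => simpa using hX.isPlaced_empty
  | insert a s _ ih =>
    rw [Finset.set_biUnion_insert]
    exact hX.isPlaced_union hj (hC a) (s.finite_toSet.isClosed_biUnion fun i _ => hC i)
      (hCX a) ih

/-- The union of a discrete family of placed closed sets, indexed by a set which embeds as a
closed discrete subset of `X`, is placed. -/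
theorem isPlaced_iUnion [MetrizableSpace Y] (hX : IsAbsoluteRetract X)
    {j : X × X → X} (hj : IsClosedEmbedding j) {ι : Type*} {C : ι → Set Y}
    (hC : ∀ i, IsClosed (C i)) (hCX : ∀ i, IsPlaced X (C i)) (hlf : LocallyFinite C)
    (hdis : Pairwise (Function.onFun Disjoint C)) {d : ι → X} (hd : Function.Injective d)
    (hdlf : LocallyFinite fun i => ({d i} : Set X)) : IsPlaced X (⋃ i, C i) := by
  have := hX.1
  choose f hf hfC using hCX
  have hex : ∀ x : ⋃ i, C i, ∃ i, (x : Y) ∈ C i := fun x => mem_iUnion.1 x.2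
  choose k hk using hex
  have hk' : ∀ (x : ⋃ i, C i) (i : ι), (x : Y) ∈ C i → k x = i := fun x i hi => by
    by_contra hne
    exact (hdis hne).le_bot ⟨hk x, hi⟩
  have hU : IsClosed (⋃ i, C i) := hlf.isClosed_iUnion hC
  let h : (⋃ i, C i) → X × X := fun x => (d (k x), f (k x) x)
  have hh : IsClosedEmbedding h := by
    refine .of_continuous_injective_isClosedMap ?_ ?_ ?_
    · refine (hlf.preimage_continuous continuous_subtype_val).continuous ?_
        (fun i => (hC i).preimage continuous_subtype_val) fun i => ?_
      · exact eq_univ_of_forall fun x => mem_iUnion.2 ⟨k x, hk x⟩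
      · have hc : Continuous fun x : ⋃ i, C i => (d i, f i x) :=
          continuous_const.prodMk ((hf i).comp continuous_subtype_val)
        refine hc.continuousOn.congr fun x hx => ?_
        simp only [h, hk' x i hx]
    · intro x y hxy
      have hkk : k x = k y := hd (congrArg Prod.fst hxy)
      have h2 : f (k x) x = f (k y) y := congrArg Prod.snd hxy
      rw [← hkk] at h2
      have := injOn_iff_injective.2 (hfC (k x)).injective (hk x) (hkk ▸ hk y) h2
      exact Subtype.ext this
    · intro F hF
      have hF' := hU.isClosedEmbedding_subtypeVal.isClosedMap F hF
      have himg : h '' F = ⋃ i, ({d i} : Set X) ×ˢ (f i '' (Subtype.val '' F ∩ C i)) := by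
        ext z
        simp only [mem_image, mem_iUnion, mem_prod, mem_singleton_iff, mem_inter_iff]
        constructor
        · rintro ⟨x, hx, rfl⟩
          exact ⟨k x, rfl, x, ⟨⟨x, hx, rfl⟩, hk x⟩, rfl⟩
        · rintro ⟨i, hi, _, ⟨⟨x, hx, rfl⟩, hxi⟩, hz⟩
          refine ⟨x, hx, ?_⟩
          simp only [h, hk' x i hxi, hz, ← hi]
      rw [himg]
      exact (hdlf.prod_right _).isClosed_iUnion fun i =>
        isClosed_singleton.prod ((hfC i).isClosed_image_inter hF')
  exact hX.isPlaced hU (hj.comp hh)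

end IsAbsoluteRetract

theorem exists_isTopologicalBasis_mk_le_tweight (X : Type*) [TopologicalSpace X] :
    ∃ B : Set (Set X), IsTopologicalBasis B ∧ #B ≤ tweight X := by
  have hne : {c : Cardinal | ℵ₀ ≤ c ∧
      ∃ B : Set (Set X), IsTopologicalBasis B ∧ #B ≤ c}.Nonempty :=
    ⟨max ℵ₀ #{s : Set X | IsOpen s}, le_max_left _ _, _, isTopologicalBasis_opens,
      le_max_right _ _⟩
  exact (csInf_mem hne).2

/-- A uniformly separated family of points is locally finite. -/
theorem locallyFinite_of_le_dist {X ι : Type*} [PseudoMetricSpace X] {C : ι → Set X} {r : ℝ}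
    (hr : 0 < r) (h : ∀ i k, i ≠ k → ∀ x ∈ C i, ∀ y ∈ C k, r ≤ dist x y) :
    LocallyFinite C := by
  intro x
  refine ⟨Metric.ball x (r / 2), Metric.ball_mem_nhds x (half_pos hr), Set.Subsingleton.finite ?_⟩
  rintro i ⟨y, hyi, hy⟩ k ⟨z, hzk, hz⟩
  by_contra hne
  have := h i k hne y hyi z hzk
  have := dist_triangle_right y z x
  rw [Metric.mem_ball] at hy hz
  linarith

theorem mk_le_tweight_of_le_dist {X ι : Type} [PseudoMetricSpace X] {p : ι → X} {r : ℝ}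
    (hr : 0 < r) (h : ∀ i k, i ≠ k → r ≤ dist (p i) (p k)) : #ι ≤ tweight X := by
  obtain ⟨B, hB, hBc⟩ := exists_isTopologicalBasis_mk_le_tweight X
  have hex : ∀ i, ∃ o : B, p i ∈ (o : Set X) ∧ (o : Set X) ⊆ Metric.ball (p i) r := fun i => by
    obtain ⟨o, hoB, ho⟩ := hB.mem_nhds_iff.1 (Metric.ball_mem_nhds (p i) hr)
    exact ⟨⟨o, hoB⟩, ho⟩
  choose o ho hob using hex
  refine (mk_le_of_injective (f := o) fun i k hik => ?_).trans hBc
  by_contra hne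
  have h1 := hob k (hik ▸ ho i)
  exact absurd (h i k hne) (not_le.2 h1)

theorem exists_maximal_le_dist (X : Type*) [PseudoMetricSpace X] {r : ℝ} (hr : 0 < r) :
    ∃ M : Set X, M.Pairwise (fun x y => r ≤ dist x y) ∧ ∀ x, ∃ m ∈ M, dist x m < r := by
  obtain ⟨M, hM⟩ := zorn_subset {M : Set X | M.Pairwise fun x y => r ≤ dist x y}
    fun c hc hch => ⟨⋃₀ c, (pairwise_sUnion hch.directedOn).2 fun s hs => hc hs,
      fun s hs => subset_sUnion_of_mem hs⟩
  refine ⟨M, hM.prop, fun x => ?_⟩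
  by_contra! hx
  have hxM : x ∉ M := fun h => by simpa using (hx x h).trans_lt' hr
  have hins : insert x M ∈ {M : Set X | M.Pairwise fun x y => r ≤ dist x y} :=
    hM.prop.insert fun y hy _ => ⟨hx y hy, by rw [dist_comm]; exact hx y hy⟩
  exact hxM (hM.le_of_ge hins (subset_insert x M) (mem_insert x M))

theorem exists_injective_nat_locallyFinite (X : Type*) [TopologicalSpace X] [MetrizableSpace X]
    (hX : ¬ CompactSpace X) :
    ∃ u : ℕ → X, Function.Injective u ∧ LocallyFinite fun n => ({u n} : Set X) := by
  let := metrizableSpaceMetric X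
  obtain ⟨v, hv⟩ : ∃ v : ℕ → X, ∀ x, ¬ MapClusterPt x atTop v := by
    by_contra! h
    refine hX (compactSpace_iff_seqCompactSpace.2 ⟨fun v _ => ?_⟩)
    obtain ⟨x, hx⟩ := h v
    obtain ⟨φ, hφ⟩ := hx.tendsto_subseq
    exact ⟨x, mem_univ x, φ, hφ⟩
  have hlf : LocallyFinite fun n => ({v n} : Set X) := by
    intro x
    have := hv x
    rw [mapClusterPt_iff_frequently] at this
    push Not at this
    obtain ⟨s, hs, hvs⟩ := this
    refine ⟨s, hs, ?_⟩
    rw [← Nat.cofinite_eq_atTop, eventually_cofinite] at hvs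
    simpa using hvs
  have hinf : (range v).Infinite := by
    intro hfin
    have := hfin.to_subtype
    obtain ⟨y, hy⟩ := Finite.exists_infinite_fiber (rangeFactorization v)
    rw [infinite_coe_iff] at hy
    exact hy (hlf.point_finite y |>.subset fun n hn => by
      simpa using (congrArg Subtype.val hn).symm)
  have := hinf.to_subtype
  let φ : ℕ ↪ range v := Infinite.natEmbedding _
  choose k hk using fun n => (φ n).2
  have hkv : Function.Injective (v ∘ k) := fun a b hab =>
    φ.injective (Subtype.ext (by simpa [hk] using hab))
  exact ⟨v ∘ k, hkv, hlf.comp_injective hkv.of_comp⟩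

/-- A noncompact metrizable space containing its square as a closed subspace has a closed discrete
subset of every cardinality up to its weight. -/
theorem exists_injective_locallyFinite {X ι : Type} [TopologicalSpace X] [MetrizableSpace X]
    (hX : ¬ CompactSpace X) {j : X × X → X} (hj : IsClosedEmbedding j) (hι : #ι ≤ tweight X) :
    ∃ d : ι → X, Function.Injective d ∧ LocallyFinite fun i => ({d i} : Set X) := by
  let := metrizableSpaceMetric X
  obtain ⟨u, hu, hulf⟩ := exists_injective_nat_locallyFinite X hX
  choose M hM hMd using fun n : ℕ =>
    exists_maximal_le_dist X (r := 1 / ((n : ℝ) + 1)) Nat.one_div_pos_of_nat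
  have hMne : ∀ n, Nonempty (M n) := fun n =>
    let ⟨m, hm, _⟩ := hMd n (u 0)
    ⟨⟨m, hm⟩⟩
  let T := Σ n, M n
  have hTinf : Infinite T := Infinite.of_injective (fun n => (⟨n, (hMne n).some⟩ : T))
    fun a b hab => congrArg Sigma.fst hab
  let b : T × ℕ → Set X := fun z => Metric.ball (z.1.2 : X) (1 / ((z.2 : ℝ) + 1))
  have hb : IsTopologicalBasis (range b) := by
    refine isTopologicalBasis_of_isOpen_of_nhds ?_ fun x o hx ho => ?_
    · rintro _ ⟨z, rfl⟩
      exact Metric.isOpen_ball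
    · obtain ⟨ε, hε, hεo⟩ := Metric.isOpen_iff.1 ho x hx
      obtain ⟨n, hn⟩ := exists_nat_one_div_lt (half_pos hε)
      obtain ⟨m, hm, hmd⟩ := hMd n x
      refine ⟨_, ⟨(⟨n, m, hm⟩, n), rfl⟩, hmd, fun y hy => hεo ?_⟩
      have := dist_triangle_right y x m
      simp only [b, Metric.mem_ball] at hy ⊢
      linarith
  have hw : tweight X ≤ #T := by
    refine csInf_le' ⟨aleph0_le_mk T, range b, hb, mk_range_le.trans ?_⟩
    simp [aleph0_le_mk T]
  obtain ⟨φ⟩ := hι.trans hw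
  let e : T → X × X := fun z => (u z.1, z.2)
  have he : Function.Injective e := by
    rintro ⟨n, m⟩ ⟨n', m'⟩ h
    obtain rfl : n = n' := hu (congrArg Prod.fst h)
    obtain rfl : m = m' := Subtype.ext (congrArg Prod.snd h)
    rfl
  have helf : LocallyFinite fun z => ({e z} : Set (X × X)) := by
    rintro ⟨x, y⟩
    obtain ⟨s, hs, hsf⟩ := hulf x
    have hMlf : ∀ n, LocallyFinite fun m : M n => ({(m : X)} : Set X) := fun n =>
      locallyFinite_of_le_dist (r := 1 / ((n : ℝ) + 1)) Nat.one_div_pos_of_nat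
        fun a b hab x hx y hy => by
          rw [mem_singleton_iff.1 hx, mem_singleton_iff.1 hy]
          exact hM n a.2 b.2 (Subtype.coe_injective.ne hab)
    choose t ht htf using fun n => hMlf n y
    refine ⟨s ×ˢ ⋂ n ∈ {n | (({u n} : Set X) ∩ s).Nonempty}, t n,
      prod_mem_nhds hs ((biInter_mem hsf).2 fun n _ => ht n), ?_⟩
    refine (hsf.biUnion fun n _ => (htf n).image (Sigma.mk n)).subset ?_
    rintro ⟨n, m⟩ hz
    simp only [singleton_inter_nonempty, mem_ofPred_eq, e, mem_prod, mem_iInter] at hz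
    simp only [singleton_inter_nonempty, mem_ofPred_eq, mem_iUnion]
    exact ⟨n, hz.1, m, hz.2 n hz.1, rfl⟩
  have hjlf : LocallyFinite fun z => ({j (e z)} : Set X) := by
    intro x
    by_cases hx : x ∈ range j
    · obtain ⟨z, rfl⟩ := hx
      obtain ⟨s, hs, hsf⟩ := helf z
      obtain ⟨t, ht, hts⟩ := (hj.isInducing.nhds_eq_comap z ▸ hs :)
      exact ⟨t, ht, hsf.subset fun k hk => by
        simp only [singleton_inter_nonempty, mem_ofPred_eq] at hk ⊢
        exact hts hk⟩
    · refine ⟨(range j)ᶜ, hj.isClosed_range.isOpen_compl.mem_nhds hx, ?_⟩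
      convert finite_empty
      simp
  exact ⟨fun i => j (e (φ i)), hj.injective.comp (he.comp φ.injective),
    hjlf.comp_injective φ.injective⟩

/-- In a metric space every open cover admits a countable family of closed sets whose interiors
cover, each of which is a uniformly separated union of closed sets inscribed in the cover. -/
theorem exists_closed_separated_refinement {X ι : Type*} [PseudoMetricSpace X] {U : ι → Set X}
    (hU : ∀ i, IsOpen (U i)) (hcov : ∀ x, ∃ i, x ∈ U i) :
    ∃ V : ℕ → ι → Set X, (∀ n i, IsClosed (V n i)) ∧ (∀ n i, V n i ⊆ U i) ∧
      (∀ n, ∃ r : ℝ, 0 < r ∧ ∀ i k, i ≠ k → ∀ x ∈ V n i, ∀ y ∈ V n k, r ≤ dist x y) ∧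
      ∀ x, ∃ n i, V n i ∈ 𝓝 x := by
  let R : ι → ι → Prop := WellOrderingRel
  let r : ℕ → ℝ := fun n => 1 / ((n : ℝ) + 1)
  have hr : ∀ n, 0 < r n := fun n => Nat.one_div_pos_of_nat
  let F : ℕ → ι → Set X := fun n i =>
    {x | (∀ z ∉ U i, r n ≤ dist x z) ∧ ∀ k, R k i → x ∉ U k}
  let V : ℕ → ι → Set X := fun n i => Metric.cthickening (r n / 4) (F n i)
  have hV : ∀ n i, ∀ x ∈ V n i, ∃ z ∈ F n i, dist x z < r n / 3 := fun n i x hx => by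
    have := hr n
    exact Metric.mem_thickening_iff.1
      (Metric.cthickening_subset_thickening' (by linarith) (by linarith) _ hx)
  have hsep : ∀ n i k, R i k → ∀ x ∈ V n i, ∀ y ∈ V n k, r n / 3 ≤ dist x y := by
    intro n i k hik x hx y hy
    obtain ⟨z, hz, hxz⟩ := hV n i x hx
    obtain ⟨w, hw, hyw⟩ := hV n k y hy
    have h1 := hz.1 w (hw.2 i hik)
    have h2 := dist_triangle4_left x y z w
    have h3 := dist_triangle4 z x y w
    rw [dist_comm z x] at h3
    linarith
  refine ⟨V, fun n i => Metric.isClosed_cthickening, fun n i x hx => ?_,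
    fun n => ⟨r n / 3, by have := hr n; positivity, fun i k hik x hx y hy => ?_⟩, fun x => ?_⟩
  · by_contra hxU
    obtain ⟨z, hz, hxz⟩ := hV n i x hx
    have h1 := hz.1 x hxU
    have := hr n
    rw [dist_comm] at h1
    linarith
  · rcases (trichotomous_of R i k) with h | h | h
    · exact hsep n i k h x hx y hy
    · exact absurd h hik
    · rw [dist_comm]
      exact hsep n k i h y hy x hx
  · have hwf : WellFounded R := WellOrderingRel.isWellOrder.wf
    let i := hwf.min {i | x ∈ U i} (hcov x)
    obtain ⟨ε, hε, hεU⟩ := Metric.isOpen_iff.1 (hU i) x (hwf.min_mem {i | x ∈ U i} (hcov x))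
    obtain ⟨n, hn⟩ := exists_nat_one_div_lt hε
    have hxF : x ∈ F n i := by
      refine ⟨fun z hz => ?_, fun k hk hxk => hwf.not_lt_min {i | x ∈ U i} hxk hk⟩
      by_contra! h
      exact hz (hεU (Metric.mem_ball'.2 (h.trans hn)))
    refine ⟨n, i, mem_of_superset ?_ (Metric.thickening_subset_cthickening _ _)⟩
    have := hr n
    exact Metric.isOpen_thickening.mem_nhds (Metric.self_subset_thickening (by linarith) _ hxF)

namespace IsAbsoluteRetract

variable {X Y : Type} [TopologicalSpace X] [TopologicalSpace Y]

/-- A space covered by the interiors of countably many placed closed sets is placed. -/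
theorem isPlaced_univ_of_countable_cover [MetrizableSpace Y] (hX : IsAbsoluteRetract X)
    [Nontrivial X] (hnc : ¬ CompactSpace X) {j : X × X → X} (hj : IsClosedEmbedding j)
    {K : ℕ → Set Y} (hK : ∀ n, IsClosed (K n)) (hKX : ∀ n, IsPlaced X (K n))
    (hcov : ∀ y, ∃ n, K n ∈ 𝓝 y) : IsPlaced X (univ : Set Y) := by
  have := hX.1
  let := metrizableSpaceMetric Y
  let L : ℕ → Set Y := fun n => ⋃ i ∈ Finset.range (n + 1), K i
  have hLX : ∀ n, IsPlaced X (L n) := fun n => hX.isPlaced_biUnion_finset hj hK hKX _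
  have hKL : ∀ n m, n ≤ m → K n ⊆ L m := fun n m h => by
    exact subset_biUnion_of_mem (u := K) (by simpa [Nat.lt_succ_iff] using h)
  obtain ⟨g, hg⟩ := exists_continuous_forall_mem_convex_of_local_const (E := ℝ)
    (t := fun y : Y => ⋂ n ∈ {n : ℕ | y ∉ L n}, Ici (n : ℝ))
    (fun y => convex_iInter₂ fun n _ => convex_Ici _) fun y => by
      obtain ⟨m, hm⟩ := hcov y
      refine ⟨m, mem_of_superset hm fun z hz => ?_⟩
      simp only [mem_iInter, mem_ofPred_eq, mem_Ici, Nat.cast_le]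
      intro n hn
      by_contra! h
      exact hn (hKL m n h.le hz)
  have hgL : ∀ y (n : ℕ), g y < n → y ∈ L n := fun y n hy => by
    by_contra h
    have := hg y
    simp only [mem_iInter, mem_ofPred_eq, mem_Ici] at this
    exact absurd (this n h) (not_le.2 hy)
  let h : Y → ℝ := fun y => max (g y) 0
  have hh : Continuous h := g.continuous.max continuous_const
  have h0 : ∀ y, 0 ≤ h y := fun y => le_max_right _ _
  have hlf : ∀ a : ℝ, LocallyFinite fun n : ℕ => Icc (2 * (n : ℝ) + a) (2 * (n : ℝ) + a + 1) :=
    fun a => by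
      refine locallyFinite_of_le_dist one_pos fun n m hnm x hx y hy => ?_
      rw [Real.dist_eq, le_abs]
      rcases lt_or_gt_of_ne hnm with hlt | hlt
      · have : (n : ℝ) + 1 ≤ m := by exact_mod_cast hlt
        right; linarith [hx.2, hy.1]
      · have : (m : ℝ) + 1 ≤ n := by exact_mod_cast hlt
        left; linarith [hx.1, hy.2]
  obtain ⟨d, hd, hdlf⟩ := exists_injective_nat_locallyFinite X hnc
  have key : ∀ a : ℝ, IsPlaced X (⋃ n : ℕ, h ⁻¹' Icc (2 * (n : ℝ) + a) (2 * (n : ℝ) + a + 1)) := by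
    intro a
    refine hX.isPlaced_iUnion hj (fun n => isClosed_Icc.preimage hh) (fun n => ?_)
      ((hlf a).preimage_continuous hh) (fun n m hnm => ?_) hd hdlf
    · obtain ⟨m, hm⟩ := exists_nat_gt (2 * n + a + 1)
      obtain ⟨f, hf, hfL⟩ := hLX m
      exact hX.isPlaced_of_subset (isClosed_Icc.preimage hh)
        (fun y hy => hgL y m ((le_max_left _ _).trans_lt (hy.2.trans_lt hm))) hfL
    · refine Disjoint.preimage h (Set.disjoint_left.2 fun x hx hy => ?_)
      rcases lt_or_gt_of_ne hnm with hlt | hlt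
      · have : (n : ℝ) + 1 ≤ m := by exact_mod_cast hlt
        linarith [hx.2, hy.1]
      · have : (m : ℝ) + 1 ≤ n := by exact_mod_cast hlt
        linarith [hx.1, hy.2]
  have hrings : ∀ a, IsClosed (⋃ n : ℕ, h ⁻¹' Icc (2 * (n : ℝ) + a) (2 * (n : ℝ) + a + 1)) :=
    fun a => ((hlf a).preimage_continuous hh).isClosed_iUnion fun n => isClosed_Icc.preimage hh
  have huniv : (⋃ n : ℕ, h ⁻¹' Icc (2 * (n : ℝ) + 0) (2 * (n : ℝ) + 0 + 1)) ∪
      (⋃ n : ℕ, h ⁻¹' Icc (2 * (n : ℝ) + 1) (2 * (n : ℝ) + 1 + 1)) = Set.univ := by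
    refine eq_univ_of_forall fun y => ?_
    have h1 := Nat.floor_le (h0 y)
    have h2 := Nat.lt_floor_add_one (h y)
    rcases Nat.even_or_odd' ⌊h y⌋₊ with ⟨m, hm | hm⟩
    all_goals
      rw [hm] at h1 h2
      push_cast at h1 h2
    · exact Or.inl (mem_iUnion.2 ⟨m, by linarith, by linarith⟩)
    · exact Or.inr (mem_iUnion.2 ⟨m, by linarith, by linarith⟩)
  rw [← huniv]
  exact hX.isPlaced_union hj (hrings 0) (hrings 1) (key 0) (key 1)

/-- A metrizable space of weight at most that of `X` which is locally closed embeddable in `X` is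
closed embeddable in `X`. -/
theorem exists_isClosedEmbedding_of_nhds [MetrizableSpace Y] (hX : IsAbsoluteRetract X)
    [Nontrivial X] (hnc : ¬ CompactSpace X) {j : X × X → X} (hj : IsClosedEmbedding j)
    (hw : tweight Y ≤ tweight X)
    (hloc : ∀ y : Y, ∃ N ∈ 𝓝 y, ∃ e : N → X, IsClosedEmbedding e) :
    ∃ e : Y → X, IsClosedEmbedding e := by
  have := hX.1
  let := metrizableSpaceMetric Y
  choose N hN e he using hloc
  obtain ⟨V, hVc, hVN, hVsep, hVcov⟩ := exists_closed_separated_refinement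
    (U := fun y => interior (N y)) (fun y => isOpen_interior)
    fun y => ⟨y, mem_interior_iff_mem_nhds.2 (hN y)⟩
  have hcl : ∀ n, LocallyFinite (V n) := fun n =>
    let ⟨_, hr, h⟩ := hVsep n
    locallyFinite_of_le_dist hr h
  have hplaced : ∀ n, IsPlaced X (⋃ y, V n y) := by
    intro n
    obtain ⟨r, hr, hsep⟩ := hVsep n
    let S := {y // (V n y).Nonempty}
    have hS : (⋃ y, V n y) = ⋃ s : S, V n s := by
      ext x
      simp only [mem_iUnion]
      exact ⟨fun ⟨y, hy⟩ => ⟨⟨y, x, hy⟩, hy⟩, fun ⟨s, hs⟩ => ⟨s, hs⟩⟩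
    have hcard : #S ≤ tweight X := by
      choose p hp using fun s : S => s.2
      exact (mk_le_tweight_of_le_dist hr fun (s t : S) hst =>
        hsep s t (Subtype.coe_injective.ne hst) _ (hp s) _ (hp t)).trans hw
    obtain ⟨d, hd, hdlf⟩ := exists_injective_locallyFinite hnc hj hcard
    rw [hS]
    refine hX.isPlaced_iUnion hj (fun s : S => hVc n s)
      (fun s => hX.isPlaced_of_subset (hVc n s) ((hVN n s).trans interior_subset) (he s))
      ((hcl n).comp_injective Subtype.coe_injective) (fun s t hst => ?_) hd hdlf
    refine Set.disjoint_left.2 fun x hx hy => ?_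
    have := hsep s t (Subtype.coe_injective.ne hst) x hx x hy
    rw [dist_self] at this
    linarith
  obtain ⟨f, -, hf⟩ := hX.isPlaced_univ_of_countable_cover hnc hj
    (fun n => (hcl n).isClosed_iUnion (hVc n)) hplaced fun y =>
      let ⟨n, i, hi⟩ := hVcov y
      ⟨n, mem_of_superset hi (subset_iUnion (V n) i)⟩
  exact ⟨_, hf.comp (Homeomorph.Set.univ Y).symm.isClosedEmbedding⟩

end IsAbsoluteRetract

end

/-- Let `X` be a noncompact AR containing a closed subset homeomorphic to `X × X`, and
let `Y` be metrizable with `w(Y) ≤ w(X)`. Then each of the conditions (A) "every point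
of `Y` has a neighbourhood closed embeddable in `X`" and (B) "`Y` is covered by a locally
finite family of closed sets, each closed embeddable in `X`" implies that `Y` admits a
closed embedding into `X`. -/
theorem closedEmbedding_of_local {X : Type} [TopologicalSpace X]
    (hAR : IsAbsoluteRetract X) (hnc : ¬ CompactSpace X)
    (A : Set X) (hA : IsClosed A) (hAX : Nonempty (A ≃ₜ X × X))
    {Y : Type} [TopologicalSpace Y] [TopologicalSpace.MetrizableSpace Y]
    (hw : tweight Y ≤ tweight X) :
    ((∀ y : Y, ∃ N : Set Y, N ∈ nhds y ∧ ∃ e : N → X, Topology.IsClosedEmbedding e) →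
      ∃ e : Y → X, Topology.IsClosedEmbedding e) ∧
    ((∃ (ι : Type) (C : ι → Set Y), (∀ i, IsClosed (C i)) ∧ (⋃ i, C i) = Set.univ ∧
        LocallyFinite C ∧ ∀ i, ∃ e : C i → X, Topology.IsClosedEmbedding e) →
      ∃ e : Y → X, Topology.IsClosedEmbedding e) := by
  have := hAR.1
  have : Nontrivial X := by
    by_contra h
    rw [not_nontrivial_iff_subsingleton] at h
    exact hnc inferInstance
  obtain ⟨φ⟩ := hAX
  have hj : Topology.IsClosedEmbedding (Subtype.val ∘ φ.symm : X × X → X) :=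
    hA.isClosedEmbedding_subtypeVal.comp φ.symm.isClosedEmbedding
  refine ⟨hAR.exists_isClosedEmbedding_of_nhds hnc hj hw, ?_⟩
  rintro ⟨ι, C, hC, hcov, hlf, hCX⟩
  have hplaced : ∀ i, IsPlaced X (C i) := fun i =>
    let ⟨_, he⟩ := hCX i
    hAR.isPlaced (hC i) he
  refine hAR.exists_isClosedEmbedding_of_nhds hnc hj hw fun y => ?_
  obtain ⟨s, hs, hsf⟩ := hlf y
  obtain ⟨f, -, hf⟩ := hAR.isPlaced_biUnion_finset hj hC hplaced hsf.toFinset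
  refine ⟨_, Filter.mem_of_superset hs fun x hx => ?_, _, hf⟩
  obtain ⟨i, hi⟩ := Set.mem_iUnion.1 (hcov ▸ Set.mem_univ x)
  exact Set.mem_biUnion (by simpa using ⟨x, hi, hx⟩) hi
end

section
/- Let X be an ANR such that every point of X has an open neighbourhood which is homeomorphic to a homotopy dense subset of some Hilbert manifold, and such that w(U) = w(X) for every nonempty open subset U of X. Then X itself is homeomorphic to a homotopy dense subset of a Hilbert manifold. -/
open Cardinal unitInterval

/-- A metrizable space `X` is an ANR (absolute neighbourhood retract for metrizable
spaces): every continuous map into `X` from a closed subset of a metrizable space extends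
continuously to some open set containing that closed subset. -/
def IsANR (X : Type u) [TopologicalSpace X] : Prop :=
  TopologicalSpace.MetrizableSpace X ∧
  ∀ (Z : Type u) (_ : TopologicalSpace Z), TopologicalSpace.MetrizableSpace Z →
    ∀ B : Set Z, IsClosed B → ∀ f : B → X, Continuous f →
      ∃ U : Set Z, IsOpen U ∧ B ⊆ U ∧ ∃ g : U → X, Continuous g ∧
        ∀ (z : Z) (hB : z ∈ B) (hU : z ∈ U), g ⟨z, hU⟩ = f ⟨z, hB⟩

/-- A subset `A` of `Y` is homotopy dense in `Y` if there is a homotopy `H : Y × I → Y`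
with `H(y,0) = y` and `H(Y × (0,1]) ⊆ A`. -/
def HomotopyDense {Y : Type*} [TopologicalSpace Y] (A : Set Y) : Prop :=
  ∃ H : Y × I → Y, Continuous H ∧ (∀ y : Y, H (y, 0) = y) ∧
    ∀ (y : Y) (t : I), t ≠ 0 → H (y, t) ∈ A

/-- A Hilbert manifold: a paracompact Hausdorff space each point of which has an open
neighbourhood homeomorphic to an open subset of an infinite-dimensional real Hilbert
space. -/
def IsHilbertManifold (M : Type) [TopologicalSpace M] : Prop :=
  ParacompactSpace M ∧ T2Space M ∧ ∀ x : M, ∃ U : Set M, IsOpen U ∧ x ∈ U ∧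
    ∃ (H : Type) (_ : NormedAddCommGroup H) (_ : InnerProductSpace ℝ H)
      (_ : CompleteSpace H), ¬ FiniteDimensional ℝ H ∧
        ∃ V : Set H, IsOpen V ∧ Nonempty (U ≃ₜ V)

/-- `X` is homeomorphic to a homotopy dense subset of some Hilbert manifold. -/
def EmbedsHomotopyDenselyInHilbertManifold (X : Type) [TopologicalSpace X] : Prop :=
  ∃ (M : Type) (_ : TopologicalSpace M), IsHilbertManifold M ∧
    ∃ A : Set M, HomotopyDense A ∧ Nonempty (X ≃ₜ A)

set_option linter.unusedSectionVars false

open scoped ZeroAtInfty Topology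

namespace C0

variable {ι : Type*} [TopologicalSpace ι] [DiscreteTopology ι]

theorem finite_le_abs (x : C₀(ι, ℝ)) {ε : ℝ} (hε : 0 < ε) : {i | ε ≤ |x i|}.Finite := by
  have h := x.zero_at_infty'
  rw [Filter.cocompact_eq_cofinite] at h
  have h2 := h (Metric.ball_mem_nhds (0 : ℝ) hε)
  rw [Filter.mem_map, Filter.mem_cofinite] at h2
  refine h2.subset fun i (hi : ε ≤ |x i|) => ?_
  simp only [Set.mem_compl_iff, Set.mem_preimage, Metric.mem_ball, dist_zero_right,
    Real.norm_eq_abs, not_lt]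
  exact hi

/-- A function on a discrete space all of whose superlevel sets are finite vanishes at infinity. -/
noncomputable def ofFinite (f : ι → ℝ) (hf : ∀ ε > 0, {i | ε ≤ |f i|}.Finite) : C₀(ι, ℝ) where
  toFun := f
  continuous_toFun := continuous_of_discreteTopology
  zero_at_infty' := by
    rw [Filter.cocompact_eq_cofinite, Metric.tendsto_nhds]
    intro ε hε
    rw [Filter.eventually_cofinite]
    refine (hf ε hε).subset fun i hi => ?_
    simpa using hi

@[simp] theorem ofFinite_apply (f : ι → ℝ) (hf : ∀ ε > 0, {i | ε ≤ |f i|}.Finite) (i : ι) :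
    ofFinite f hf i = f i := rfl

theorem abs_le_norm (x : C₀(ι, ℝ)) (i : ι) : |x i| ≤ ‖x‖ := by
  rw [← ZeroAtInftyContinuousMap.norm_toBCF_eq_norm]
  exact x.toBCF.norm_coe_le_norm i

theorem norm_le {x : C₀(ι, ℝ)} {c : ℝ} (hc : 0 ≤ c) : ‖x‖ ≤ c ↔ ∀ i, |x i| ≤ c := by
  rw [← ZeroAtInftyContinuousMap.norm_toBCF_eq_norm]
  exact BoundedContinuousFunction.norm_le hc

theorem norm_sub_le {x y : C₀(ι, ℝ)} {c : ℝ} (hc : 0 ≤ c) : ‖x - y‖ ≤ c ↔ ∀ i, |x i - y i| ≤ c :=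
  norm_le hc

theorem abs_sub_le_norm (x y : C₀(ι, ℝ)) (i : ι) : |x i - y i| ≤ ‖x - y‖ :=
  abs_le_norm (x - y) i

/-- Evaluation at a coordinate, as a continuous linear map. -/
noncomputable def eval (i : ι) : C₀(ι, ℝ) →L[ℝ] ℝ :=
  LinearMap.mkContinuous ⟨⟨fun x => x i, fun _ _ => rfl⟩, fun _ _ => rfl⟩ 1
    (fun x => by simpa using abs_le_norm x i)

@[simp] theorem eval_apply (i : ι) (x : C₀(ι, ℝ)) : eval i x = x i := rfl

theorem continuous_apply (i : ι) : Continuous fun x : C₀(ι, ℝ) => x i := (eval i).continuous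

open Classical in
/-- The element with a single nonzero coordinate. -/
noncomputable def single (i : ι) (a : ℝ) : C₀(ι, ℝ) :=
  ofFinite (Pi.single i a) fun ε hε => (Set.finite_singleton i).subset fun j hj => by
    by_contra h
    have : j ≠ i := h
    simp [this] at hj
    linarith

@[simp] theorem single_same (i : ι) (a : ℝ) : single i a i = a := by simp [single]

theorem single_of_ne {i j : ι} (h : j ≠ i) (a : ℝ) : single i a j = 0 := by
  simp [single, h]

open Classical in
theorem single_apply (i j : ι) (a : ℝ) : single i a j = if j = i then a else 0 := by
  by_cases h : j = i
  · subst h; simp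
  · simp [h, single_of_ne h]

theorem sum_apply {κ : Type*} (T : Finset κ) (f : κ → C₀(ι, ℝ)) (i : ι) :
    (∑ k ∈ T, f k) i = ∑ k ∈ T, f k i := by
  exact map_sum (eval i) f T

end C0

namespace C0
variable {ι : Type*} [TopologicalSpace ι] [DiscreteTopology ι]

/-- Soft thresholding of a real number at level `|s|`. -/
noncomputable def soft (s a : ℝ) : ℝ := a - max (-|s|) (min |s| a)

theorem abs_soft_sub_soft_le (s s' a b : ℝ) : |soft s a - soft s' b| ≤ |s - s'| + |a - b| := by
  have h := abs_abs_sub_abs_le s s'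
  have h0 := abs_nonneg s
  have h0' := abs_nonneg s'
  simp only [soft]
  generalize |s| = t at *
  generalize |s'| = t' at *
  generalize |s - s'| = d at *
  rw [abs_le] at h ⊢
  have h2 := neg_abs_le (a - b)
  have h3 := le_abs_self (a - b)
  generalize |a - b| = e at *
  simp only [max_def, min_def]
  constructor <;> split_ifs <;> linarith

theorem soft_eq_zero {s a : ℝ} (h : |a| ≤ s) : soft s a = 0 := by
  have hs : 0 ≤ s := (abs_nonneg a).trans h
  rw [soft, abs_of_nonneg hs, min_eq_right (le_of_abs_le h), max_eq_right (neg_le_of_abs_le h),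
    sub_self]

theorem soft_zero_left (a : ℝ) : soft 0 a = a := by
  rcases le_total a 0 with h | h <;> simp [soft, h]

/-- Coordinatewise soft thresholding. -/
noncomputable def thr (s : ℝ) (x : C₀(ι, ℝ)) : C₀(ι, ℝ) :=
  ofFinite (fun i => soft s (x i)) fun ε hε => (finite_le_abs x hε).subset fun i hi => by
    have h := abs_soft_sub_soft_le s s (x i) 0
    have h0 : soft s 0 = 0 := by simp [soft]
    simp only [h0, sub_self, abs_zero, zero_add, sub_zero] at h
    exact le_trans (show ε ≤ |soft s (x i)| from hi) h

@[simp] theorem thr_apply (s : ℝ) (x : C₀(ι, ℝ)) (i : ι) : thr s x i = soft s (x i) := rfl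

theorem norm_thr_sub_thr_le (s s' : ℝ) (x x' : C₀(ι, ℝ)) :
    ‖thr s x - thr s' x'‖ ≤ |s - s'| + ‖x - x'‖ := by
  refine (norm_sub_le (by positivity)).2 fun i => ?_
  exact (abs_soft_sub_soft_le _ _ _ _).trans (by gcongr; exact abs_sub_le_norm x x' i)

theorem thr_zero_left (x : C₀(ι, ℝ)) : thr 0 x = x := by
  ext i; simp [soft_zero_left]

theorem continuous_thr : Continuous fun p : C₀(ι, ℝ) × ℝ => thr p.2 p.1 := by
  rw [Metric.continuous_iff]
  intro p ε hε
  refine ⟨ε / 2, by positivity, fun q hq => ?_⟩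
  rw [dist_eq_norm]
  rw [Prod.dist_eq, max_lt_iff, dist_eq_norm, Real.dist_eq] at hq
  linarith [norm_thr_sub_thr_le q.2 p.2 q.1 p.1]

/-- The weight measuring how close the thresholding of `x` comes to the zeros of the `u k`. -/
noncomputable def wt (u : ℕ → C₀(ι, ℝ) → ℝ) (x : C₀(ι, ℝ)) (s : ℝ) : ℝ :=
  ∑' k : ℕ, (1 / 2 : ℝ) ^ (k + 1) * (s / max s (u k (thr s x)))

theorem summable_half : Summable fun k : ℕ => (1 / 2 : ℝ) ^ (k + 1) :=
  (summable_nat_add_iff 1).2 summable_geometric_two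

theorem tsum_half : ∑' k : ℕ, (1 / 2 : ℝ) ^ (k + 1) = 1 := by
  have := tsum_geometric_two' 1
  simp only [pow_succ]
  rw [tsum_mul_right, tsum_geometric_two]; norm_num

theorem div_max_nonneg {s : ℝ} (hs : 0 ≤ s) (a : ℝ) : 0 ≤ s / max s a :=
  div_nonneg hs (hs.trans (le_max_left _ _))

theorem div_max_le_one {s : ℝ} (hs : 0 ≤ s) (a : ℝ) : s / max s a ≤ 1 :=
  div_le_one_of_le₀ (le_max_left _ _) (hs.trans (le_max_left _ _))

variable {u : ℕ → C₀(ι, ℝ) → ℝ}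

theorem wt_term_nonneg (x : C₀(ι, ℝ)) {s : ℝ} (hs : 0 ≤ s) (k : ℕ) :
    0 ≤ (1 / 2 : ℝ) ^ (k + 1) * (s / max s (u k (thr s x))) :=
  mul_nonneg (by positivity) (div_max_nonneg hs _)

theorem wt_term_le (x : C₀(ι, ℝ)) {s : ℝ} (hs : 0 ≤ s) (k : ℕ) :
    (1 / 2 : ℝ) ^ (k + 1) * (s / max s (u k (thr s x))) ≤ (1 / 2 : ℝ) ^ (k + 1) :=
  mul_le_of_le_one_right (by positivity) (div_max_le_one hs _)

theorem summable_wt (x : C₀(ι, ℝ)) {s : ℝ} (hs : 0 ≤ s) :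
    Summable fun k : ℕ => (1 / 2 : ℝ) ^ (k + 1) * (s / max s (u k (thr s x))) :=
  summable_half.of_nonneg_of_le (wt_term_nonneg x hs) (wt_term_le x hs)

theorem wt_nonneg (x : C₀(ι, ℝ)) {s : ℝ} (hs : 0 ≤ s) : 0 ≤ wt u x s :=
  tsum_nonneg (wt_term_nonneg x hs)

theorem wt_zero (x : C₀(ι, ℝ)) : wt u x 0 = 0 := by simp [wt]

theorem wt_mono (hu1 : ∀ k x y, |u k x - u k y| ≤ ‖x - y‖) (x : C₀(ι, ℝ)) {s s' : ℝ}
    (hs : 0 ≤ s) (hss : s ≤ s') : wt u x s ≤ wt u x s' := by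
  rcases hs.eq_or_lt with rfl | hs
  · rw [wt_zero]; exact wt_nonneg x hss
  refine (summable_wt x hs.le).tsum_le_tsum (fun k => ?_) (summable_wt x (hs.le.trans hss))
  have h1 : u k (thr s' x) ≤ u k (thr s x) + (s' - s) := by
    have h := (abs_le.1 ((hu1 k (thr s' x) (thr s x)).trans (norm_thr_sub_thr_le s' s x x))).2
    rw [sub_self, norm_zero, add_zero, abs_of_nonneg (sub_nonneg.2 hss)] at h
    linarith
  gcongr ?_ * ?_
  have hs' : 0 < s' := hs.trans_le hss
  rcases le_total (u k (thr s' x)) s' with h | h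
  · rw [max_eq_left h, div_self hs'.ne']; exact div_max_le_one hs.le _
  · rw [max_eq_right h, div_le_div_iff₀ (lt_max_of_lt_left hs) (hs'.trans_le h)]
    nlinarith [le_max_left s (u k (thr s x)), le_max_right s (u k (thr s x))]

theorem wt_sub_le (hu1 : ∀ k x y, |u k x - u k y| ≤ ‖x - y‖) (x x' : C₀(ι, ℝ)) {s : ℝ}
    (hs : 0 < s) : wt u x s ≤ wt u x' s + ‖thr s x - thr s x'‖ / s := by
  have h2 : wt u x' s + ‖thr s x - thr s x'‖ / s = ∑' k : ℕ, ((1 / 2 : ℝ) ^ (k + 1) *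
      (s / max s (u k (thr s x'))) + (1 / 2 : ℝ) ^ (k + 1) * (‖thr s x - thr s x'‖ / s)) := by
    rw [(summable_wt x' hs.le).tsum_add (summable_half.mul_right _), tsum_mul_right, tsum_half,
      one_mul, wt]
  rw [h2]
  refine (summable_wt x hs.le).tsum_le_tsum (fun k => ?_)
    ((summable_wt x' hs.le).add (summable_half.mul_right _))
  rw [← mul_add]
  gcongr ?_ * ?_
  have h := hu1 k (thr s x) (thr s x')
  generalize ‖thr s x - thr s x'‖ = d at *
  generalize u k (thr s x) = a at *
  generalize u k (thr s x') = b at *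
  have ha := le_max_left s a
  have hb := le_max_left s b
  have hab : max s b - max s a ≤ d := by
    have := abs_le.1 h
    have h4 : max s b ≤ max s a + d := by
      apply max_le
      · linarith [abs_nonneg (a - b)]
      · linarith [le_max_right s a]
    linarith
  have hd : 0 ≤ d := (abs_nonneg _).trans h
  generalize max s a = A at *
  generalize max s b = B at *
  have hA : 0 < A := hs.trans_le ha
  have hB : 0 < B := hs.trans_le hb
  rw [div_add_div _ _ hB.ne' hs.ne', div_le_div_iff₀ hA (by positivity)]
  have e1 : s * s * (B - A) ≤ s * s * d := by gcongr
  have e2 : s * s * d ≤ A * B * d := by gcongr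
  nlinarith

theorem continuous_of_lip (hu1 : ∀ k x y, |u k x - u k y| ≤ ‖x - y‖) (k : ℕ) :
    Continuous (u k) := by
  refine LipschitzWith.continuous (K := 1) (LipschitzWith.of_dist_le_mul fun x y => ?_)
  simpa [Real.dist_eq, dist_eq_norm] using hu1 k x y

theorem continuousOn_wt (hu1 : ∀ k x y, |u k x - u k y| ≤ ‖x - y‖) :
    ContinuousOn (fun p : C₀(ι, ℝ) × ℝ => wt u p.1 p.2)
      {p | 0 ≤ p.2 ∧ (0 < p.2 ∨ ∀ k, 0 < u k p.1)} := by
  refine continuousOn_tsum (u := fun k : ℕ => (1 / 2 : ℝ) ^ (k + 1)) (fun k => ?_) summable_half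
    (fun k p hp => ?_)
  · refine ContinuousOn.mul continuousOn_const (ContinuousOn.div continuousOn_snd ?_ ?_)
    · exact (continuous_snd.max ((continuous_of_lip hu1 k).comp continuous_thr)).continuousOn
    · rintro p ⟨h0, h | h⟩
      · exact (lt_max_of_lt_left h).ne'
      · rcases h0.eq_or_lt with h1 | h1
        · rw [← h1, thr_zero_left]; exact (lt_max_of_lt_right (h k)).ne'
        · exact (lt_max_of_lt_left h1).ne'
  · rw [Real.norm_of_nonneg (wt_term_nonneg _ hp.1 k)]
    exact wt_term_le _ hp.1 k

theorem half_pow_le_wt (hu1 : ∀ k x y, |u k x - u k y| ≤ ‖x - y‖) (x : C₀(ι, ℝ)) {s : ℝ}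
    (hs : 0 < s) {k : ℕ} (hk : u k x ≤ 0) : (1 / 2 : ℝ) ^ (k + 1) ≤ wt u x s := by
  refine le_trans ?_ ((summable_wt x hs.le).le_tsum k fun j _ => wt_term_nonneg x hs.le j)
  have h := (abs_le.1 ((hu1 k (thr s x) (thr 0 x)).trans (norm_thr_sub_thr_le s 0 x x))).2
  rw [thr_zero_left, sub_self, norm_zero, add_zero, sub_zero, abs_of_pos hs] at h
  rw [max_eq_left (by linarith), div_self hs.ne', mul_one]

theorem exists_wt_lt (hu1 : ∀ k x y, |u k x - u k y| ≤ ‖x - y‖) {x₀ : C₀(ι, ℝ)}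
    (hx : ∀ k, 0 < u k x₀) {ε : ℝ} (hε : 0 < ε) :
    ∃ δ > 0, ∀ x, (∀ k, 0 < u k x) → ‖x - x₀‖ < δ → ∀ s, 0 ≤ s → s < δ → wt u x s < ε := by
  have h := continuousOn_wt hu1 (x₀, 0) ⟨le_rfl, Or.inr hx⟩
  rw [Metric.continuousWithinAt_iff] at h
  obtain ⟨δ, hδ, h⟩ := h ε hε
  refine ⟨δ, hδ, fun x hxu hxd s hs hsd => ?_⟩
  have := h (x := (x, s)) ⟨hs, Or.inr hxu⟩ (by
    rw [Prod.dist_eq, max_lt_iff, dist_eq_norm, Real.dist_eq]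
    simpa [abs_of_nonneg hs] using ⟨hxd, hsd⟩)
  rw [wt_zero, Real.dist_eq, sub_zero] at this
  exact (le_abs_self _).trans_lt this

/-- The coordinates of the expansion map. -/
noncomputable def expand (u : ℕ → C₀(ι, ℝ) → ℝ) (x : C₀(ι, ℝ)) (i : ι) : ℝ :=
  x i + x i / |x i| * wt u x |x i|

theorem expand_eq (x : C₀(ι, ℝ)) (i : ι) :
    expand u x i = x i / |x i| * (|x i| + wt u x |x i|) := by
  rw [expand, mul_add]
  congr 1
  by_cases h : x i = 0
  · simp [h]
  · rw [div_mul_cancel₀ _ (abs_ne_zero.2 h)]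

theorem expand_of_eq_zero {x : C₀(ι, ℝ)} {i : ι} (h : x i = 0) : expand u x i = 0 := by
  simp [expand, h]

theorem abs_expand (x : C₀(ι, ℝ)) (i : ι) : |expand u x i| = |x i| + wt u x |x i| := by
  by_cases h : x i = 0
  · simp [expand, h, wt_zero]
  · rw [expand_eq, abs_mul, abs_div, abs_abs, div_self (abs_ne_zero.2 h), one_mul, abs_of_nonneg]
    exact add_nonneg (abs_nonneg _) (wt_nonneg _ (abs_nonneg _))

theorem abs_le_abs_expand (x : C₀(ι, ℝ)) (i : ι) : |x i| ≤ |expand u x i| := by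
  rw [abs_expand]; linarith [wt_nonneg (u := u) x (abs_nonneg (x i))]

theorem expand_pos {x : C₀(ι, ℝ)} {i : ι} (h : 0 ≤ x i) :
    expand u x i = x i + wt u x (x i) := by
  rcases h.eq_or_lt with h | h
  · simp [expand, ← h, wt_zero]
  · rw [expand, abs_of_pos h, div_self h.ne', one_mul]

theorem expand_neg {x : C₀(ι, ℝ)} {i : ι} (h : x i ≤ 0) :
    expand u x i = x i - wt u x (-x i) := by
  rcases h.eq_or_lt with h | h
  · simp [expand, h, wt_zero]
  · rw [expand, abs_of_neg h, div_neg, div_self h.ne, neg_one_mul, sub_eq_add_neg]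

theorem continuousAt_expand (hu1 : ∀ k x y, |u k x - u k y| ≤ ‖x - y‖) {x₀ : C₀(ι, ℝ)} {i : ι}
    (hi : x₀ i ≠ 0) : ContinuousAt (fun x => expand u x i) x₀ := by
  have hc := (continuous_apply (ι := ι) i).continuousAt (x := x₀)
  refine hc.add ((hc.div hc.abs (abs_ne_zero.2 hi)).mul ?_)
  have hW : ContinuousAt (fun p : C₀(ι, ℝ) × ℝ => wt u p.1 p.2) (x₀, |x₀ i|) := by
    refine (continuousOn_wt hu1).continuousAt ?_
    refine Filter.mem_of_superset ((isOpen_lt continuous_const continuous_snd).mem_nhds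
      (show (0 : ℝ) < |x₀ i| from abs_pos.2 hi)) fun p hp => ⟨le_of_lt hp, Or.inl hp⟩
  exact ContinuousAt.comp (f := fun x : C₀(ι, ℝ) => (x, |x i|)) hW
    (continuousAt_id.prodMk hc.abs)

end C0

namespace C0
variable {ι : Type*} [TopologicalSpace ι] [DiscreteTopology ι]
variable {u : ℕ → C₀(ι, ℝ) → ℝ}

theorem finite_le_abs_expand (hu1 : ∀ k x y, |u k x - u k y| ≤ ‖x - y‖) {x : C₀(ι, ℝ)}
    (hx : ∀ k, 0 < u k x) {ε : ℝ} (hε : 0 < ε) : {i | ε ≤ |expand u x i|}.Finite := by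
  obtain ⟨δ, hδ, h⟩ := exists_wt_lt hu1 hx (half_pos hε)
  refine (finite_le_abs x (lt_min hδ (half_pos hε))).subset fun i (hi : ε ≤ |expand u x i|) => ?_
  by_contra hc
  have hc' : |x i| < min δ (ε / 2) := not_le.1 hc
  rw [lt_min_iff] at hc'
  have := h x hx (by simpa using hδ) _ (abs_nonneg (x i)) hc'.1
  rw [abs_expand] at hi
  linarith

/-- The expansion map, defined where all the functions `u k` are positive. -/
noncomputable def expandMap (hu1 : ∀ k x y, |u k x - u k y| ≤ ‖x - y‖)
    (x : {x : C₀(ι, ℝ) | ∀ k, 0 < u k x}) : C₀(ι, ℝ) :=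
  ofFinite (expand u x.1) fun _ hε => finite_le_abs_expand hu1 x.2 hε

@[simp] theorem expandMap_apply (hu1 : ∀ k x y, |u k x - u k y| ≤ ‖x - y‖)
    (x : {x : C₀(ι, ℝ) | ∀ k, 0 < u k x}) (i : ι) : expandMap hu1 x i = expand u x.1 i := rfl

theorem continuous_expandMap (hu1 : ∀ k x y, |u k x - u k y| ≤ ‖x - y‖) :
    Continuous (expandMap hu1) := by
  rw [continuous_iff_continuousAt]
  intro x₀
  rw [Metric.continuousAt_iff']
  intro ε hε
  obtain ⟨δ₁, hδ₁, h⟩ := exists_wt_lt hu1 x₀.2 (show 0 < ε / 8 by positivity)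
  obtain ⟨δ, hδ, hd1, hd2⟩ : ∃ δ > 0, δ ≤ δ₁ ∧ δ ≤ ε / 8 :=
    ⟨min δ₁ (ε / 8), by positivity, min_le_left _ _, min_le_right _ _⟩
  have hJ := finite_le_abs x₀.1 (half_pos hδ)
  have h1 : ∀ᶠ x in 𝓝 x₀, ∀ i ∈ hJ.toFinset, |expand u x.1 i - expand u x₀.1 i| < ε / 2 := by
    rw [Filter.eventually_all_finset]
    intro i hi
    have hi' : δ / 2 ≤ |x₀.1 i| := by simpa using hi
    have hc := (continuousAt_expand hu1 (abs_pos.1 ((half_pos hδ).trans_le hi'))).comp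
      (continuous_subtype_val.continuousAt (x := x₀))
    exact Metric.continuousAt_iff'.1 hc (ε / 2) (half_pos hε)
  have h2 : ∀ᶠ x in 𝓝 x₀, ‖x.1 - x₀.1‖ < δ / 2 := by
    have := Metric.continuousAt_iff'.1 (continuous_subtype_val.continuousAt (x := x₀)) (δ / 2)
      (half_pos hδ)
    simpa [dist_eq_norm] using this
  filter_upwards [h1, h2] with x hx1 hx2
  rw [dist_eq_norm]
  refine lt_of_le_of_lt ((norm_sub_le (half_pos hε).le).2 fun i => ?_) (half_lt_self hε)
  by_cases hi : i ∈ hJ.toFinset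
  · exact (hx1 i hi).le
  · have hi' : |x₀.1 i| < δ / 2 := by simpa using hi
    have hxi : |x.1 i| < δ := by
      have := abs_sub_le_norm x.1 x₀.1 i
      have h3 := abs_sub_abs_le_abs_sub (x.1 i) (x₀.1 i)
      linarith
    have a1 := h x.1 x.2 (by linarith) _ (abs_nonneg (x.1 i)) (by linarith)
    have a2 := h x₀.1 x₀.2 (by simpa using hδ₁) _ (abs_nonneg (x₀.1 i)) (by linarith)
    have b1 := abs_expand (u := u) x.1 i
    have b2 := abs_expand (u := u) x₀.1 i
    have b3 := abs_sub (expand u x.1 i) (expand u x₀.1 i)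
    simp only [expandMap_apply]
    linarith

theorem abs_sub_le_of_abs_le (hu1 : ∀ k x y, |u k x - u k y| ≤ ‖x - y‖) {x x' : C₀(ι, ℝ)} {i : ι}
    {η : ℝ} (h : |expand u x i - expand u x' i| ≤ η) (h0 : 0 < |x' i|) (hxx : |x i| ≤ |x' i|) :
    |x i - x' i| ≤ η + ‖thr (|x' i|) x - thr (|x' i|) x'‖ / |x' i| := by
  have hm := wt_mono hu1 x (abs_nonneg (x i)) hxx
  have hs := wt_sub_le hu1 x x' h0
  have hd : 0 ≤ ‖thr (|x' i|) x - thr (|x' i|) x'‖ / |x' i| := by positivity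
  have hn := wt_nonneg (u := u) x (abs_nonneg (x i))
  have hn' := wt_nonneg (u := u) x' (abs_nonneg (x' i))
  generalize ‖thr (|x' i|) x - thr (|x' i|) x'‖ / |x' i| = d at *
  rw [abs_le] at h ⊢
  rcases le_total 0 (x i) with h1 | h1 <;> rcases le_total 0 (x' i) with h2 | h2
  · rw [expand_pos h1, expand_pos h2] at h
    simp only [abs_of_nonneg h1, abs_of_nonneg h2] at *
    constructor <;> linarith
  · rw [expand_pos h1, expand_neg h2] at h
    simp only [abs_of_nonneg h1, abs_of_nonpos h2] at *
    constructor <;> linarith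
  · rw [expand_neg h1, expand_pos h2] at h
    simp only [abs_of_nonpos h1, abs_of_nonneg h2] at *
    constructor <;> linarith
  · rw [expand_neg h1, expand_neg h2] at h
    simp only [abs_of_nonpos h1, abs_of_nonpos h2] at *
    constructor <;> linarith

theorem abs_sub_le_max (hu1 : ∀ k x y, |u k x - u k y| ≤ ‖x - y‖) {x x' : C₀(ι, ℝ)} {i : ι}
    {η : ℝ} (h : |expand u x i - expand u x' i| ≤ η) (h0 : 0 < max |x i| |x' i|) :
    |x i - x' i| ≤ η + ‖thr (max |x i| |x' i|) x - thr (max |x i| |x' i|) x'‖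
      / max |x i| |x' i| := by
  rcases le_total |x i| |x' i| with hxx | hxx
  · rw [max_eq_right hxx] at h0 ⊢
    exact abs_sub_le_of_abs_le hu1 h h0 hxx
  · rw [max_eq_left hxx] at h0 ⊢
    rw [abs_sub_comm, norm_sub_rev]
    rw [abs_sub_comm] at h
    exact abs_sub_le_of_abs_le hu1 h h0 hxx

theorem abs_sub_le_pow (hu1 : ∀ k x y, |u k x - u k y| ≤ ‖x - y‖) {x x' : C₀(ι, ℝ)}
    {η : ℝ} (h : ∀ i, |expand u x i - expand u x' i| ≤ η) {s : ℝ} (hs : 0 < s) (S : Finset ι)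
    (hS : ∀ i ∉ S, max |x i| |x' i| < s) (n : ℕ) :
    ∀ i, s ≤ max |x i| |x' i| → (S.filter fun j => max |x i| |x' i| < max |x j| |x' j|).card ≤ n →
      |x i - x' i| ≤ η * (1 + 1 / s) ^ n := by
  induction n with
  | zero =>
    intro i hi hn
    have hη : 0 ≤ η := (abs_nonneg _).trans (h i)
    have hn' := Finset.filter_eq_empty_iff.1 (Finset.card_eq_zero.1 (Nat.le_zero.1 hn))
    have := abs_sub_le_max hu1 (h i) (hs.trans_le hi)
    have h0 : thr (max |x i| |x' i|) x = thr (max |x i| |x' i|) x' := by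
      ext j
      have hj : max |x j| |x' j| ≤ max |x i| |x' i| := by
        by_cases hjS : j ∈ S
        · exact not_lt.1 (hn' hjS)
        · exact ((hS j hjS).trans_le hi).le
      rw [max_le_iff] at hj
      simp only [thr_apply, soft_eq_zero hj.1, soft_eq_zero hj.2]
    simpa [h0] using this
  | succ n ih =>
    intro i hi hn
    have hη : 0 ≤ η := (abs_nonneg _).trans (h i)
    have hm : 0 < max |x i| |x' i| := hs.trans_le hi
    refine (abs_sub_le_max hu1 (h i) hm).trans ?_
    have h0 : ‖thr (max |x i| |x' i|) x - thr (max |x i| |x' i|) x'‖ ≤ η * (1 + 1 / s) ^ n := by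
      refine (norm_sub_le (by positivity)).2 fun j => ?_
      simp only [thr_apply]
      by_cases hj : max |x j| |x' j| ≤ max |x i| |x' i|
      · rw [max_le_iff] at hj
        rw [soft_eq_zero hj.1, soft_eq_zero hj.2]
        simp only [sub_self, abs_zero]
        positivity
      · rw [not_le] at hj
        refine (abs_soft_sub_soft_le _ _ _ _).trans ?_
        rw [sub_self, abs_zero, zero_add]
        refine ih j (hi.trans hj.le) (Nat.le_of_lt_succ (lt_of_lt_of_le ?_ hn))
        refine Finset.card_lt_card (Finset.ssubset_iff_of_subset (fun l hl => ?_) |>.2 ⟨j, ?_, ?_⟩)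
        · rw [Finset.mem_filter] at hl ⊢
          exact ⟨hl.1, hj.trans hl.2⟩
        · rw [Finset.mem_filter]
          refine ⟨by_contra fun hjS => ?_, hj⟩
          exact absurd (hS j hjS) (not_lt.2 (hi.trans hj.le))
        · rw [Finset.mem_filter]
          exact fun hh => lt_irrefl _ hh.2
    have h1 : ‖thr (max |x i| |x' i|) x - thr (max |x i| |x' i|) x'‖ / max |x i| |x' i|
        ≤ η * (1 + 1 / s) ^ n / s := by gcongr
    have h2 : η ≤ η * (1 + 1 / s) ^ n :=
      le_mul_of_one_le_right hη (one_le_pow₀ (by simp [hs.le]))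
    rw [pow_succ, ← mul_assoc, mul_add, mul_one, mul_one_div]
    linarith

theorem exists_expand_stable (hu1 : ∀ k x y, |u k x - u k y| ≤ ‖x - y‖) (y : C₀(ι, ℝ)) {ε : ℝ}
    (hε : 0 < ε) : ∃ η > 0, ∀ x x' : C₀(ι, ℝ), (∀ i, |expand u x i - y i| ≤ η) →
      (∀ i, |expand u x' i - y i| ≤ η) → ‖x - x'‖ ≤ ε := by
  set s := ε / 2 with hs
  have hs0 : 0 < s := half_pos hε
  have hJ := finite_le_abs y (half_pos hs0)
  set K := hJ.toFinset.card
  have hp : 0 < (1 + 1 / s) ^ K := by positivity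
  refine ⟨min (s / 4) (ε / (2 * (1 + 1 / s) ^ K)), by positivity, fun x x' hx hx' => ?_⟩
  refine (norm_sub_le hε.le).2 fun i => ?_
  have key : ∀ x : C₀(ι, ℝ), (∀ i, |expand u x i - y i| ≤ min (s / 4)
      (ε / (2 * (1 + 1 / s) ^ K))) → ∀ j ∉ hJ.toFinset, |x j| < s := fun x hx j hj => by
    have hj' : |y j| < s / 2 := by simpa using hj
    have h1 := (hx j).trans (min_le_left _ _)
    have h2 := abs_sub_abs_le_abs_sub (expand u x j) (y j)
    have h3 := abs_le_abs_expand (u := u) x j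
    linarith
  by_cases hi : s ≤ max |x i| |x' i|
  · have hh : ∀ i, |expand u x i - expand u x' i| ≤ ε / (1 + 1 / s) ^ K := fun j => by
      have h1 := (hx j).trans (min_le_right _ _)
      have h2 := (hx' j).trans (min_le_right _ _)
      rw [abs_sub_comm] at h2
      have h3 := abs_sub_le (expand u x j) (y j) (expand u x' j)
      have h4 : ε / (1 + 1 / s) ^ K = ε / (2 * (1 + 1 / s) ^ K) + ε / (2 * (1 + 1 / s) ^ K) := by
        field_simp; norm_num
      linarith
    have := abs_sub_le_pow hu1 hh hs0 hJ.toFinset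
      (fun j hj => max_lt (key x hx j hj) (key x' hx' j hj)) K i hi
      (Finset.card_le_card (Finset.filter_subset _ _))
    rwa [div_mul_cancel₀ _ hp.ne'] at this
  · rw [not_le, max_lt_iff] at hi
    have := abs_sub (x i) (x' i)
    linarith

theorem exists_expand_eq (hu1 : ∀ k x y, |u k x - u k y| ≤ ‖x - y‖)
    (hfin : ∀ x : C₀(ι, ℝ), {i | x i ≠ 0}.Finite → ∀ k, 0 < u k x) (y : ι → ℝ) (S : Finset ι) :
    ∃ x : C₀(ι, ℝ), (∀ i ∉ S, x i = 0) ∧ ∀ i ∈ S, expand u x i = y i := by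
  classical
  induction S using Finset.induction_on_min_value (fun i => |y i|) with
  | empty => exact ⟨0, fun _ _ => rfl, by simp⟩
  | insert a S haS hmin ih =>
    obtain ⟨x', hx0, hx⟩ := ih
    by_cases hya : y a = 0
    · refine ⟨x', fun i hi => hx0 i fun h => hi (Finset.mem_insert_of_mem h), fun i hi => ?_⟩
      rcases Finset.mem_insert.1 hi with rfl | hi
      · rw [hya, expand_of_eq_zero (hx0 _ haS)]
      · exact hx i hi
    have hx'G : ∀ k, 0 < u k x' := hfin x' (S.finite_toSet.subset fun i hi => by
      by_contra h; exact hi (hx0 i h))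
    have hya' : 0 < |y a| := abs_pos.2 hya
    have hcont : ContinuousOn (fun s => s + wt u x' s) (Set.Icc 0 |y a|) := by
      refine continuousOn_id.add ?_
      exact (continuousOn_wt hu1).comp (f := fun s : ℝ => (x', s))
        (by fun_prop) fun s hs => ⟨hs.1, Or.inr hx'G⟩
    obtain ⟨r, hr, hre⟩ := intermediate_value_Icc hya'.le hcont (show |y a| ∈ Set.Icc _ _ from
      ⟨by simp [wt_zero], by simpa using wt_nonneg x' hya'.le⟩)
    simp only at hre
    have hr0 : 0 < r := by
      rcases hr.1.eq_or_lt with h | h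
      · rw [← h, wt_zero] at hre; linarith
      · exact h
    have hrS : ∀ j ∈ S, r ≤ |x' j| := fun j hj => by
      by_contra! hlt
      have h1 := abs_expand (u := u) x' j
      rw [hx j hj] at h1
      have h2 := wt_mono hu1 x' (abs_nonneg (x' j)) hlt.le
      have := hmin j hj
      linarith
    set b := y a / |y a| * r with hb
    have hbabs : |b| = r := by
      rw [hb, abs_mul, abs_div, abs_abs, div_self hya'.ne', one_mul, abs_of_pos hr0]
    have hxa : (x' + single a b) a = b := by
      rw [ZeroAtInftyContinuousMap.add_apply, hx0 a haS, single_same, zero_add]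
    have hxne : ∀ j, j ≠ a → (x' + single a b) j = x' j := fun j hj => by
      rw [ZeroAtInftyContinuousMap.add_apply, single_of_ne hj, add_zero]
    have hthr : ∀ s, r ≤ s → thr s (x' + single a b) = thr s x' := fun s hs => by
      ext j
      by_cases hj : j = a
      · subst hj
        simp only [thr_apply]
        rw [hxa, hx0 _ haS, soft_eq_zero (hbabs.trans_le hs), soft_eq_zero (by
          rw [abs_zero]; exact hr0.le.trans hs)]
      · rw [thr_apply, hxne j hj, thr_apply]
    have hwt : ∀ s, r ≤ s → wt u (x' + single a b) s = wt u x' s := fun s hs => by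
      simp only [wt, hthr s hs]
    refine ⟨x' + single a b, fun i hi => ?_, fun i hi => ?_⟩
    · rw [Finset.mem_insert, not_or] at hi
      rw [hxne i hi.1, hx0 i hi.2]
    · rcases Finset.mem_insert.1 hi with rfl | hi
      · rw [expand_eq, hxa, hbabs, hwt r le_rfl, hre, hb]
        field_simp
      · have hia : i ≠ a := fun h => haS (h ▸ hi)
        rw [expand, hxne i hia, hwt _ (hrS i hi), ← hx i hi, expand]

theorem exists_mem_eq_of_tendsto
    (hu1 : ∀ k x y, |u k x - u k y| ≤ ‖x - y‖)
    (hfin : ∀ x : C₀(ι, ℝ), {i | x i ≠ 0}.Finite → ∀ k, 0 < u k x)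
    (X : ℕ → {x : C₀(ι, ℝ) | ∀ k, 0 < u k x}) (y : C₀(ι, ℝ))
    (hX : Filter.Tendsto (fun n => expandMap hu1 (X n)) Filter.atTop (𝓝 y)) :
    ∃ x, expandMap hu1 x = y := by
  have hC : CauchySeq fun n => (X n).1 := by
    rw [Metric.cauchySeq_iff']
    intro ε hε
    obtain ⟨η, hη, h⟩ := exists_expand_stable hu1 y (half_pos hε)
    obtain ⟨N, hN⟩ := Metric.tendsto_atTop.1 hX η hη
    have hN' : ∀ n ≥ N, ∀ i, |expand u (X n).1 i - y i| ≤ η := fun n hn i => by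
      have := (hN n hn).le
      rw [dist_eq_norm] at this
      exact (abs_sub_le_norm (expandMap hu1 (X n)) y i).trans this
    refine ⟨N, fun n hn => ?_⟩
    rw [dist_eq_norm]
    exact (h _ _ (hN' n hn) (hN' N le_rfl)).trans_lt (half_lt_self hε)
  obtain ⟨x, hx⟩ := cauchySeq_tendsto_of_complete hC
  have hcoord : ∀ i, x i ≠ 0 → y i = expand u x i := fun i hi =>
    tendsto_nhds_unique (((continuous_apply i).tendsto y).comp hX)
      ((continuousAt_expand hu1 hi).tendsto.comp hx)
  have hxG : ∀ k, 0 < u k x := by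
    by_contra! hcon
    obtain ⟨k, hk⟩ := hcon
    refine absurd (hfin x ?_ k) (not_lt.2 hk)
    refine (finite_le_abs y (show (0 : ℝ) < (1 / 2) ^ (k + 1) by positivity)).subset
      fun i (hi : x i ≠ 0) => ?_
    change (1 / 2 : ℝ) ^ (k + 1) ≤ |y i|
    rw [hcoord i hi, abs_expand]
    linarith [half_pow_le_wt hu1 x (abs_pos.2 hi) hk, abs_nonneg (x i)]
  refine ⟨⟨x, hxG⟩, tendsto_nhds_unique (((continuous_expandMap hu1).tendsto ⟨x, hxG⟩).comp ?_) hX⟩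
  exact tendsto_subtype_rng.2 hx

theorem exists_finite_support_norm_sub_le (y : C₀(ι, ℝ)) {ε : ℝ} (hε : 0 < ε) :
    ∃ z : C₀(ι, ℝ), {i | z i ≠ 0}.Finite ∧ ‖z - y‖ ≤ ε := by
  refine ⟨thr ε y, (finite_le_abs y hε).subset fun i (hi : soft ε (y i) ≠ 0) => ?_, ?_⟩
  · by_contra h
    exact hi (soft_eq_zero (not_le.1 h).le)
  · have := norm_thr_sub_thr_le ε 0 y y
    rw [thr_zero_left, sub_self, norm_zero, add_zero, sub_zero, abs_of_pos hε] at this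
    exact this

/-- The complement of the common zero sets of countably many `1`-Lipschitz functions that are
positive at all finitely supported points is homeomorphic to the whole space. -/
theorem nonempty_homeomorph_of_pos
    (hu1 : ∀ k x y, |u k x - u k y| ≤ ‖x - y‖)
    (hfin : ∀ x : C₀(ι, ℝ), {i | x i ≠ 0}.Finite → ∀ k, 0 < u k x) :
    Nonempty ({x : C₀(ι, ℝ) | ∀ k, 0 < u k x} ≃ₜ C₀(ι, ℝ)) := by
  have hinj : Function.Injective (expandMap hu1) := fun x x' h => by
    refine Subtype.ext (sub_eq_zero.1 (norm_eq_zero.1 (le_antisymm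
      (le_of_forall_pos_le_add fun ε hε => ?_) (norm_nonneg _))))
    obtain ⟨η, hη, hh⟩ := exists_expand_stable hu1 (expandMap hu1 x) hε
    rw [zero_add]
    refine hh _ _ (fun i => by simpa using hη.le) fun i => ?_
    rw [h]; simpa using hη.le
  have hfs : ∀ z : C₀(ι, ℝ), {i | z i ≠ 0}.Finite → ∃ x, expandMap hu1 x = z := fun z hz => by
    obtain ⟨x, hx0, hx⟩ := exists_expand_eq hu1 hfin z hz.toFinset
    refine ⟨⟨x, hfin x (hz.subset fun i hi => ?_)⟩, ?_⟩
    · by_contra h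
      exact hi (hx0 i (by simpa using h))
    · ext i
      by_cases hi : z i = 0
      · rw [expandMap_apply, hi]
        exact expand_of_eq_zero (hx0 i (by simpa using hi))
      · exact hx i (by simpa using hi)
  have hsurj : Function.Surjective (expandMap hu1) := fun y => by
    choose z hz hzy using fun n : ℕ => exists_finite_support_norm_sub_le y
      (show (0 : ℝ) < 1 / (n + 1) by positivity)
    choose X hX using fun n => hfs (z n) (hz n)
    refine exists_mem_eq_of_tendsto hu1 hfin X y ?_
    simp only [hX]
    rw [tendsto_iff_norm_sub_tendsto_zero]
    exact squeeze_zero (fun _ => norm_nonneg _) hzy tendsto_one_div_add_atTop_nhds_zero_nat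
  let e := Equiv.ofBijective _ ⟨hinj, hsurj⟩
  refine ⟨⟨e, continuous_expandMap hu1, ?_⟩⟩
  rw [Metric.continuous_iff]
  intro y ε hε
  obtain ⟨η, hη, h⟩ := exists_expand_stable hu1 y (half_pos hε)
  refine ⟨η, hη, fun y' hy' => ?_⟩
  obtain ⟨x, rfl⟩ := e.surjective y
  obtain ⟨x', rfl⟩ := e.surjective y'
  change dist (e.symm (e x')) (e.symm (e x)) < ε
  rw [Equiv.symm_apply_apply, Equiv.symm_apply_apply, Subtype.dist_eq, dist_eq_norm]
  refine (h _ _ (fun i => ?_) fun i => ?_).trans_lt (half_lt_self hε)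
  · rw [dist_eq_norm] at hy'
    exact (abs_sub_le_norm (expandMap hu1 x') (expandMap hu1 x) i).trans hy'.le
  · change |expand u x.1 i - expand u x.1 i| ≤ η
    simpa using hη.le

end C0

theorem abs_cutoff_sub_le {ρ : ℝ} (hρ : 0 < ρ) (r r' : ℝ) :
    |max 0 (min 1 (2 - r / (2 * ρ))) - max 0 (min 1 (2 - r' / (2 * ρ)))| ≤ |r - r'| / (2 * ρ) := by
  have h1 : |max 0 (min 1 (2 - r / (2 * ρ))) - max 0 (min 1 (2 - r' / (2 * ρ)))|
      ≤ |(2 - r / (2 * ρ)) - (2 - r' / (2 * ρ))| := by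
    refine (abs_max_sub_max_le_max _ _ _ _).trans ?_
    rw [sub_self, abs_zero, max_eq_right (abs_nonneg _)]
    refine (abs_min_sub_min_le_max _ _ _ _).trans ?_
    rw [sub_self, abs_zero, max_eq_right (abs_nonneg _)]
  refine h1.trans_eq ?_
  rw [sub_sub_sub_cancel_left, ← sub_div, abs_div, abs_of_pos (show 0 < 2 * ρ by positivity),
    abs_sub_comm]

/-- Pushing along the fibres of a linear map `Z` in the direction of a vector field `V` with
values in the kernel of `Z`. -/
theorem exists_homeomorph_push {E : Type*} [NormedAddCommGroup E] [NormedSpace ℝ E]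
    (Z : E →L[ℝ] E) {V : E → E} (hV : Continuous V) (hZV : ∀ z, Z (V z) = 0) {ρ : ℝ} (hρ : 0 < ρ)
    (hVρ : ∀ z, ‖V z‖ ≤ ρ) :
    ∃ τ : E ≃ₜ E, (∀ x, ‖x - Z x‖ ≤ 2 * ρ → τ x = x + V (Z x)) ∧
      ∀ x, τ x = x ∨ (‖x - Z x‖ < 4 * ρ ∧ V (Z x) ≠ 0 ∧ ‖τ x - x‖ ≤ ρ) := by
  set ct : ℝ → ℝ := fun r => max 0 (min 1 (2 - r / (2 * ρ))) with hct
  have hct0 : ∀ r, 0 ≤ ct r := fun r => le_max_left _ _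
  have hct1 : ∀ r, ct r ≤ 1 := fun r => max_le zero_le_one (min_le_left _ _)
  have hctc : Continuous ct := by fun_prop
  set g : ℝ → E → ℝ := fun c y => c - ct ‖y - Z y - c • V (Z y)‖ with hg
  have hgc : Continuous fun p : ℝ × E => g p.1 p.2 := by fun_prop
  have hgl : ∀ y c c', |c - c'| ≤ 2 * |g c y - g c' y| := fun y c c' => by
    have h1 : |ct ‖y - Z y - c • V (Z y)‖ - ct ‖y - Z y - c' • V (Z y)‖| ≤ |c - c'| / 2 := by
      refine (abs_cutoff_sub_le hρ _ _).trans ?_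
      rw [div_le_div_iff₀ (by positivity) two_pos]
      have h2 := abs_norm_sub_norm_le (y - Z y - c • V (Z y)) (y - Z y - c' • V (Z y))
      rw [sub_sub_sub_cancel_left, ← sub_smul, norm_smul, Real.norm_eq_abs, abs_sub_comm c' c] at h2
      have h3 : |c - c'| * ‖V (Z y)‖ ≤ |c - c'| * ρ := by gcongr; exact hVρ _
      linarith
    have h2 := abs_sub_abs_le_abs_sub (c - c')
      (ct ‖y - Z y - c • V (Z y)‖ - ct ‖y - Z y - c' • V (Z y)‖)
    have h3 : g c y - g c' y = (c - c') -
      (ct ‖y - Z y - c • V (Z y)‖ - ct ‖y - Z y - c' • V (Z y)‖) := by simp only [hg]; ring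
    rw [h3]
    linarith
  have hex : ∀ y, ∃ c, g c y = 0 := fun y => by
    have := intermediate_value_Icc (zero_le_one' ℝ)
      (hgc.comp (f := fun c : ℝ => (c, y)) (by fun_prop)).continuousOn
    obtain ⟨c, -, hc⟩ := this (show (0 : ℝ) ∈ Set.Icc _ _ from
      ⟨by simpa [hg] using hct0 _, by simpa [hg] using hct1 _⟩)
    exact ⟨c, hc⟩
  choose c hc using hex
  have hcc : Continuous c := by
    rw [continuous_iff_continuousAt]
    intro y
    rw [ContinuousAt, tendsto_iff_dist_tendsto_zero]
    have h1 : Filter.Tendsto (fun y' => 2 * |g (c y) y'|) (𝓝 y) (𝓝 0) := by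
      have : Continuous fun y' => 2 * |g (c y) y'| :=
        continuous_const.mul (hgc.comp (f := fun y' => (c y, y')) (by fun_prop)).abs
      have h2 := this.tendsto y
      rwa [hc y, abs_zero, mul_zero] at h2
    refine squeeze_zero (fun _ => dist_nonneg) (fun y' => ?_) h1
    have := hgl y' (c y') (c y)
    rwa [hc y', zero_sub, abs_neg] at this
  refine ⟨{ toFun := fun x => x + ct ‖x - Z x‖ • V (Z x)
            invFun := fun y => y - c y • V (Z y)
            left_inv := fun x => ?_
            right_inv := fun y => ?_
            continuous_toFun := by fun_prop
            continuous_invFun := by fun_prop }, fun x hx => ?_, fun x => ?_⟩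
  · have hZ : Z (x + ct ‖x - Z x‖ • V (Z x)) = Z x := by simp [hZV]
    have h0 : g (ct ‖x - Z x‖) (x + ct ‖x - Z x‖ • V (Z x)) = 0 := by
      simp only [hg, hZ]
      rw [show x + ct ‖x - Z x‖ • V (Z x) - Z x - ct ‖x - Z x‖ • V (Z x) = x - Z x by abel, sub_self]
    have h1 := hgl (x + ct ‖x - Z x‖ • V (Z x)) (c (x + ct ‖x - Z x‖ • V (Z x))) (ct ‖x - Z x‖)
    rw [hc, h0, sub_self, abs_zero, mul_zero] at h1
    have h2 := sub_eq_zero.1 (abs_eq_zero.1 (le_antisymm h1 (abs_nonneg _)))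
    simp only [h2, hZ, add_sub_cancel_right]
  · have hZ : Z (y - c y • V (Z y)) = Z y := by simp [hZV]
    simp only [hZ]
    have := sub_eq_zero.1 (hc y)
    rw [sub_right_comm, ← this, sub_add_cancel]
  · have h : ct ‖x - Z x‖ = 1 := by
      simp only [hct]
      rw [min_eq_left, max_eq_right zero_le_one]
      have : ‖x - Z x‖ / (2 * ρ) ≤ 1 := div_le_one_of_le₀ hx (by positivity)
      linarith
    simp [h]
  · change x + ct ‖x - Z x‖ • V (Z x) = x ∨ (_ ∧ _ ∧ ‖x + ct ‖x - Z x‖ • V (Z x) - x‖ ≤ ρ)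
    by_cases h1 : V (Z x) = 0
    · left; simp [h1]
    by_cases h2 : ‖x - Z x‖ < 4 * ρ
    · right
      refine ⟨h2, h1, ?_⟩
      rw [add_sub_cancel_left, norm_smul, Real.norm_of_nonneg (hct0 _)]
      exact (mul_le_of_le_one_left (norm_nonneg _) (hct1 _)).trans (hVρ _)
    · left
      have : ct ‖x - Z x‖ = 0 := by
        simp only [hct]
        have h3 : 2 ≤ ‖x - Z x‖ / (2 * ρ) := by
          rw [le_div_iff₀ (by positivity)]; linarith
        rw [max_eq_left]
        exact (min_le_right _ _).trans (by linarith)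
      simp [this]

namespace C0
variable {ι : Type*} [TopologicalSpace ι] [DiscreteTopology ι]

/-- Restriction to finitely many coordinates. -/
noncomputable def proj (T : Finset ι) : C₀(ι, ℝ) →L[ℝ] C₀(ι, ℝ) :=
  ∑ i ∈ T, (eval i).smulRight (single i 1)

open Classical in
theorem proj_apply (T : Finset ι) (x : C₀(ι, ℝ)) (i : ι) :
    proj T x i = if i ∈ T then x i else 0 := by
  simp only [proj, _root_.sum_apply, ContinuousLinearMap.smulRight_apply, eval_apply,
    sum_apply, ZeroAtInftyContinuousMap.smul_apply, single_apply, smul_eq_mul]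
  simp

theorem norm_proj_le (T : Finset ι) (x : C₀(ι, ℝ)) : ‖proj T x‖ ≤ ‖x‖ := by
  classical
  refine (norm_le (norm_nonneg _)).2 fun i => ?_
  rw [proj_apply]
  split_ifs
  · exact abs_le_norm x i
  · simp

/-- Transport of the coordinates in `S` along `f`. -/
noncomputable def shift (S : Finset ι) (f : S → ι) : C₀(ι, ℝ) →L[ℝ] C₀(ι, ℝ) :=
  ∑ i : S, (eval (i : ι)).smulRight (single (f i) 1)

/-- Transport of the coordinates in the range of `f` back to `S`. -/
noncomputable def unshift (S : Finset ι) (f : S → ι) : C₀(ι, ℝ) →L[ℝ] C₀(ι, ℝ) :=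
  ∑ i : S, (eval (f i)).smulRight (single (i : ι) 1)

theorem shift_apply_of_notMem (S : Finset ι) (f : S → ι) (x : C₀(ι, ℝ)) {j : ι}
    (hj : j ∉ Set.range f) : shift S f x j = 0 := by
  simp only [shift, _root_.sum_apply, ContinuousLinearMap.smulRight_apply, eval_apply,
    sum_apply, ZeroAtInftyContinuousMap.smul_apply, smul_eq_mul]
  refine Finset.sum_eq_zero fun i _ => ?_
  rw [single_of_ne (fun h => hj ⟨i, h.symm⟩), mul_zero]

theorem shift_apply {S : Finset ι} {f : S → ι} (hf : Function.Injective f) (x : C₀(ι, ℝ)) (i : S) :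
    shift S f x (f i) = x i := by
  classical
  simp only [shift, _root_.sum_apply, ContinuousLinearMap.smulRight_apply, eval_apply,
    sum_apply, ZeroAtInftyContinuousMap.smul_apply, smul_eq_mul, single_apply, hf.eq_iff]
  simp

theorem unshift_eq_zero (S : Finset ι) (f : S → ι) {x : C₀(ι, ℝ)} (hx : ∀ i, x (f i) = 0) :
    unshift S f x = 0 := by
  simp [unshift, hx]

theorem unshift_shift {S : Finset ι} {f : S → ι} (hf : Function.Injective f) {x : C₀(ι, ℝ)}
    (hx : ∀ i ∉ S, x i = 0) : unshift S f (shift S f x) = x := by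
  classical
  ext j
  simp only [unshift, _root_.sum_apply, ContinuousLinearMap.smulRight_apply,
    eval_apply, sum_apply, ZeroAtInftyContinuousMap.smul_apply, smul_eq_mul, shift_apply hf,
    single_apply]
  rw [Finset.sum_coe_sort S fun i => x i * if j = i then 1 else 0]
  by_cases hj : j ∈ S
  · simp [hj]
  · simp [hj, hx j hj]

theorem norm_shift_le {S : Finset ι} {f : S → ι} (hf : Function.Injective f) (x : C₀(ι, ℝ)) :
    ‖shift S f x‖ ≤ ‖x‖ := by
  refine (norm_le (norm_nonneg _)).2 fun j => ?_
  by_cases hj : j ∈ Set.range f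
  · obtain ⟨i, rfl⟩ := hj
    rw [shift_apply hf]
    exact abs_le_norm x i
  · rw [shift_apply_of_notMem S f x hj]; simp

theorem exists_norm_proj_sub_lt {K : Set C₀(ι, ℝ)} (hK : IsCompact K) {ε : ℝ} (hε : 0 < ε)
    (S : Finset ι) : ∃ T : Finset ι, S ⊆ T ∧ ∀ y ∈ K, ‖proj T y - y‖ < ε := by
  classical
  have hmono : ∀ (T T' : Finset ι) (y : C₀(ι, ℝ)), T ⊆ T' → ‖proj T' y - y‖ ≤ ‖proj T y - y‖ := by
    intro T T' y h
    refine (norm_sub_le (norm_nonneg _)).2 fun i => ?_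
    rw [proj_apply]
    split_ifs with hi
    · simp
    · have := abs_sub_le_norm (proj T y) y i
      rwa [proj_apply, if_neg fun hiT => hi (h hiT)] at this
  obtain ⟨T, hT⟩ := hK.elim_directed_cover (fun T : Finset ι => {y | ‖proj T y - y‖ < ε})
    (fun T => isOpen_lt (by fun_prop) continuous_const)
    (fun y _ => by
      have h := finite_le_abs y (half_pos hε)
      refine Set.mem_iUnion.2 ⟨h.toFinset, lt_of_le_of_lt ((norm_sub_le (half_pos hε).le).2
        fun i => ?_) (half_lt_self hε)⟩
      rw [proj_apply]
      split_ifs with hi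
      · simpa using (half_pos hε).le
      · rw [zero_sub, abs_neg]
        simpa using (not_le.1 fun hh => hi (h.mem_toFinset.2 hh)).le)
    (fun T T' => ⟨T ∪ T', fun y hy => (hmono _ _ y Finset.subset_union_left).trans_lt hy,
      fun y hy => (hmono _ _ y Finset.subset_union_right).trans_lt hy⟩)
  exact ⟨S ∪ T, Finset.subset_union_left,
    fun y hy => (hmono _ _ y Finset.subset_union_right).trans_lt (hT hy)⟩

end C0

theorem exists_ne_zero_forall_norm_sub_lt {E : Type*} [NormedAddCommGroup E] {h : E × I → E}
    (hc : Continuous h) (h0 : ∀ y, h (y, 0) = y) {K : Set E} (hK : IsCompact K) {ρ : ℝ}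
    (hρ : 0 < ρ) : ∃ t : I, t ≠ 0 ∧ ∀ z ∈ K, ‖h (z, t) - z‖ < ρ := by
  have h1 : ∀ᶠ t in 𝓝 (0 : I), ∀ z ∈ K, ‖h (z, t) - z‖ < ρ := by
    refine hK.eventually_forall_of_forall_eventually fun z _ => ?_
    have hcont : Continuous fun p : I × E => ‖h (p.2, p.1) - p.2‖ := by fun_prop
    refine hcont.continuousAt.eventually_lt continuousAt_const ?_
    simpa [h0] using hρ
  have h2 : ∀ᶠ t in 𝓝[≠] (0 : I), ∀ z ∈ K, ‖h (z, t) - z‖ < ρ := h1.filter_mono nhdsWithin_le_nhds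
  have h3 : (𝓝[≠] (0 : I)).NeBot := by
    rw [← mem_closure_iff_nhdsWithin_neBot, Metric.mem_closure_iff]
    intro ε hε
    refine ⟨⟨min 1 (ε / 2), by positivity, min_le_left _ _⟩, ?_, ?_⟩
    · rw [Set.mem_compl_iff, Set.mem_singleton_iff]
      intro hh
      have := congrArg Subtype.val hh
      simp only [Set.Icc.coe_zero] at this
      have h4 : (0 : ℝ) < min 1 (ε / 2) := by positivity
      linarith
    · rw [Subtype.dist_eq, Real.dist_eq, Set.Icc.coe_zero, zero_sub, abs_neg,
        abs_of_pos (by positivity)]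
      exact (min_le_right _ _).trans_lt (half_lt_self hε)
  obtain ⟨t, ht, htK⟩ := (h2.and self_mem_nhdsWithin).exists
  exact ⟨t, htK, ht⟩

namespace C0
variable {ι : Type*} [TopologicalSpace ι] [DiscreteTopology ι]

theorem exists_embedding_disjoint [Infinite ι] (S T : Finset ι) :
    ∃ f : S → ι, Function.Injective f ∧ ∀ i, f i ∉ T := by
  classical
  have : Infinite {i // i ∉ T} := by
    have := T.finite_toSet.infinite_compl
    exact this.to_subtype
  let f := (S.equivFin.toEmbedding).trans ((Fin.valEmbedding).trans
    (Infinite.natEmbedding {i // i ∉ T}))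
  exact ⟨fun i => (f i).1, fun a b h => f.injective (Subtype.ext h), fun i => (f i).2⟩

theorem exists_homeomorph_compact_avoid [Infinite ι] {A : Set C₀(ι, ℝ)} (hA : IsClosed A)
    {h : C₀(ι, ℝ) × I → C₀(ι, ℝ)} (hc : Continuous h) (h0 : ∀ y, h (y, 0) = y)
    (hhA : ∀ y (t : I), t ≠ 0 → h (y, t) ∉ A) {K : Set C₀(ι, ℝ)} (hK : IsCompact K) (S : Finset ι)
    (hKS : ∀ z ∈ K, ∀ i ∉ S, z i = 0) {r : ℝ} (hr : 0 < r) :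
    ∃ τ : C₀(ι, ℝ) ≃ₜ C₀(ι, ℝ), (∀ z ∈ K, τ z ∉ A) ∧
      ∀ x, τ x = x ∨ ∃ z ∈ K, ‖x - z‖ < r ∧ ‖τ x - z‖ < r := by
  classical
  obtain ⟨ρ, hρ, hρr⟩ : ∃ ρ > 0, 6 * ρ ≤ r := ⟨r / 6, by positivity, by linarith⟩
  obtain ⟨t, ht, htK⟩ := exists_ne_zero_forall_norm_sub_lt hc h0 hK hρ
  set q : C₀(ι, ℝ) → C₀(ι, ℝ) := fun z => h (z, t) with hq
  have hqc : Continuous q := by fun_prop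
  obtain ⟨η, hη, hηA⟩ := (hK.image hqc).exists_thickening_subset_open hA.isOpen_compl (by
    rintro _ ⟨z, -, rfl⟩
    exact hhA z t ht)
  obtain ⟨T, hST, hT⟩ := exists_norm_proj_sub_lt (hK.image hqc) (half_pos hη) S
  obtain ⟨f, hf, hfT⟩ := exists_embedding_disjoint S T
  have hrange : ∀ i ∈ T, i ∉ Set.range f := by
    rintro _ hi ⟨j, rfl⟩
    exact hfT j hi
  set O : Set C₀(ι, ℝ) := {z | ‖q z - z‖ < ρ} ∩ Metric.thickening ρ K with hO
  have hOo : IsOpen O := (isOpen_lt (by fun_prop) continuous_const).inter Metric.isOpen_thickening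
  have hKO : K ⊆ O := fun z hz => ⟨htK z hz, Metric.self_subset_thickening hρ K hz⟩
  obtain ⟨β, hβ0, hβ1, hβI⟩ := exists_continuous_zero_one_of_isClosed hOo.isClosed_compl
    hK.isClosed (Set.disjoint_left.2 fun z hz hzK => hz (hKO hzK))
  obtain ⟨R, hR0, hR⟩ : ∃ R > 0, ∀ z ∈ O, ‖z‖ ≤ R := by
    obtain ⟨R, hR⟩ := hK.isBounded.thickening (δ := ρ).exists_norm_le
    exact ⟨max R 1, by positivity, fun z hz => (hR z hz.2).trans (le_max_left _ _)⟩
  obtain ⟨lam, hlam, hl1, hl2⟩ : ∃ lam > 0, lam * R ≤ ρ ∧ lam * R ≤ η / 2 :=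
    ⟨min ρ (η / 2) / R, by positivity, by rw [div_mul_cancel₀ _ hR0.ne']; exact min_le_left _ _,
      by rw [div_mul_cancel₀ _ hR0.ne']; exact min_le_right _ _⟩
  have hβO : ∀ z, β z ≠ 0 → z ∈ O := fun z hz => by
    by_contra hzO
    exact hz (hβ0 hzO)
  have hβn : ∀ (z v : C₀(ι, ℝ)) (c : ℝ), 0 ≤ c → (z ∈ O → ‖v‖ ≤ c) → ‖β z • v‖ ≤ c := by
    intro z v c hc hv
    by_cases hz : β z = 0
    · rw [hz, zero_smul, norm_zero]; exact hc
    · rw [norm_smul, Real.norm_of_nonneg (hβI z).1]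
      exact (mul_le_of_le_one_left (norm_nonneg _) (hβI z).2).trans (hv (hβO z hz))
  have hsh : ∀ z ∈ O, ‖lam • shift S f z‖ ≤ lam * R := fun z hz => by
    rw [norm_smul, Real.norm_of_nonneg hlam.le]
    gcongr
    exact (norm_shift_le hf z).trans (hR z hz)
  obtain ⟨τ₁, h11, h12⟩ := exists_homeomorph_push (proj S)
    (V := fun z => β z • lam • shift S f z) (by fun_prop) (fun z => by
      ext i
      rw [proj_apply]
      split_ifs with hi
      · simp [shift_apply_of_notMem S f z (hrange i (hST hi))]
      · simp) hρ
    (fun z => hβn _ _ _ hρ.le fun hz => (hsh z hz).trans hl1)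
  obtain ⟨τ₂, h21, h22⟩ := exists_homeomorph_push (lam⁻¹ • unshift S f)
    (V := fun z => β z • proj T (q z - z)) (by fun_prop) (fun z => by
      have : unshift S f (β z • proj T (q z - z)) = 0 := unshift_eq_zero _ _ fun i => by
        simp [proj_apply, hfT i]
      rw [_root_.smul_apply, this, smul_zero]) hρ
    (fun z => hβn _ _ _ hρ.le fun hz => (norm_proj_le T _).trans hz.1.le)
  have near : ∀ w x : C₀(ι, ℝ), ‖x - w‖ < 4 * ρ → β w ≠ 0 → ∃ z ∈ K, ‖x - z‖ < 5 * ρ := by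
    intro w x hx hw
    obtain ⟨z, hz, hwz⟩ := Metric.mem_thickening_iff.1 (hβO w hw).2
    rw [dist_eq_norm] at hwz
    exact ⟨z, hz, by linarith [norm_sub_le_norm_sub_add_norm_sub x w z]⟩
  have m1 : ∀ x, τ₁ x = x ∨ ∃ z ∈ K, ‖x - z‖ < 5 * ρ ∧ ‖τ₁ x - z‖ < 6 * ρ := fun x => by
    rcases h12 x with hx | ⟨hx1, hx2, hx3⟩
    · exact Or.inl hx
    · obtain ⟨z, hz, hxz⟩ := near _ _ hx1 (fun hh => hx2 (by simp only [hh, zero_smul]))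
      exact Or.inr ⟨z, hz, hxz, by linarith [norm_sub_le_norm_sub_add_norm_sub (τ₁ x) x z]⟩
  have m1' : ∀ x, ‖τ₁ x - x‖ ≤ ρ := fun x => by
    rcases h12 x with hx | ⟨hx1, hx2, hx3⟩
    · rw [hx, sub_self, norm_zero]; exact hρ.le
    · exact hx3
  refine ⟨τ₁.trans τ₂, fun z hz => ?_, fun x => ?_⟩
  · have hβz : β z = 1 := hβ1 hz
    have hzS : proj S z = z := by
      ext i
      rw [proj_apply]
      split_ifs with hi
      · rfl
      · exact (hKS z hz i hi).symm
    have e1 : τ₁ z = z + lam • shift S f z := by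
      rw [h11 z (by rw [hzS, sub_self, norm_zero]; positivity), hzS, hβz, one_smul]
    have hz0 : unshift S f z = 0 := unshift_eq_zero _ _ fun i => hKS z hz _ fun hi =>
      hfT i (hST hi)
    have e2 : (lam⁻¹ • unshift S f) (τ₁ z) = z := by
      rw [_root_.smul_apply, e1, map_add, hz0, zero_add, map_smul,
        unshift_shift hf (hKS z hz), smul_smul, inv_mul_cancel₀ hlam.ne', one_smul]
    have e3 : τ₂ (τ₁ z) = z + lam • shift S f z + proj T (q z - z) := by
      rw [h21 _ ?_, e2, hβz, one_smul, e1]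
      rw [e2, e1, add_sub_cancel_left]
      linarith [hsh z (hKO hz)]
    have hzT : proj T z = z := by
      ext i
      rw [proj_apply]
      split_ifs with hi
      · rfl
      · exact (hKS z hz i fun hiS => hi (hST hiS)).symm
    have e4 : τ₂ (τ₁ z) = lam • shift S f z + proj T (q z) := by
      rw [e3, map_sub, hzT]; abel
    have : τ₂ (τ₁ z) ∈ Metric.thickening η (q '' K) := by
      rw [Metric.mem_thickening_iff]
      refine ⟨q z, ⟨z, hz, rfl⟩, ?_⟩
      rw [dist_eq_norm, e4, add_sub_assoc]
      have a1 := hT (q z) ⟨z, hz, rfl⟩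
      have a2 := hsh z (hKO hz)
      have a3 := norm_add_le (lam • shift S f z) (proj T (q z) - q z)
      linarith
    exact hηA this
  · change τ₂ (τ₁ x) = x ∨ ∃ z ∈ K, _ ∧ ‖τ₂ (τ₁ x) - z‖ < r
    rcases h22 (τ₁ x) with hx | ⟨hx1, hx2, hx3⟩
    · rw [hx]
      rcases m1 x with hx' | ⟨z, hz, hxz, hxz'⟩
      · exact Or.inl hx'
      · exact Or.inr ⟨z, hz, by linarith, by linarith⟩
    · right
      obtain ⟨z, hz, hxz⟩ := near _ _ hx1 (fun hh => hx2 (by simp only [hh, zero_smul]))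
      refine ⟨z, hz, ?_, by linarith [norm_sub_le_norm_sub_add_norm_sub (τ₂ (τ₁ x)) (τ₁ x) z]⟩
      have := m1' x
      rw [norm_sub_rev] at this
      linarith [norm_sub_le_norm_sub_add_norm_sub x (τ₁ x) z]

end C0

theorem continuous_glue {Y κ : Type*} [MetricSpace Y] {N : κ → Set Y} {f : κ → Y → Y}
    {δ : ℝ} (hδ : 0 < δ) (hN : ∀ x s s', (Metric.ball x δ ∩ N s).Nonempty →
      (Metric.ball x δ ∩ N s').Nonempty → s = s') (hf : ∀ s, Continuous (f s))
    (hfN : ∀ s x, x ∉ N s → f s x = x) {F : Y → Y} (hF : ∀ s x, x ∈ N s → F x = f s x)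
    (hF' : ∀ x, (∀ s, x ∉ N s) → F x = x) : Continuous F := by
  rw [continuous_iff_continuousAt]
  intro x
  by_cases h : ∃ s, (Metric.ball x δ ∩ N s).Nonempty
  · obtain ⟨s, hs⟩ := h
    refine (hf s).continuousAt.congr ?_
    filter_upwards [Metric.ball_mem_nhds x hδ] with y hy
    by_cases hyN : y ∈ N s
    · exact (hF s y hyN).symm
    · rw [hfN s y hyN, hF' y]
      intro s' hs'
      have := hN x s s' hs ⟨y, hy, hs'⟩
      exact hyN (this ▸ hs')
  · refine continuousAt_id.congr ?_
    filter_upwards [Metric.ball_mem_nhds x hδ] with y hy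
    exact (hF' y fun s hs => h ⟨s, y, hy, hs⟩).symm

theorem exists_homeomorph_glue {Y κ : Type*} [MetricSpace Y] {N : κ → Set Y} (τ : κ → Y ≃ₜ Y)
    {δ : ℝ} (hδ : 0 < δ) (hN : ∀ x s s', (Metric.ball x δ ∩ N s).Nonempty →
      (Metric.ball x δ ∩ N s').Nonempty → s = s')
    (hτ : ∀ s x, τ s x = x ∨ (x ∈ N s ∧ τ s x ∈ N s)) :
    ∃ F : Y ≃ₜ Y, (∀ s x, x ∈ N s → F x = τ s x) ∧ ∀ x, (∀ s, x ∉ N s) → F x = x := by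
  classical
  have huniq : ∀ x s s', x ∈ N s → x ∈ N s' → s = s' := fun x s s' h h' =>
    hN x s s' ⟨x, Metric.mem_ball_self hδ, h⟩ ⟨x, Metric.mem_ball_self hδ, h'⟩
  have hτ' : ∀ s x, (τ s).symm x = x ∨ (x ∈ N s ∧ (τ s).symm x ∈ N s) := fun s x => by
    rcases hτ s ((τ s).symm x) with h | ⟨h, h'⟩
    · rw [Homeomorph.apply_symm_apply] at h
      exact Or.inl h.symm
    · rw [Homeomorph.apply_symm_apply] at h'
      exact Or.inr ⟨h', h⟩
  have key : ∀ f : κ → Y → Y, ∃ F : Y → Y, (∀ s x, x ∈ N s → F x = f s x) ∧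
      ∀ x, (∀ s, x ∉ N s) → F x = x := fun f => by
    refine ⟨fun x => if h : ∃ s, x ∈ N s then f h.choose x else x, fun s x hx => ?_, fun x hx => ?_⟩
    · have h : ∃ s, x ∈ N s := ⟨s, hx⟩
      simp only [dif_pos h]
      rw [huniq x _ s h.choose_spec hx]
    · refine dif_neg ?_
      rintro ⟨s, hs⟩
      exact hx s hs
  obtain ⟨F, hF, hF'⟩ := key fun s => τ s
  obtain ⟨G, hG, hG'⟩ := key fun s => (τ s).symm
  refine ⟨⟨⟨F, G, fun x => ?_, fun x => ?_⟩, ?_, ?_⟩, hF, hF'⟩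
  · by_cases h : ∃ s, x ∈ N s
    · obtain ⟨s, hs⟩ := h
      rw [hF s x hs]
      have : τ s x ∈ N s := by
        rcases hτ s x with h | h
        · rwa [h]
        · exact h.2
      rw [hG s _ this, Homeomorph.symm_apply_apply]
    · push Not at h
      rw [hF' x h, hG' x h]
  · by_cases h : ∃ s, x ∈ N s
    · obtain ⟨s, hs⟩ := h
      rw [hG s x hs]
      have : (τ s).symm x ∈ N s := by
        rcases hτ' s x with h | h
        · rwa [h]
        · exact h.2
      rw [hF s _ this, Homeomorph.apply_symm_apply]
    · push Not at h
      rw [hG' x h, hF' x h]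
  · exact continuous_glue hδ hN (fun s => (τ s).continuous)
      (fun s x hx => (hτ s x).resolve_right fun h => hx h.1) hF hF'
  · exact continuous_glue hδ hN (fun s => (τ s).symm.continuous)
      (fun s x hx => (hτ' s x).resolve_right fun h => hx h.1) hG hG'

namespace C0
variable {ι : Type*} [TopologicalSpace ι] [DiscreteTopology ι]

/-- Points all of whose nonzero coordinates have size between `1 / (j + 1)` and `j + 1`. -/
def layer (ι : Type*) [TopologicalSpace ι] (j : ℕ) : Set C₀(ι, ℝ) :=
  {z | ∀ i, z i = 0 ∨ (1 / (j + 1 : ℝ) ≤ |z i| ∧ |z i| ≤ j + 1)}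

theorem isClosed_layer (j : ℕ) : IsClosed (layer ι j) := by
  have : layer ι j = ⋂ i, {z : C₀(ι, ℝ) | z i = 0} ∪
      ({z | 1 / (j + 1 : ℝ) ≤ |z i|} ∩ {z | |z i| ≤ j + 1}) := by
    ext z
    rw [Set.mem_iInter]
    exact Iff.rfl
  rw [this]
  refine isClosed_iInter fun i => ?_
  have hc := continuous_apply (ι := ι) i
  exact (isClosed_eq hc continuous_const).union
    ((isClosed_le continuous_const hc.abs).inter (isClosed_le hc.abs continuous_const))

theorem exists_mem_layer {x : C₀(ι, ℝ)} (hx : {i | x i ≠ 0}.Finite) : ∃ j, x ∈ layer ι j := by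
  obtain ⟨m, hm⟩ := exists_nat_ge
    (∑ i ∈ hx.toFinset, (|x i| + 1 / |x i|))
  refine ⟨m, fun i => ?_⟩
  by_cases hi : x i = 0
  · exact Or.inl hi
  right
  have h0 : 0 < |x i| := abs_pos.2 hi
  have h1 : |x i| + 1 / |x i| ≤ m := (Finset.single_le_sum
    (f := fun i => |x i| + 1 / |x i|) (fun j _ => by positivity) (by simpa using hi)).trans hm
  have h2 : 0 < 1 / |x i| := by positivity
  refine ⟨?_, by linarith⟩
  rw [one_div_le (by positivity) h0]
  linarith

/-- The points of a layer with prescribed support. -/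
def block (j : ℕ) (S : Finset ι) : Set C₀(ι, ℝ) :=
  {z | (∀ i ∈ S, 1 / (j + 1 : ℝ) ≤ |z i| ∧ |z i| ≤ j + 1) ∧ ∀ i ∉ S, z i = 0}

theorem isCompact_block (j : ℕ) (S : Finset ι) : IsCompact (block j S) := by
  classical
  have hcl : IsClosed (block j S) := by
    have : block j S = (⋂ i ∈ S, {z : C₀(ι, ℝ) | 1 / (j + 1 : ℝ) ≤ |z i|} ∩ {z | |z i| ≤ j + 1}) ∩
        ⋂ i, ⋂ (_ : i ∉ S), {z | z i = 0} := by
      ext z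
      rw [Set.mem_inter_iff]
      simp only [Set.mem_iInter]
      exact Iff.rfl
    rw [this]
    refine IsClosed.inter (isClosed_biInter fun i _ => ?_)
      (isClosed_iInter fun i => isClosed_iInter fun _ => ?_)
    · have hc := continuous_apply (ι := ι) i
      exact (isClosed_le continuous_const hc.abs).inter (isClosed_le hc.abs continuous_const)
    · exact isClosed_eq (continuous_apply i) continuous_const
  have hΦ : Continuous fun a : S → ℝ => ∑ i : S, a i • single (i : ι) 1 := by fun_prop
  refine ((isCompact_univ_pi fun _ : S => isCompact_Icc (a := -(j + 1 : ℝ)) (b := j + 1)).image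
    hΦ).of_isClosed_subset hcl fun z hz => ⟨fun i => z i, fun i _ => ?_, ?_⟩
  · exact abs_le.1 (hz.1 i i.2).2
  · ext l
    simp only [sum_apply, ZeroAtInftyContinuousMap.smul_apply, smul_eq_mul, single_apply]
    rw [Finset.sum_coe_sort S fun i => z i * if l = i then 1 else 0]
    by_cases hl : l ∈ S
    · simp [hl]
    · simp [hl, hz.2 l hl]

theorem eq_of_mem_block {j : ℕ} {S S' : Finset ι} {z z' : C₀(ι, ℝ)} (hz : z ∈ block j S)
    (hz' : z' ∈ block j S') (h : ‖z - z'‖ < 1 / (j + 1 : ℝ)) : S = S' := by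
  have key : ∀ {S S' : Finset ι} {z z' : C₀(ι, ℝ)}, z ∈ block j S → z' ∈ block j S' →
      ‖z - z'‖ < 1 / (j + 1 : ℝ) → S ⊆ S' := fun {S S' z z'} hz hz' h i hi => by
    by_contra hi'
    have h1 := (hz.1 i hi).1
    have h2 := abs_sub_le_norm z z' i
    rw [hz'.2 i hi', sub_zero] at h2
    linarith
  exact (key hz hz' h).antisymm (key hz' hz (by rwa [norm_sub_rev]))

theorem exists_homeomorph_layer_avoid [Infinite ι] {A : Set C₀(ι, ℝ)} (hA : IsClosed A)
    {h : C₀(ι, ℝ) × I → C₀(ι, ℝ)} (hc : Continuous h) (h0 : ∀ y, h (y, 0) = y)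
    (hhA : ∀ y (t : I), t ≠ 0 → h (y, t) ∉ A) (j : ℕ) {R : Set (C₀(ι, ℝ) × C₀(ι, ℝ))}
    (hR : IsOpen R) (hdiag : ∀ x, (x, x) ∈ R) :
    ∃ τ : C₀(ι, ℝ) ≃ₜ C₀(ι, ℝ), (∀ x, (x, τ x) ∈ R) ∧ ∀ x ∈ layer ι j, τ x ∉ A := by
  set δ : ℝ := 1 / (4 * (j + 1)) with hδ
  have hδ0 : 0 < δ := by positivity
  have hδ4 : 1 / (j + 1 : ℝ) = 4 * δ := by rw [hδ]; field_simp
  have h1 : ∀ S : Finset ι, ∃ r > 0, r ≤ δ ∧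
      Metric.thickening r ((fun z => (z, z)) '' block j S) ⊆ R := fun S => by
    obtain ⟨r, hr, hrR⟩ := ((isCompact_block j S).image
      (show Continuous fun z : C₀(ι, ℝ) => (z, z) by fun_prop)).exists_thickening_subset_open hR (by
        rintro _ ⟨z, -, rfl⟩
        exact hdiag z)
    exact ⟨min r δ, by positivity, min_le_right _ _,
      (Metric.thickening_mono (min_le_left _ _) _).trans hrR⟩
  choose r hr0 hrδ hrR using h1
  have h2 := fun S : Finset ι => exists_homeomorph_compact_avoid hA hc h0 hhA (isCompact_block j S)
    S (fun z hz => hz.2) (hr0 S)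
  choose τ hτA hτm using h2
  have hN : ∀ x S S', (Metric.ball x δ ∩ {x | ∃ z ∈ block j S, ‖x - z‖ < r S}).Nonempty →
      (Metric.ball x δ ∩ {x | ∃ z ∈ block j S', ‖x - z‖ < r S'}).Nonempty → S = S' := by
    rintro x S S' ⟨y, hy, z, hz, hyz⟩ ⟨y', hy', z', hz', hyz'⟩
    refine eq_of_mem_block hz hz' ?_
    rw [Metric.mem_ball, dist_eq_norm] at hy hy'
    rw [hδ4]
    rw [norm_sub_rev] at hyz hy
    have a1 := norm_sub_le_norm_sub_add_norm_sub z y z'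
    have a2 := norm_sub_le_norm_sub_add_norm_sub y x z'
    have a3 := norm_sub_le_norm_sub_add_norm_sub x y' z'
    rw [norm_sub_rev] at hy hy'
    have := hrδ S
    have := hrδ S'
    linarith [norm_sub_rev x y']
  obtain ⟨F, hF, hF'⟩ := exists_homeomorph_glue τ hδ0 hN (fun S x => by
    rcases hτm S x with h | ⟨z, hz, h, h'⟩
    · exact Or.inl h
    · exact Or.inr ⟨⟨z, hz, h⟩, ⟨z, hz, h'⟩⟩)
  refine ⟨F, fun x => ?_, fun x hx => ?_⟩
  · by_cases hx : ∃ S, x ∈ {x | ∃ z ∈ block j S, ‖x - z‖ < r S}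
    · obtain ⟨S, hS⟩ := hx
      rw [hF S x hS]
      rcases hτm S x with h | ⟨z, hz, h, h'⟩
      · rw [h]; exact hdiag x
      · refine hrR S (Metric.mem_thickening_iff.2 ⟨(z, z), ⟨z, hz, rfl⟩, ?_⟩)
        rw [Prod.dist_eq, dist_eq_norm, dist_eq_norm]
        exact max_lt h h'
    · push Not at hx
      rw [hF' x hx]
      exact hdiag x
  · have hfin := finite_le_abs x (show (0 : ℝ) < 1 / (j + 1) by positivity)
    have hxb : x ∈ block j hfin.toFinset := by
      refine ⟨fun i hi => ?_, fun i hi => ?_⟩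
      · have hi' : 1 / (j + 1 : ℝ) ≤ |x i| := (hfin.mem_toFinset).1 hi
        rcases hx i with h | h
        · rw [h, abs_zero] at hi'
          have : (0 : ℝ) < 1 / (j + 1) := by positivity
          linarith
        · exact h
      · rcases hx i with h | h
        · exact h
        · exact absurd ((hfin.mem_toFinset).2 h.1) hi
    rw [hF _ x ⟨x, hxb, by simpa using hr0 _⟩]
    exact hτA _ x hxb

end C0

theorem exists_lipschitz_zero_set {Y : Type*} [MetricSpace Y] {F : Set Y} (hF : IsClosed F) :
    ∃ u : Y → ℝ, (∀ x, 0 ≤ u x) ∧ (∀ x y, |u x - u y| ≤ dist x y) ∧ ∀ x, u x = 0 ↔ x ∈ F := by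
  rcases F.eq_empty_or_nonempty with rfl | h
  · exact ⟨fun _ => 1, fun _ => zero_le_one, fun x y => by simp, fun x => by simp⟩
  · refine ⟨fun x => Metric.infDist x F, fun x => Metric.infDist_nonneg, fun x y => ?_,
      fun x => (hF.mem_iff_infDist_zero h).symm⟩
    have := (Metric.lipschitz_infDist_pt F).dist_le_mul x y
    simpa [Real.dist_eq] using this

theorem exists_uniform_limit {Y : Type*} [MetricSpace Y] [CompleteSpace Y] {f : ℕ → Y → Y}
    (hf : ∀ n, Continuous (f n)) (hd : ∀ n x, dist (f n x) (f (n + 1) x) ≤ 1 * (1 / 4 : ℝ) ^ n) :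
    ∃ G : Y → Y, Continuous G ∧ TendstoUniformly f G Filter.atTop := by
  have h4 : (1 / 4 : ℝ) < 1 := by norm_num
  have hC : ∀ x, ∃ y, Filter.Tendsto (fun n => f n x) Filter.atTop (𝓝 y) := fun x =>
    cauchySeq_tendsto_of_complete (cauchySeq_of_le_geometric _ _ h4 fun n => hd n x)
  choose G hG using hC
  have hu : TendstoUniformly f G Filter.atTop := by
    rw [Metric.tendstoUniformly_iff]
    intro ε hε
    have hl : Filter.Tendsto (fun n : ℕ => 1 * (1 / 4 : ℝ) ^ n / (1 - 1 / 4)) Filter.atTop (𝓝 0) := by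
      have := (tendsto_pow_atTop_nhds_zero_of_lt_one (by norm_num) h4).const_mul 1 |>.div_const
        (1 - 1 / 4 : ℝ)
      simpa using this
    filter_upwards [hl.eventually (gt_mem_nhds hε)] with n hn x
    rw [dist_comm]
    exact (dist_le_of_le_geometric_of_tendsto _ _ h4 (fun n => hd n x) (hG x) n).trans_lt hn
  exact ⟨G, hu.continuous (Filter.Frequently.of_forall hf), hu⟩

theorem exists_homeomorph_limit {Y : Type*} [MetricSpace Y] [CompleteSpace Y] {C F : ℕ → Set Y}
    (hC : ∀ j, IsClosed (C j)) (hF : ∀ k, IsClosed (F k))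
    (hst : ∀ (g : Y ≃ₜ Y) (j k : ℕ) (R : Set (Y × Y)), IsOpen R → (∀ x, (x, x) ∈ R) →
      ∃ τ : Y ≃ₜ Y, (∀ x, (x, τ x) ∈ R) ∧ ∀ x ∈ C j, g (τ x) ∉ F k) :
    ∃ g : Y ≃ₜ Y, ∀ j k, ∀ x ∈ C j, g x ∉ F k := by
  choose u hu0 hu1 huF using fun k => exists_lipschitz_zero_set (hF k)
  choose v hv0 hv1 hvC using fun j => exists_lipschitz_zero_set (hC j)
  have lipc : ∀ w : Y → ℝ, (∀ x y, |w x - w y| ≤ dist x y) → Continuous w := fun w hw =>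
    LipschitzWith.continuous (K := 1) (LipschitzWith.of_dist_le_mul fun x y => by
      simpa [Real.dist_eq] using hw x y)
  let P := {p : (Y ≃ₜ Y) × (Y → ℝ) // Continuous p.2 ∧ ∀ x, 0 < p.2 x}
  have step : ∀ (m : ℕ) (p : P), ∃ p' : P, (∀ x, dist (p.1.1 x) (p'.1.1 x) < p.1.2 x) ∧
      (∀ y, dist (p.1.1.symm y) (p'.1.1.symm y) < (1 / 4 : ℝ) ^ m) ∧
      (∀ x, p'.1.2 x ≤ p.1.2 x * (1 / 4)) ∧
      ∀ x ∈ C m.unpair.1, p'.1.2 x ≤ u m.unpair.2 (p'.1.1 x) / 4 := by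
    rintro m ⟨⟨g, e⟩, hec, he0⟩
    simp only at hec he0
    obtain ⟨τ, hτR, hτF⟩ := hst g m.unpair.1 m.unpair.2
      {q | dist q.2 q.1 < (1 / 4 : ℝ) ^ m ∧ dist (g q.1) (g q.2) < e q.1}
      (IsOpen.and (isOpen_lt (by fun_prop) continuous_const) (isOpen_lt (by fun_prop) (by fun_prop)))
      (fun x => ⟨by simp, by simpa using he0 x⟩)
    have huc := lipc _ (hu1 m.unpair.2)
    have hvc := lipc _ (hv1 m.unpair.1)
    refine ⟨⟨⟨τ.trans g, fun x => min (e x) (u m.unpair.2 (g (τ x)) + v m.unpair.1 x) * (1 / 4)⟩,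
      by fun_prop, fun x => ?_⟩, fun x => (hτR x).2, fun y => ?_, fun x => ?_, fun x hx => ?_⟩
    · have : 0 < u m.unpair.2 (g (τ x)) + v m.unpair.1 x := by
        by_cases hx : x ∈ C m.unpair.1
        · have h1 : 0 < u m.unpair.2 (g (τ x)) :=
            (hu0 _ _).lt_of_ne fun h => hτF x hx ((huF _ _).1 h.symm)
          linarith [hv0 m.unpair.1 x]
        · have h1 : 0 < v m.unpair.1 x := (hv0 _ _).lt_of_ne fun h => hx ((hvC _ _).1 h.symm)
          linarith [hu0 m.unpair.2 (g (τ x))]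
      have := lt_min (he0 x) this
      simp only
      positivity
    · have := (hτR (τ.symm (g.symm y))).1
      simpa using this
    · simp only
      gcongr
      exact min_le_left _ _
    · have h1 : v m.unpair.1 x = 0 := (hvC _ _).2 hx
      have h2 := min_le_right (e x) (u m.unpair.2 (g (τ x)) + v m.unpair.1 x)
      rw [h1, add_zero] at h2
      simp only [h1, add_zero, Homeomorph.trans_apply]
      linarith
  choose nxt hn1 hn2 hn3 hn4 using step
  let s : ℕ → P := fun n => Nat.rec ⟨⟨Homeomorph.refl Y, fun _ => 1⟩, continuous_const,
    fun _ => one_pos⟩ nxt n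
  have hs : ∀ n, s (n + 1) = nxt n (s n) := fun n => rfl
  have he : ∀ m n x, (s (m + n)).1.2 x ≤ (s m).1.2 x * (1 / 4 : ℝ) ^ n := by
    intro m n x
    induction n with
    | zero => simp
    | succ n ih =>
      rw [← add_assoc, hs, pow_succ, ← mul_assoc]
      exact (hn3 _ _ x).trans (by gcongr)
  have he' : ∀ n x, (s n).1.2 x ≤ 1 * (1 / 4 : ℝ) ^ n := fun n x => by
    have := he 0 n x
    rwa [zero_add] at this
  obtain ⟨G, hGc, hG⟩ := exists_uniform_limit (f := fun n => (s n).1.1)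
    (fun n => (s n).1.1.continuous) (fun n x => by
      rw [hs]; exact (hn1 n (s n) x).le.trans (he' n x))
  obtain ⟨G', hGc', hG'⟩ := exists_uniform_limit (f := fun n => (s n).1.1.symm)
    (fun n => (s n).1.1.symm.continuous) (fun n x => by
      rw [hs, one_mul]; exact (hn2 n (s n) x).le)
  refine ⟨⟨⟨G, G', fun x => ?_, fun x => ?_⟩, hGc, hGc'⟩, fun j k x hx => ?_⟩
  · have := hG'.tendsto_comp hGc'.continuousAt (hG.tendsto_at x)
    refine tendsto_nhds_unique this ?_
    simp
  · have := hG.tendsto_comp hGc.continuousAt (hG'.tendsto_at x)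
    refine tendsto_nhds_unique this ?_
    simp
  · change G x ∉ F k
    set m := Nat.pair j k with hm
    have h1 := hn4 m (s m) x (by rw [hm, Nat.unpair_pair]; exact hx)
    rw [hm, Nat.unpair_pair, ← hm, ← hs] at h1
    have h2 : dist ((s (m + 1)).1.1 x) (G x) ≤ (s (m + 1)).1.2 x / (1 - 1 / 4) := by
      refine dist_le_of_le_geometric_of_tendsto₀ (f := fun n => (s (m + 1 + n)).1.1 x) (1 / 4)
        ((s (m + 1)).1.2 x) (by norm_num) (fun n => ?_) ?_
      · exact (hn1 _ (s (m + 1 + n)) x).le.trans (he (m + 1) n x)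
      · have := (hG.tendsto_at x).comp (Filter.tendsto_add_atTop_nat (m + 1))
        refine this.congr fun n => ?_
        simp only [Function.comp_apply]
        rw [add_comm n]
    intro hGF
    have h3 := (abs_le.1 (hu1 k ((s (m + 1)).1.1 x) (G x))).2
    rw [(huF k _).2 hGF] at h3
    have h4 := (s (m + 1)).2.2 x
    norm_num at h2
    simp only at h1
    linarith

namespace C0
variable {ι : Type*} [TopologicalSpace ι] [DiscreteTopology ι]

theorem nonempty_homeomorph_compl [Infinite ι] {F : ℕ → Set C₀(ι, ℝ)} (hF : ∀ k, IsClosed (F k))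
    {h : C₀(ι, ℝ) × I → C₀(ι, ℝ)} (hc : Continuous h) (h0 : ∀ y, h (y, 0) = y)
    (hhF : ∀ y (t : I), t ≠ 0 → ∀ k, h (y, t) ∉ F k) :
    Nonempty ({y | ∀ k, y ∉ F k} ≃ₜ C₀(ι, ℝ)) := by
  obtain ⟨g, hg⟩ := exists_homeomorph_limit (C := layer ι) isClosed_layer hF
    (fun g j k R hR hdiag => exists_homeomorph_layer_avoid (A := g ⁻¹' F k)
      ((hF k).preimage g.continuous) (h := fun p => g.symm (h (g p.1, p.2))) (by fun_prop)
      (fun y => by simp [h0]) (fun y t ht => by simpa using hhF (g y) t ht k) j hR hdiag)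
  choose u hu0 hu1 huF using fun k => exists_lipschitz_zero_set ((hF k).preimage g.continuous)
  have hpos : ∀ x k, 0 < u k x ↔ g x ∉ F k := fun x k => by
    rw [(hu0 k x).lt_iff_ne, ne_comm, Ne, huF]; rfl
  obtain ⟨e⟩ := nonempty_homeomorph_of_pos (u := u)
    (fun k x y => by simpa [dist_eq_norm] using hu1 k x y)
    (fun x hx k => by
      obtain ⟨j, hj⟩ := exists_mem_layer hx
      exact (hpos x k).2 (hg j k x hj))
  refine ⟨Homeomorph.trans (Homeomorph.symm ?_) e⟩
  exact g.subtype fun x => forall_congr' fun k => hpos x k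

end C0

section TruncSum
variable {ι : Type*}

/-- The sum of the truncations at level `r` of a family of nonnegative numbers. -/
noncomputable def truncSum (b : ι → ℝ) (r : ℝ) : ℝ := ∑' j, min (max r 0) (b j)

theorem truncSum_of_nonpos {b : ι → ℝ} (hb : ∀ j, 0 ≤ b j) {r : ℝ} (hr : r ≤ 0) :
    truncSum b r = 0 := by
  simp [truncSum, max_eq_right hr, min_eq_left (hb _)]

theorem summable_trunc {b : ι → ℝ} (hb : ∀ j, 0 ≤ b j) (hs : Summable b) (r : ℝ) :
    Summable fun j => min (max r 0) (b j) :=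
  hs.of_nonneg_of_le (fun j => le_min (le_max_right _ _) (hb j)) fun _ => min_le_right _ _

theorem truncSum_nonneg {b : ι → ℝ} (hb : ∀ j, 0 ≤ b j) (r : ℝ) : 0 ≤ truncSum b r :=
  tsum_nonneg fun j => le_min (le_max_right _ _) (hb j)

theorem truncSum_mono {b : ι → ℝ} (hb : ∀ j, 0 ≤ b j) (hs : Summable b) : Monotone (truncSum b) :=
  fun r r' h => (summable_trunc hb hs r).tsum_le_tsum
    (fun _ => min_le_min_right _ (max_le_max_right _ h)) (summable_trunc hb hs r')

theorem truncSum_le_add {b b' : ι → ℝ} (hb : ∀ j, 0 ≤ b j) (hs : Summable b)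
    (hb' : ∀ j, 0 ≤ b' j) (hs' : Summable b') (r : ℝ) :
    truncSum b r ≤ truncSum b' r + ∑' j, |b j - b' j| := by
  have hd : Summable fun j => |b j - b' j| := (hs.sub hs').abs
  rw [truncSum, truncSum, ← (summable_trunc hb' hs' r).tsum_add hd]
  refine (summable_trunc hb hs r).tsum_le_tsum (fun j => ?_)
    ((summable_trunc hb' hs' r).add hd)
  have h1 := le_abs_self (b j - b' j)
  have h2 := abs_nonneg (b j - b' j)
  rcases le_total (max r 0) (b' j) with h | h
  · rw [min_eq_left h]; linarith [min_le_left (max r 0) (b j)]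
  · rw [min_eq_right h]; linarith [min_le_right (max r 0) (b j)]

theorem truncSum_le_add_truncSum {b : ι → ℝ} (hb : ∀ j, 0 ≤ b j) (hs : Summable b) (r r' : ℝ) :
    truncSum b r ≤ truncSum b r' + truncSum b |r - r'| := by
  rw [truncSum, truncSum, truncSum, ← (summable_trunc hb hs _).tsum_add (summable_trunc hb hs _)]
  refine (summable_trunc hb hs r).tsum_le_tsum (fun j => ?_)
    ((summable_trunc hb hs _).add (summable_trunc hb hs _))
  have h1 := le_abs_self (r - r')
  have h2 := abs_nonneg (r - r')
  have h3 := hb j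
  rw [max_eq_left h2]
  generalize |r - r'| = d at *
  simp only [min_def, max_def]
  split_ifs <;> linarith

theorem continuous_truncSum {b : ι → ℝ} (hb : ∀ j, 0 ≤ b j) (hs : Summable b) :
    Continuous (truncSum b) := by
  refine continuous_tsum (fun j => by fun_prop) hs fun j r => ?_
  rw [Real.norm_of_nonneg (le_min (le_max_right _ _) (hb j))]
  exact min_le_right _ _

theorem le_truncSum_self {b : ι → ℝ} (hb : ∀ j, 0 ≤ b j) (hs : Summable b) (i : ι) :
    b i ≤ truncSum b (b i) := by
  have := (summable_trunc hb hs (b i)).le_tsum i fun j _ => le_min (le_max_right _ _) (hb j)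
  rw [truncSum]
  simpa only [max_eq_left (hb i), min_self] using this

theorem sub_le_truncSum_sub {b : ι → ℝ} (hb : ∀ j, 0 ≤ b j) (hs : Summable b) {r : ℝ} {i : ι}
    (hr0 : 0 ≤ r) (hr : r ≤ b i) : b i - r ≤ truncSum b (b i) - truncSum b r := by
  rw [truncSum, truncSum, ← (summable_trunc hb hs _).tsum_sub (summable_trunc hb hs _)]
  have := ((summable_trunc hb hs (b i)).sub (summable_trunc hb hs r)).le_tsum i fun j _ =>
    sub_nonneg.2 (min_le_min_right (b j) (max_le_max_right 0 hr))
  simp only [max_eq_left (hb i), max_eq_left hr0, min_self, min_eq_left hr] at this ⊢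
  exact this

theorem truncSum_lt_iff {b : ι → ℝ} (hb : ∀ j, 0 ≤ b j) (hs : Summable b) (i k : ι) :
    truncSum b (b i) < truncSum b (b k) ↔ b i < b k := by
  refine ⟨fun h => ?_, fun h => ?_⟩
  · by_contra hh
    exact absurd (truncSum_mono hb hs (not_lt.1 hh)) (not_le.2 h)
  · linarith [sub_le_truncSum_sub hb hs (hb i) h.le]

theorem truncSum_pos_iff {b : ι → ℝ} (hb : ∀ j, 0 ≤ b j) (hs : Summable b) (i : ι) :
    0 < truncSum b (b i) ↔ 0 < b i := by
  refine ⟨fun h => ?_, fun h => h.trans_le (le_truncSum_self hb hs i)⟩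
  by_contra hh
  rw [truncSum_of_nonpos hb (not_lt.1 hh)] at h
  exact lt_irrefl _ h

theorem truncSum_sub_eq {b : ι → ℝ} (hb : ∀ j, 0 ≤ b j) (hs : Summable b) {r : ℝ} {i : ι}
    (hr0 : 0 ≤ r) (hr : r ≤ b i) (N : Finset ι) (hN : ∀ j, j ∈ N ↔ b i ≤ b j)
    (hgap : ∀ j, b j < b i → b j ≤ r) :
    truncSum b (b i) - truncSum b r = N.card * (b i - r) := by
  rw [truncSum, truncSum, ← (summable_trunc hb hs _).tsum_sub (summable_trunc hb hs _),
    tsum_eq_sum (s := N)]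
  · rw [← nsmul_eq_mul, ← Finset.sum_const]
    refine Finset.sum_congr rfl fun j hj => ?_
    have := (hN j).1 hj
    rw [max_eq_left (hb i), max_eq_left hr0, min_eq_left this, min_eq_left (hr.trans this)]
  · intro j hj
    have h1 : b j < b i := not_le.1 fun h => hj ((hN j).2 h)
    rw [max_eq_left (hb i), max_eq_left hr0, min_eq_right h1.le, min_eq_right (hgap j h1), sub_self]

theorem finite_le_of_summable {b : ι → ℝ} (hs : Summable b) {ε : ℝ} (hε : 0 < ε) :
    {i | ε ≤ b i}.Finite := by
  have h := hs.tendsto_cofinite_zero.eventually (gt_mem_nhds hε)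
  rw [Filter.eventually_cofinite] at h
  simpa using h

theorem le_of_truncSum_eq {b b' : ι → ℝ} (hb : ∀ j, 0 ≤ b j) (hs : Summable b)
    (hb' : ∀ j, 0 ≤ b' j) (hs' : Summable b')
    (h : ∀ i, truncSum b (b i) = truncSum b' (b' i)) (i₀ : ι) : b i₀ ≤ b' i₀ := by
  have hlt : ∀ i k, b i < b k ↔ b' i < b' k := fun i k => by
    rw [← truncSum_lt_iff hb hs, h, h, truncSum_lt_iff hb' hs']
  have hpos : ∀ i, 0 < b i ↔ 0 < b' i := fun i => by
    rw [← truncSum_pos_iff hb hs, h, truncSum_pos_iff hb' hs']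
  by_contra! hi₀
  have hfin : {i | b i₀ - b' i₀ ≤ b i - b' i}.Finite :=
    (finite_le_of_summable hs (sub_pos.2 hi₀)).subset fun i hi => by
      have hi' : b i₀ - b' i₀ ≤ b i - b' i := hi
      exact hi'.trans (by linarith [hb' i])
  obtain ⟨m, hm, hmax⟩ := hfin.exists_maximalFor (fun i => b i - b' i) _
    ⟨i₀, show b i₀ - b' i₀ ≤ b i₀ - b' i₀ from le_rfl⟩
  have hmax' : ∀ i, b i - b' i ≤ b m - b' m := fun i => by
    by_contra! hh
    have hm' : b i₀ - b' i₀ ≤ b m - b' m := hm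
    exact absurd (hmax (show b i₀ - b' i₀ ≤ b i - b' i by linarith) hh.le) (not_le.2 hh)
  have hfin2 : {i | b i - b' i = b m - b' m}.Finite := hfin.subset fun i hi => by
    have hi' : b i - b' i = b m - b' m := hi
    have hm' : b i₀ - b' i₀ ≤ b m - b' m := hm
    exact (hm'.trans_eq hi'.symm)
  obtain ⟨i, hi, hmin⟩ := hfin2.exists_minimalFor b _
    ⟨m, show b m - b' m = b m - b' m from rfl⟩
  have hi' : b i - b' i = b m - b' m := hi
  have hdi : 0 < b i - b' i := by
    have hm' : b i₀ - b' i₀ ≤ b m - b' m := hm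
    linarith
  have hbi : 0 < b i := by linarith [hb' i]
  have hNfin := finite_le_of_summable hs hbi
  have hN : ∀ j, j ∈ hNfin.toFinset ↔ b i ≤ b j := fun j => hNfin.mem_toFinset
  have hN' : ∀ j, j ∈ hNfin.toFinset ↔ b' i ≤ b' j := fun j => by
    rw [hN, ← not_lt, hlt, not_lt]
  have hcard : (hNfin.toFinset.card : ℝ) ≠ 0 := by
    have : i ∈ hNfin.toFinset := (hN i).2 le_rfl
    exact_mod_cast (Finset.card_pos.2 ⟨i, this⟩).ne'
  by_cases hlow : ∃ j, 0 < b j ∧ b j < b i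
  · obtain ⟨j₀, hj₀, hj₀i⟩ := hlow
    have hfin3 : {j | b j₀ ≤ b j ∧ b j < b i}.Finite :=
      (finite_le_of_summable hs hj₀).subset fun j hj => hj.1
    obtain ⟨k, hk, hkmax⟩ := hfin3.exists_maximalFor b _
      ⟨j₀, show b j₀ ≤ b j₀ ∧ b j₀ < b i from ⟨le_rfl, hj₀i⟩⟩
    have hgap : ∀ j, b j < b i → b j ≤ b k := fun j hj => by
      by_contra! hh
      exact absurd (hkmax (show b j₀ ≤ b j ∧ b j < b i from ⟨hk.1.trans hh.le, hj⟩) hh.le)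
        (not_le.2 hh)
    have e1 := truncSum_sub_eq hb hs (hb k) hk.2.le _ hN hgap
    have e2 := truncSum_sub_eq hb' hs' (hb' k) ((hlt k i).1 hk.2).le _ hN' fun j hj => by
      by_contra! hh
      exact absurd (hgap j ((hlt j i).2 hj)) (not_le.2 ((hlt k j).2 hh))
    rw [h, h, e2] at e1
    have e3 := mul_left_cancel₀ hcard e1
    have e4 : b k - b' k = b m - b' m := by linarith
    exact absurd (hmin e4 hk.2.le) (not_le.2 hk.2)
  · push Not at hlow
    have hz : ∀ j, b j < b i → b j ≤ 0 := fun j hj => by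
      by_contra! hh
      exact absurd (hlow j hh) (not_le.2 hj)
    have e1 := truncSum_sub_eq hb hs le_rfl hbi.le _ hN hz
    have e2 := truncSum_sub_eq hb' hs' le_rfl (hb' i) _ hN' fun j hj => by
      by_contra! hh
      exact absurd (hz j ((hlt j i).2 hj)) (not_le.2 ((hpos j).2 hh))
    rw [truncSum_of_nonpos hb le_rfl, h] at e1
    rw [truncSum_of_nonpos hb' le_rfl, e1] at e2
    have e3 := mul_left_cancel₀ hcard e2
    linarith

end TruncSum

section L2
variable {ι : Type*}

theorem l2_hasSum_sq (y : lp (fun _ : ι => ℝ) 2) : HasSum (fun i => y i ^ 2) (‖y‖ ^ 2) := by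
  have := lp.hasSum_norm (p := 2) (by norm_num) y
  simpa using this

theorem l2_abs_le_norm (y : lp (fun _ : ι => ℝ) 2) (i : ι) : |y i| ≤ ‖y‖ :=
  lp.norm_apply_le_norm (by norm_num) y i

theorem l2_tsum_abs_sq_sub_le (y y' : lp (fun _ : ι => ℝ) 2) :
    ∑' i, |y i ^ 2 - y' i ^ 2| ≤ ‖y - y'‖ * ‖y + y'‖ := by
  refine ((l2_hasSum_sq y).summable.sub (l2_hasSum_sq y').summable).abs.tsum_le_of_sum_le
    fun s => ?_
  have hle : ∀ z : lp (fun _ : ι => ℝ) 2, √(∑ i ∈ s, |z i| ^ 2) ≤ ‖z‖ := fun z => by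
    refine Real.sqrt_le_iff.2 ⟨norm_nonneg _, ?_⟩
    simp only [sq_abs]
    exact sum_le_hasSum s (fun i _ => sq_nonneg _) (l2_hasSum_sq z)
  calc ∑ i ∈ s, |y i ^ 2 - y' i ^ 2| = ∑ i ∈ s, |(y - y') i| * |(y + y') i| := by
        refine Finset.sum_congr rfl fun i _ => ?_
        rw [← abs_mul, lp.coeFn_sub, lp.coeFn_add, Pi.sub_apply, Pi.add_apply]
        ring_nf
    _ ≤ √(∑ i ∈ s, |(y - y') i| ^ 2) * √(∑ i ∈ s, |(y + y') i| ^ 2) :=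
        Real.sum_mul_le_sqrt_mul_sqrt _ _ _
    _ ≤ _ := mul_le_mul (hle _) (hle _) (Real.sqrt_nonneg _) (norm_nonneg _)

theorem abs_mul_abs_sub_le (u v : ℝ) : |u * |u| - (v * |v|)| ≤ |u - v| * (|u| + |v|) := by
  have h : u * |u| - v * |v| = (u - v) * |u| + v * (|u| - |v|) := by ring
  rw [h, mul_add]
  refine (abs_add_le _ _).trans ?_
  rw [abs_mul, abs_mul, abs_abs, mul_comm |v|]
  exact add_le_add_right (mul_le_mul_of_nonneg_right (abs_abs_sub_abs_le u v) (abs_nonneg v)) _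

/-- The signed coordinate of the homeomorphism from `ℓ²` to `c₀`. -/
noncomputable def l2ToC0Coord (y : ι → ℝ) (i : ι) : ℝ :=
  truncSum (fun j => y j ^ 2) (y i * |y i|) - truncSum (fun j => y j ^ 2) (-(y i * |y i|))

theorem l2ToC0Coord_of_nonneg {y : ι → ℝ} {i : ι} (h : 0 ≤ y i) :
    l2ToC0Coord y i = truncSum (fun j => y j ^ 2) (y i ^ 2) := by
  rw [l2ToC0Coord, truncSum_of_nonpos (r := -(y i * |y i|)) (fun j => sq_nonneg _)
    (neg_nonpos.2 (mul_nonneg h (abs_nonneg _))), abs_of_nonneg h, sub_zero, sq]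

theorem l2ToC0Coord_of_nonpos {y : ι → ℝ} {i : ι} (h : y i ≤ 0) :
    l2ToC0Coord y i = -truncSum (fun j => y j ^ 2) (y i ^ 2) := by
  rw [l2ToC0Coord, truncSum_of_nonpos (r := y i * |y i|) (fun j => sq_nonneg _)
    (mul_nonpos_of_nonpos_of_nonneg h (abs_nonneg _)), abs_of_nonpos h, zero_sub]
  congr 2
  ring

theorem abs_l2ToC0Coord (y : ι → ℝ) (i : ι) :
    |l2ToC0Coord y i| = truncSum (fun j => y j ^ 2) (y i ^ 2) := by
  rcases le_total 0 (y i) with h | h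
  · rw [l2ToC0Coord_of_nonneg h, abs_of_nonneg (truncSum_nonneg (fun j => sq_nonneg _) _)]
  · rw [l2ToC0Coord_of_nonpos h, abs_neg, abs_of_nonneg (truncSum_nonneg (fun j => sq_nonneg _) _)]

theorem l2ToC0Coord_injective {y y' : ι → ℝ} (hs : Summable fun i => y i ^ 2)
    (hs' : Summable fun i => y' i ^ 2) (h : ∀ i, l2ToC0Coord y i = l2ToC0Coord y' i) :
    y = y' := by
  have hT : ∀ i, truncSum (fun j => y j ^ 2) (y i ^ 2) = truncSum (fun j => y' j ^ 2) (y' i ^ 2) :=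
    fun i => by rw [← abs_l2ToC0Coord, ← abs_l2ToC0Coord, h]
  have hn : ∀ (z : ι → ℝ) (j : ι), 0 ≤ z j ^ 2 := fun z j => sq_nonneg _
  have hsq : ∀ i, y i ^ 2 = y' i ^ 2 := fun i => le_antisymm
    (le_of_truncSum_eq (hn y) hs (hn y') hs' hT i)
    (le_of_truncSum_eq (hn y') hs' (hn y) hs (fun i => (hT i).symm) i)
  funext i
  rcases sq_eq_sq_iff_eq_or_eq_neg.1 (hsq i) with h1 | h1
  · exact h1
  · have hle := le_truncSum_self (hn y) hs i
    have hle' := le_truncSum_self (hn y') hs' i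
    have hh := h i
    rcases le_total 0 (y i) with h2 | h2
    · rw [l2ToC0Coord_of_nonneg h2, l2ToC0Coord_of_nonpos (by linarith)] at hh
      have : y i ^ 2 = 0 := le_antisymm (by linarith [hn y' i]) (hn y i)
      have := pow_eq_zero_iff (two_ne_zero) |>.1 this
      linarith
    · rw [l2ToC0Coord_of_nonpos h2, l2ToC0Coord_of_nonneg (by linarith)] at hh
      have : y i ^ 2 = 0 := le_antisymm (by linarith [hn y' i]) (hn y i)
      have := pow_eq_zero_iff (two_ne_zero) |>.1 this
      linarith

theorem l2ToC0Coord_sub_le (y y' : lp (fun _ : ι => ℝ) 2) (i : ι) :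
    |l2ToC0Coord y' i - l2ToC0Coord y i| ≤ 2 * (‖y' - y‖ * ‖y' + y‖ +
      truncSum (fun j => y j ^ 2) (‖y' - y‖ * (‖y'‖ + ‖y‖))) := by
  have hn : ∀ (z : ι → ℝ) (j : ι), 0 ≤ z j ^ 2 := fun z j => sq_nonneg _
  have hs := (l2_hasSum_sq y).summable
  have hs' := (l2_hasSum_sq y').summable
  have hS := l2_tsum_abs_sq_sub_le y' y
  have hS' : ∑' i, |y i ^ 2 - y' i ^ 2| ≤ ‖y' - y‖ * ‖y' + y‖ := by
    simpa only [abs_sub_comm] using hS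
  have ha : |y' i * |y' i| - (y i * |y i|)| ≤ ‖y' - y‖ * (‖y'‖ + ‖y‖) :=
    (abs_mul_abs_sub_le _ _).trans (mul_le_mul (l2_abs_le_norm (y' - y) i)
      (add_le_add (l2_abs_le_norm _ _) (l2_abs_le_norm _ _)) (by positivity) (norm_nonneg _))
  have key : ∀ r r' : ℝ, |r' - r| ≤ ‖y' - y‖ * (‖y'‖ + ‖y‖) →
      |truncSum (fun j => y' j ^ 2) r' - truncSum (fun j => y j ^ 2) r| ≤
        ‖y' - y‖ * ‖y' + y‖ + truncSum (fun j => y j ^ 2) (‖y' - y‖ * (‖y'‖ + ‖y‖)) := by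
    intro r r' hr
    have h0 := truncSum_mono (hn y) hs hr
    have h1 := truncSum_le_add (hn y') hs' (hn y) hs r'
    have h2 := truncSum_le_add_truncSum (hn y) hs r' r
    have h3 := truncSum_le_add (hn y) hs (hn y') hs' r'
    have h4 := truncSum_le_add_truncSum (hn y) hs r r'
    rw [abs_sub_comm] at h4
    rw [abs_le]
    constructor <;> linarith
  rw [l2ToC0Coord, l2ToC0Coord]
  have k1 := key _ _ ha
  have k2 := key (-(y i * |y i|)) (-(y' i * |y' i|)) (by
    rw [neg_sub_neg, abs_sub_comm]; exact ha)
  rw [abs_le] at k1 k2 ⊢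
  constructor <;> linarith [k1.1, k1.2, k2.1, k2.2]

variable [TopologicalSpace ι] [DiscreteTopology ι]

theorem l2ToC0Coord_finite (y : lp (fun _ : ι => ℝ) 2) {ε : ℝ} (hε : 0 < ε) :
    {i | ε ≤ |l2ToC0Coord y i|}.Finite := by
  have hn : ∀ j, 0 ≤ y j ^ 2 := fun j => sq_nonneg _
  have hs := (l2_hasSum_sq y).summable
  have hc := (continuous_truncSum hn hs).tendsto 0
  rw [truncSum_of_nonpos hn le_rfl] at hc
  obtain ⟨δ, hδ, hd⟩ := Metric.eventually_nhds_iff.1 (hc.eventually (gt_mem_nhds hε))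
  refine (finite_le_of_summable hs hδ).subset fun i (hi : ε ≤ |l2ToC0Coord y i|) => ?_
  rw [abs_l2ToC0Coord] at hi
  by_contra hh
  have hh' : y i ^ 2 < δ := not_le.1 hh
  refine absurd (hd (y := y i ^ 2) ?_) (not_lt.2 hi)
  rwa [Real.dist_eq, sub_zero, abs_of_nonneg (hn i)]

/-- The continuous injection of `ℓ²` in `c₀`. -/
noncomputable def l2ToC0 (y : lp (fun _ : ι => ℝ) 2) : C₀(ι, ℝ) :=
  C0.ofFinite (l2ToC0Coord y) fun _ hε => l2ToC0Coord_finite y hε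

theorem l2ToC0_apply (y : lp (fun _ : ι => ℝ) 2) (i : ι) : l2ToC0 y i = l2ToC0Coord y i :=
  C0.ofFinite_apply _ _ _

theorem l2ToC0_injective : Function.Injective (l2ToC0 : lp (fun _ : ι => ℝ) 2 → C₀(ι, ℝ)) :=
  fun y y' h => by
    have := l2ToC0Coord_injective (l2_hasSum_sq y).summable (l2_hasSum_sq y').summable fun i => by
      rw [← l2ToC0_apply, h, l2ToC0_apply]
    exact lp.ext this

theorem continuous_l2ToC0 : Continuous (l2ToC0 : lp (fun _ : ι => ℝ) 2 → C₀(ι, ℝ)) := by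
  rw [continuous_iff_continuousAt]
  intro y
  have hn : ∀ j, 0 ≤ y j ^ 2 := fun j => sq_nonneg _
  have hT := continuous_truncSum hn (l2_hasSum_sq y).summable
  have hc : Continuous fun y' : lp (fun _ : ι => ℝ) 2 => 2 * (‖y' - y‖ * ‖y' + y‖ +
      truncSum (fun j => y j ^ 2) (‖y' - y‖ * (‖y'‖ + ‖y‖))) := by fun_prop
  have ht := hc.tendsto y
  simp only [sub_self, norm_zero, zero_mul, truncSum_of_nonpos hn le_rfl, add_zero,
    mul_zero] at ht
  rw [ContinuousAt, tendsto_iff_norm_sub_tendsto_zero]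
  refine squeeze_zero (fun _ => norm_nonneg _) (fun y' => ?_) ht
  have h0 := fun i => l2ToC0Coord_sub_le y y' i
  refine (C0.norm_sub_le ?_).2 fun i => ?_
  · have := truncSum_nonneg hn (‖y' - y‖ * (‖y'‖ + ‖y‖))
    positivity
  · rw [l2ToC0_apply, l2ToC0_apply]
    exact h0 i

end L2

namespace C0
open MeasureTheory
variable {ι : Type*} [TopologicalSpace ι] [DiscreteTopology ι]

/-- The reciprocal of the number of coordinates of absolute value at least `ρ`. -/
noncomputable def recipCount (x : C₀(ι, ℝ)) (ρ : ℝ) : ℝ :=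
  if ρ ≤ 0 then 0 else (max 1 ({i | ρ ≤ |x i|}.ncard : ℝ))⁻¹

theorem recipCount_of_nonpos (x : C₀(ι, ℝ)) {ρ : ℝ} (h : ρ ≤ 0) : recipCount x ρ = 0 := if_pos h

theorem recipCount_of_pos (x : C₀(ι, ℝ)) {ρ : ℝ} (h : 0 < ρ) :
    recipCount x ρ = (max 1 ({i | ρ ≤ |x i|}.ncard : ℝ))⁻¹ := if_neg (not_le.2 h)

theorem recipCount_nonneg (x : C₀(ι, ℝ)) (ρ : ℝ) : 0 ≤ recipCount x ρ := by
  rw [recipCount]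
  split_ifs <;> positivity

theorem recipCount_le_one (x : C₀(ι, ℝ)) (ρ : ℝ) : recipCount x ρ ≤ 1 := by
  rw [recipCount]
  split_ifs
  · exact zero_le_one
  · exact inv_le_one_of_one_le₀ (le_max_left _ _)

theorem recipCount_le_recipCount {x x' : C₀(ι, ℝ)} {ρ ρ' : ℝ} (h : ρ + ‖x - x'‖ ≤ ρ') :
    recipCount x ρ ≤ recipCount x' ρ' := by
  rcases le_or_gt ρ 0 with h0 | h0
  · rw [recipCount_of_nonpos x h0]
    exact recipCount_nonneg _ _
  · have hn := norm_nonneg (x - x')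
    have h0' : 0 < ρ' := by linarith
    rw [recipCount_of_pos x h0, recipCount_of_pos x' h0']
    have : {i | ρ' ≤ |x' i|}.ncard ≤ {i | ρ ≤ |x i|}.ncard := by
      refine Set.ncard_le_ncard (fun i (hi : ρ' ≤ |x' i|) => ?_) (finite_le_abs x h0)
      change ρ ≤ |x i|
      have h1 := abs_sub_le_norm x x' i
      have h2 := abs_sub_abs_le_abs_sub (x' i) (x i)
      rw [abs_sub_comm] at h2
      linarith
    gcongr

theorem recipCount_mono (x : C₀(ι, ℝ)) : Monotone (recipCount x) := fun ρ ρ' h =>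
  recipCount_le_recipCount (by simpa using h)

theorem intervalIntegrable_recipCount (x : C₀(ι, ℝ)) (a b : ℝ) :
    IntervalIntegrable (recipCount x) volume a b := (recipCount_mono x).intervalIntegrable

/-- The integral of `recipCount`. -/
noncomputable def lam (x : C₀(ι, ℝ)) (r : ℝ) : ℝ := ∫ ρ in (0 : ℝ)..r, recipCount x ρ

theorem lam_sub (x : C₀(ι, ℝ)) (r r' : ℝ) : lam x r - lam x r' = ∫ ρ in r'..r, recipCount x ρ :=
  intervalIntegral.integral_interval_sub_left (intervalIntegrable_recipCount x _ _)
    (intervalIntegrable_recipCount x _ _)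

theorem lam_of_nonpos (x : C₀(ι, ℝ)) {r : ℝ} (h : r ≤ 0) : lam x r = 0 := by
  rw [lam, intervalIntegral.integral_congr (g := fun _ => (0 : ℝ)), intervalIntegral.integral_zero]
  intro ρ hρ
  rw [Set.uIcc_of_ge h] at hρ
  exact recipCount_of_nonpos x hρ.2

theorem lam_mono (x : C₀(ι, ℝ)) : Monotone (lam x) := fun r r' h => by
  rw [← sub_nonneg, lam_sub]
  exact intervalIntegral.integral_nonneg h fun ρ _ => recipCount_nonneg x ρ

theorem lam_nonneg (x : C₀(ι, ℝ)) (r : ℝ) : 0 ≤ lam x r := by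
  rcases le_total r 0 with h | h
  · rw [lam_of_nonpos x h]
  · rw [← lam_of_nonpos x le_rfl]
    exact lam_mono x h

theorem lam_sub_le (x : C₀(ι, ℝ)) {r r' : ℝ} (h : r' ≤ r) : lam x r - lam x r' ≤ r - r' := by
  rw [lam_sub]
  have := intervalIntegral.integral_mono_on (μ := volume) h
    (intervalIntegrable_recipCount x r' r) intervalIntegrable_const
    fun ρ _ => recipCount_le_one x ρ
  simpa using this

theorem lam_le_add (x x' : C₀(ι, ℝ)) (r r' : ℝ) : lam x r ≤ lam x' r' + |r - r'| + ‖x - x'‖ := by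
  have hd : ∀ y : C₀(ι, ℝ), ∀ s s', lam y s ≤ lam y s' + |s - s'| := fun y s s' => by
    rcases le_total s' s with h | h
    · have := lam_sub_le y h
      have := le_abs_self (s - s')
      linarith
    · have := lam_mono y h
      have := abs_nonneg (s - s')
      linarith
  set η := ‖x - x'‖
  have hη : 0 ≤ η := norm_nonneg _
  have h1 := hd x r (r - η)
  rw [sub_sub_cancel, abs_of_nonneg hη] at h1
  have h2 : lam x (r - η) ≤ lam x' r := by
    rcases le_total (r - η) 0 with h | h
    · rw [lam_of_nonpos x h]
      exact lam_nonneg _ _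
    · have h_int : ∫ ρ in η..r, recipCount x (ρ - η) = lam x (r - η) := by
        rw [intervalIntegral.integral_comp_sub_right (fun ρ => recipCount x ρ), sub_self]
        rfl
      rw [← h_int]
      have h3 : ∫ ρ in η..r, recipCount x (ρ - η) ≤ ∫ ρ in η..r, recipCount x' ρ := by
        refine intervalIntegral.integral_mono_on (by linarith) ?_
          (intervalIntegrable_recipCount x' _ _)
          fun ρ _ => recipCount_le_recipCount (sub_add_cancel _ _).le
        refine Monotone.intervalIntegrable fun a b hab => recipCount_mono x ?_
        linarith
      rw [← lam_sub] at h3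
      linarith [lam_nonneg x' η]
  have h4 := hd x' r r'
  linarith

theorem continuous_lam {f : C₀(ι, ℝ) → ℝ} (hf : Continuous f) : Continuous fun x => lam x (f x) := by
  rw [continuous_iff_continuousAt]
  intro x
  have hc : Continuous fun x' => |f x' - f x| + ‖x' - x‖ := by fun_prop
  have ht := hc.tendsto x
  simp only [sub_self, abs_zero, norm_zero, add_zero] at ht
  rw [ContinuousAt, tendsto_iff_norm_sub_tendsto_zero]
  refine squeeze_zero (fun _ => norm_nonneg _) (fun x' => ?_) ht
  have h1 := lam_le_add x x' (f x) (f x')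
  have h2 := lam_le_add x' x (f x') (f x)
  rw [norm_sub_rev, abs_sub_comm] at h1
  rw [Real.norm_eq_abs, abs_le]
  constructor <;> linarith

theorem lam_min (x : C₀(ι, ℝ)) {r c : ℝ} (hr : 0 ≤ r) (hc : 0 ≤ c) :
    lam x (min r c) = ∫ ρ in Set.Ioc 0 r, (Set.Iic c).indicator (recipCount x) ρ := by
  rw [setIntegral_indicator measurableSet_Iic, Set.Ioc_inter_Iic, lam,
    intervalIntegral.integral_of_le (le_min hr hc)]

theorem integrableOn_indicator_recipCount (x : C₀(ι, ℝ)) {r : ℝ} (hr : 0 ≤ r) (c : ℝ) :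
    IntegrableOn ((Set.Iic c).indicator (recipCount x)) (Set.Ioc 0 r) := by
  refine Integrable.indicator ?_ measurableSet_Iic
  exact (intervalIntegrable_iff_integrableOn_Ioc_of_le hr).1 (intervalIntegrable_recipCount x 0 r)

theorem sum_lam_min (x : C₀(ι, ℝ)) {r : ℝ} (hr : 0 ≤ r) (J : Finset ι) :
    ∑ i ∈ J, lam x (min r |x i|) =
      ∫ ρ in Set.Ioc 0 r, ∑ i ∈ J, (Set.Iic |x i|).indicator (recipCount x) ρ := by
  rw [integral_finsetSum _ fun i _ => integrableOn_indicator_recipCount x hr _]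
  exact Finset.sum_congr rfl fun i _ => lam_min x hr (abs_nonneg _)

theorem sum_indicator_recipCount (x : C₀(ι, ℝ)) (J : Finset ι) (ρ : ℝ) :
    ∑ i ∈ J, (Set.Iic |x i|).indicator (recipCount x) ρ =
      (J.filter fun i => ρ ≤ |x i|).card * recipCount x ρ := by
  rw [← nsmul_eq_mul, ← Finset.sum_const, Finset.sum_filter]
  refine Finset.sum_congr rfl fun i _ => ?_
  rw [Set.indicator_apply]
  rfl

theorem sum_lam_min_le (x : C₀(ι, ℝ)) {r : ℝ} (hr : 0 ≤ r) (J : Finset ι) :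
    ∑ i ∈ J, lam x (min r |x i|) ≤ r := by
  rw [sum_lam_min x hr]
  have : ∫ ρ in Set.Ioc 0 r, ∑ i ∈ J, (Set.Iic |x i|).indicator (recipCount x) ρ ≤
      ∫ ρ in Set.Ioc 0 r, (1 : ℝ) := by
    refine setIntegral_mono_on (integrable_finsetSum _ fun i _ =>
      integrableOn_indicator_recipCount x hr _) (by simp) measurableSet_Ioc fun ρ hρ => ?_
    rw [sum_indicator_recipCount, recipCount_of_pos x hρ.1, ← div_eq_mul_inv]
    refine div_le_one_of_le₀ ((Nat.cast_le.2 ?_).trans (le_max_right _ _)) (by positivity)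
    rw [← Set.ncard_coe_finset]
    refine Set.ncard_le_ncard (fun i hi => ?_) (finite_le_abs x hρ.1)
    exact (Finset.mem_filter.1 (Finset.mem_coe.1 hi)).2
  simpa [hr] using this

theorem sub_le_sum_lam_min (x : C₀(ι, ℝ)) {i : ι} {δ : ℝ} (hδ : 0 < δ) (hδi : δ ≤ |x i|)
    (J : Finset ι) (hJ : ∀ j, δ ≤ |x j| → j ∈ J) :
    |x i| - δ ≤ ∑ j ∈ J, lam x (min |x i| |x j|) := by
  rw [sum_lam_min x (abs_nonneg _)]
  have : ∫ ρ in Set.Ioc 0 |x i|, (Set.Ioi δ).indicator (fun _ => (1 : ℝ)) ρ ≤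
      ∫ ρ in Set.Ioc 0 |x i|, ∑ j ∈ J, (Set.Iic |x j|).indicator (recipCount x) ρ := by
    refine setIntegral_mono_on (Integrable.indicator (by simp) measurableSet_Ioi)
      (integrable_finsetSum _ fun i _ =>
      integrableOn_indicator_recipCount x (abs_nonneg _) _) measurableSet_Ioc fun ρ hρ => ?_
    rw [sum_indicator_recipCount]
    rw [Set.indicator_apply]
    split_ifs with hρδ
    swap
    · exact mul_nonneg (Nat.cast_nonneg _) (recipCount_nonneg _ _)
    have hρδ' : δ < ρ := hρδ
    rw [recipCount_of_pos x hρ.1]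
    have hcard : (J.filter fun j => ρ ≤ |x j|).card = {j | ρ ≤ |x j|}.ncard := by
      rw [← Set.ncard_coe_finset]
      congr 1
      ext j
      rw [Finset.mem_coe, Finset.mem_filter]
      exact ⟨fun h => h.2, fun h => ⟨hJ j (hρδ'.le.trans h), h⟩⟩
    have hpos : 0 < (J.filter fun j => ρ ≤ |x j|).card :=
      Finset.card_pos.2 ⟨i, Finset.mem_filter.2 ⟨hJ i hδi, hρ.2⟩⟩
    rw [← hcard, max_eq_right (by exact_mod_cast hpos)]
    exact (mul_inv_cancel₀ (by exact_mod_cast hpos.ne')).ge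
  rw [setIntegral_indicator measurableSet_Ioi, Set.Ioc_inter_Ioi, max_eq_right hδ.le] at this
  simpa [hδi] using this

end C0

namespace C0
variable {ι : Type*} [TopologicalSpace ι] [DiscreteTopology ι]

theorem sum_lam_le (x : C₀(ι, ℝ)) {r : ℝ} (hr : 0 ≤ r) (J : Finset ι) (hJ : ∀ i ∈ J, |x i| ≤ r) :
    ∑ i ∈ J, lam x |x i| ≤ r := by
  refine (Finset.sum_congr rfl fun i hi => ?_).trans_le (sum_lam_min_le x hr J)
  rw [min_eq_right (hJ i hi)]

theorem summable_lam (x : C₀(ι, ℝ)) : Summable fun i => lam x |x i| :=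
  summable_of_sum_le (fun _ => lam_nonneg x _)
    fun J => sum_lam_le x (norm_nonneg x) J fun _ _ => abs_le_norm x _

/-- The coordinates of the inverse homeomorphism from `c₀` to `ℓ²`. -/
noncomputable def toL2Coord (x : C₀(ι, ℝ)) (i : ι) : ℝ := √(lam x (x i)) - √(lam x (-x i))

theorem toL2Coord_of_nonneg {x : C₀(ι, ℝ)} {i : ι} (h : 0 ≤ x i) :
    toL2Coord x i = √(lam x |x i|) := by
  rw [toL2Coord, lam_of_nonpos (r := -x i) x (neg_nonpos.2 h), Real.sqrt_zero, sub_zero,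
    abs_of_nonneg h]

theorem toL2Coord_of_nonpos {x : C₀(ι, ℝ)} {i : ι} (h : x i ≤ 0) :
    toL2Coord x i = -√(lam x |x i|) := by
  rw [toL2Coord, lam_of_nonpos (r := x i) x h, Real.sqrt_zero, zero_sub, abs_of_nonpos h]

theorem toL2Coord_sq (x : C₀(ι, ℝ)) (i : ι) : toL2Coord x i ^ 2 = lam x |x i| := by
  rcases le_total 0 (x i) with h | h
  · rw [toL2Coord_of_nonneg h, Real.sq_sqrt (lam_nonneg _ _)]
  · rw [toL2Coord_of_nonpos h, neg_sq, Real.sq_sqrt (lam_nonneg _ _)]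

/-- The inverse homeomorphism from `c₀` to `ℓ²`. -/
noncomputable def toL2 (x : C₀(ι, ℝ)) : lp (fun _ : ι => ℝ) 2 :=
  ⟨toL2Coord x, memℓp_gen (by
    have := summable_lam x
    simp only [← toL2Coord_sq] at this
    simpa using this)⟩

theorem toL2_apply (x : C₀(ι, ℝ)) (i : ι) : toL2 x i = toL2Coord x i := rfl

theorem continuous_toL2Coord (i : ι) : Continuous fun x : C₀(ι, ℝ) => toL2Coord x i :=
  (continuous_lam (continuous_apply i)).sqrt.sub (continuous_lam (continuous_apply i).neg).sqrt

theorem continuous_toL2 : Continuous (toL2 : C₀(ι, ℝ) → lp (fun _ : ι => ℝ) 2) := by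
  rw [continuous_iff_continuousAt]
  intro x
  rw [ContinuousAt, Metric.tendsto_nhds]
  intro ε hε
  obtain ⟨δ, hδ, hδε⟩ : ∃ δ > 0, 6 * δ < ε ^ 2 / 2 :=
    ⟨ε ^ 2 / 13, by positivity, by have := pow_pos hε 2; linarith⟩
  classical
  let J := (finite_le_abs x hδ).toFinset
  have hJ : ∀ i, i ∉ J → |x i| < δ := fun i hi => by
    by_contra hh
    exact hi ((finite_le_abs x hδ).mem_toFinset.2 (not_lt.1 hh))
  have hcJ : Continuous fun x' => ∑ i ∈ J, (toL2Coord x' i - toL2Coord x i) ^ 2 :=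
    continuous_finsetSum _ fun _ _ => ((continuous_toL2Coord _).sub continuous_const).pow 2
  have ht := hcJ.tendsto x
  simp only [sub_self, ne_eq, OfNat.ofNat_ne_zero, not_false_eq_true, zero_pow,
    Finset.sum_const_zero] at ht
  filter_upwards [ht.eventually (gt_mem_nhds (show 0 < ε ^ 2 / 2 by positivity)),
    Metric.ball_mem_nhds x hδ] with x' h1 h2
  rw [Metric.mem_ball, dist_eq_norm] at h2
  have h3 : ‖toL2 x' - toL2 x‖ ^ 2 ≤
      ∑ i ∈ J, (toL2Coord x' i - toL2Coord x i) ^ 2 + 6 * δ := by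
    refine hasSum_le_of_sum_le (l2_hasSum_sq _) fun s => ?_
    rw [← Finset.sum_inter_add_sum_sdiff s J]
    refine add_le_add (Finset.sum_le_sum_of_subset_of_nonneg Finset.inter_subset_right
      fun i _ _ => sq_nonneg _) ?_
    have hsJ : ∀ i ∈ s \ J, |x i| ≤ δ := fun i hi => (hJ i (Finset.mem_sdiff.1 hi).2).le
    have e1 := sum_lam_le x hδ.le (s \ J) hsJ
    have e2 := sum_lam_le x' (r := 2 * δ) (by linarith) (s \ J) fun i hi => by
      have := hsJ i hi
      have := abs_sub_le_norm x' x i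
      have := abs_sub_abs_le_abs_sub (x' i) (x i)
      linarith
    have e3 : ∑ i ∈ s \ J, (toL2 x' - toL2 x : lp (fun _ : ι => ℝ) 2) i ^ 2 ≤
        ∑ i ∈ s \ J, (2 * lam x' |x' i| + 2 * lam x |x i|) := by
      refine Finset.sum_le_sum fun i _ => ?_
      rw [← toL2Coord_sq, ← toL2Coord_sq, lp.coeFn_sub, Pi.sub_apply, toL2_apply, toL2_apply]
      nlinarith [sq_nonneg (toL2Coord x' i + toL2Coord x i)]
    rw [Finset.sum_add_distrib, ← Finset.mul_sum, ← Finset.mul_sum] at e3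
    linarith
  rw [dist_eq_norm]
  exact lt_of_pow_lt_pow_left₀ 2 hε.le (by linarith)

theorem truncSum_lam (x : C₀(ι, ℝ)) (i : ι) :
    truncSum (fun j => lam x |x j|) (lam x |x i|) = |x i| := by
  have hn : ∀ j, 0 ≤ lam x |x j| := fun j => lam_nonneg _ _
  have hs := summable_trunc hn (summable_lam x) (lam x |x i|)
  rw [truncSum]
  simp only [max_eq_left (hn i), ← (lam_mono x).map_min] at hs ⊢
  refine le_antisymm (hs.tsum_le_of_sum_le fun J => sum_lam_min_le x (abs_nonneg _) J) ?_
  rcases (abs_nonneg (x i)).eq_or_lt with h0 | h0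
  · rw [← h0]
    exact tsum_nonneg fun j => lam_nonneg _ _
  · refine le_of_forall_pos_lt_add fun ε hε => ?_
    have hδ : 0 < min (ε / 2) |x i| := lt_min (half_pos hε) h0
    have h1 := sub_le_sum_lam_min x hδ (min_le_right _ _) (finite_le_abs x hδ).toFinset
      fun j hj => (finite_le_abs x hδ).mem_toFinset.2 hj
    have h2 := hs.sum_le_tsum (finite_le_abs x hδ).toFinset fun j _ => lam_nonneg _ _
    linarith [min_le_left (ε / 2) |x i|]

theorem l2ToC0_toL2 (x : C₀(ι, ℝ)) : l2ToC0 (toL2 x) = x := by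
  ext i
  have hT : truncSum (fun j => toL2Coord x j ^ 2) (toL2Coord x i ^ 2) = |x i| := by
    simp only [toL2Coord_sq, truncSum_lam]
  rw [l2ToC0_apply]
  change l2ToC0Coord (toL2Coord x) i = x i
  rcases le_total 0 (x i) with h | h
  · rw [l2ToC0Coord_of_nonneg, hT, abs_of_nonneg h]
    rw [toL2Coord_of_nonneg h]
    exact Real.sqrt_nonneg _
  · rw [l2ToC0Coord_of_nonpos, hT, abs_of_nonpos h, neg_neg]
    rw [toL2Coord_of_nonpos h]
    exact neg_nonpos.2 (Real.sqrt_nonneg _)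

/-- The sequence spaces `ℓ²` and `c₀` over the same index set are homeomorphic. -/
noncomputable def homeomorphL2 : C₀(ι, ℝ) ≃ₜ lp (fun _ : ι => ℝ) 2 where
  toFun := toL2
  invFun := l2ToC0
  left_inv := l2ToC0_toL2
  right_inv _ := l2ToC0_injective (l2ToC0_toL2 _)
  continuous_toFun := continuous_toL2
  continuous_invFun := continuous_l2ToC0

end C0

section Hilbert

theorem exists_homeomorph_C0.{u} (H : Type u) [NormedAddCommGroup H] [InnerProductSpace ℝ H]
    [CompleteSpace H] (hH : ¬ FiniteDimensional ℝ H) :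
    ∃ (ι : Type u) (_ : TopologicalSpace ι) (_ : DiscreteTopology ι), Infinite ι ∧
      Nonempty (H ≃ₜ C₀(ι, ℝ)) := by
  obtain ⟨w, b, -⟩ := exists_hilbertBasis ℝ H
  let : TopologicalSpace w := ⊥
  have : DiscreteTopology w := ⟨rfl⟩
  refine ⟨w, ⊥, ⟨rfl⟩, ?_, ⟨b.repr.toHomeomorph.trans C0.homeomorphL2.symm⟩⟩
  by_contra hfin
  have := not_infinite_iff_finite.1 hfin
  have := Fintype.ofFinite w
  exact hH b.toOrthonormalBasis.toBasis.finiteDimensional_of_finite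

/-- Removing countably many closed homotopy negligible sets from an infinite-dimensional Hilbert
space does not change the homeomorphism type. -/
theorem nonempty_homeomorph_compl_hilbert {H : Type*} [NormedAddCommGroup H]
    [InnerProductSpace ℝ H] [CompleteSpace H] (hH : ¬ FiniteDimensional ℝ H) {F : ℕ → Set H}
    (hF : ∀ k, IsClosed (F k)) {h : H × I → H} (hc : Continuous h) (h0 : ∀ y, h (y, 0) = y)
    (hhF : ∀ y (t : I), t ≠ 0 → ∀ k, h (y, t) ∉ F k) : Nonempty ({y | ∀ k, y ∉ F k} ≃ₜ H) := by
  obtain ⟨ι, _, _, _, ⟨e⟩⟩ := exists_homeomorph_C0 H hH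
  obtain ⟨g⟩ := C0.nonempty_homeomorph_compl (F := fun k => e.symm ⁻¹' F k)
    (fun k => (hF k).preimage e.symm.continuous)
    (h := fun p => e (h (e.symm p.1, p.2))) (by fun_prop) (fun y => by simp [h0])
    (fun y t ht k => by simpa using hhF (e.symm y) t ht k)
  refine ⟨(Homeomorph.subtype e fun y => ?_).trans (g.trans e.symm)⟩
  simp only [Set.mem_ofPred_eq, Set.mem_preimage, Homeomorph.symm_apply_apply]

theorem IsGδ.nonempty_homeomorph_hilbert {H : Type*} [NormedAddCommGroup H]
    [InnerProductSpace ℝ H] [CompleteSpace H] (hH : ¬ FiniteDimensional ℝ H) {E D : Set H}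
    (hE : IsGδ E) (hDE : D ⊆ E) (hD : HomotopyDense D) : Nonempty (E ≃ₜ H) := by
  obtain ⟨U, hU, hEU⟩ := isGδ_iff_eq_iInter_nat.1 hE
  obtain ⟨h, hc, h0, hh⟩ := hD
  obtain ⟨g⟩ := nonempty_homeomorph_compl_hilbert hH (F := fun k => (U k)ᶜ)
    (fun k => (hU k).isClosed_compl) hc h0 fun y t ht k hk => hk (by
      have := hDE (hh y t ht)
      rw [hEU] at this
      exact Set.mem_iInter.1 this k)
  have : {y | ∀ k, y ∉ (U k)ᶜ} = E := by
    rw [hEU]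
    ext y
    simp
  rw [this] at g
  exact ⟨g⟩

end Hilbert

section LocalToGlobal

theorem exists_continuous_mul_mem {B : Type*} [TopologicalSpace B] [T2Space B] [ParacompactSpace B]
    {Ω : Set (B × I)} (hΩ : IsOpen Ω) (h0 : ∀ y, (y, 0) ∈ Ω) :
    ∃ τ : B → I, Continuous τ ∧ (∀ y, τ y ≠ 0) ∧ ∀ y t, (y, t * τ y) ∈ Ω := by
  obtain ⟨g, hg⟩ := exists_continuous_forall_mem_convex_of_local_const
    (t := fun y : B => {r : ℝ | 0 < r ∧ r ≤ 1 ∧ ∀ s : I, (s : ℝ) ≤ r → (y, s) ∈ Ω}) (fun y => by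
      intro r hr r' hr' a b ha hb hab
      refine ⟨?_, ?_, fun s hs => ?_⟩
      · exact (convex_Ioi (0 : ℝ)) hr.1 hr'.1 ha hb hab
      · exact (convex_Iic (1 : ℝ)) hr.2.1 hr'.2.1 ha hb hab
      · rcases le_total r r' with h | h
        · refine hr'.2.2 s (hs.trans ?_)
          exact (convex_Iic r') h Set.self_mem_Iic ha hb hab
        · refine hr.2.2 s (hs.trans ?_)
          exact (convex_Iic r) Set.self_mem_Iic h ha hb hab) (fun y => by
      have := hΩ.mem_nhds (h0 y)
      rw [nhds_prod_eq, Filter.mem_prod_iff] at this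
      obtain ⟨U, hU, V, hV, hUV⟩ := this
      obtain ⟨ε, hε, hεV⟩ := Metric.mem_nhds_iff.1 hV
      refine ⟨min (ε / 2) 1, Filter.mem_of_superset hU fun y' hy' =>
        ⟨lt_min (half_pos hε) one_pos, min_le_right _ _, fun s hs => hUV ⟨hy', hεV ?_⟩⟩⟩
      rw [Metric.mem_ball, Subtype.dist_eq, Real.dist_eq, Set.Icc.coe_zero, sub_zero,
        abs_of_nonneg s.2.1]
      linarith [min_le_left (ε / 2) 1])
  refine ⟨fun y => ⟨g y, (hg y).1.le, (hg y).2.1⟩, g.continuous.subtype_mk _, fun y hy => ?_,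
    fun y t => (hg y).2.2 _ ?_⟩
  · exact (hg y).1.ne' (congrArg Subtype.val hy)
  · exact mul_le_of_le_one_left (hg y).1.le t.2.2

/-- Homotopy denseness is inherited by open subspaces. -/
theorem HomotopyDense.preimage {B M : Type*} [TopologicalSpace B] [T2Space B] [ParacompactSpace B]
    [TopologicalSpace M] {A : Set M} (hA : HomotopyDense A) {c : B → M} (hc : Topology.IsOpenEmbedding c) :
    HomotopyDense (c ⁻¹' A) := by
  obtain ⟨h, hh, h0, hhA⟩ := hA
  obtain ⟨τ, hτ, hτ0, hτΩ⟩ := exists_continuous_mul_mem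
    (Ω := (fun p : B × I => h (c p.1, p.2)) ⁻¹' Set.range c)
    (hc.isOpen_range.preimage (by have := hc.continuous; fun_prop))
    (fun y => ⟨y, (h0 _).symm⟩)
  choose k hk using hτΩ
  refine ⟨fun p => k p.1 p.2, ?_, fun y => hc.injective ?_, fun y t ht => ?_⟩
  · rw [hc.isEmbedding.continuous_iff]
    have : c ∘ (fun p : B × I => k p.1 p.2) = fun p => h (c p.1, p.2 * τ p.1) :=
      funext fun p => hk _ _
    rw [this]
    have := hc.continuous
    fun_prop
  · rw [hk]
    simp [h0]
  · change c (k y t) ∈ A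
    rw [hk]
    exact hhA _ _ (mul_ne_zero ht (hτ0 y))

theorem HomotopyDense.exists_local_homotopy {Y : Type*} [TopologicalSpace Y] {A N : Set Y}
    (hN : IsOpen N) (h : HomotopyDense (Subtype.val ⁻¹' A : Set N)) {ρ : Y → I}
    (hρ : Continuous ρ) {K : Set Y} (hK : IsClosed K) (hρK : ∀ y, y ∉ K → ρ y = 0) (hKN : K ⊆ N) :
    ∃ k : Y × I → Y, Continuous k ∧ (∀ y, k (y, 0) = y) ∧ (∀ y t, ρ y = 0 → k (y, t) = y) ∧
      (∀ y t, t ≠ 0 → ρ y ≠ 0 → k (y, t) ∈ A) ∧ ∀ y t, y ∈ A → k (y, t) ∈ A := by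
  classical
  obtain ⟨h, hh, h0, hhA⟩ := h
  let k : Y × I → Y := fun p => if hp : p.1 ∈ N then (h (⟨p.1, hp⟩, p.2 * ρ p.1)).1 else p.1
  have hk0 : ∀ y (t : I), t * ρ y = 0 → k (y, t) = y := fun y t ht => by
    by_cases hy : y ∈ N
    · simp only [k, dif_pos hy, ht, h0]
    · simp only [k, dif_neg hy]
  have hkA : ∀ y (t : I), t * ρ y ≠ 0 → k (y, t) ∈ A := fun y t ht => by
    have hy : y ∈ N := by
      by_contra hy
      exact ht (by rw [hρK y (fun hh => hy (hKN hh)), mul_zero])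
    simp only [k, dif_pos hy]
    exact hhA ⟨y, hy⟩ _ ht
  refine ⟨k, ?_, fun y => hk0 y 0 (zero_mul _), fun y t hy => hk0 y t (by rw [hy, mul_zero]),
    fun y t ht hy => hkA y t (mul_ne_zero ht hy), fun y t hy => ?_⟩
  · rw [continuous_iff_continuousAt]
    rintro ⟨y, t⟩
    by_cases hy : y ∈ N
    · have hO : IsOpen {p : Y × I | p.1 ∈ N} := hN.preimage continuous_fst
      have : ContinuousOn k {p : Y × I | p.1 ∈ N} := by
        rw [continuousOn_iff_continuous_domRestrict]
        have e : Set.domRestrict {p : Y × I | p.1 ∈ N} k =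
            fun p => (h (⟨p.1.1, p.2⟩, p.1.2 * ρ p.1.1)).1 := funext fun p => dif_pos p.2
        rw [e]
        refine continuous_subtype_val.comp (hh.comp (Continuous.prodMk ?_ ?_))
        · exact (continuous_fst.comp continuous_subtype_val).subtype_mk _
        · fun_prop
      exact this.continuousAt (hO.mem_nhds hy)
    · have hyK : y ∉ K := fun h => hy (hKN h)
      have hO : IsOpen {p : Y × I | p.1 ∉ K} := hK.isOpen_compl.preimage continuous_fst
      refine continuousAt_fst.congr (Filter.mem_of_superset (hO.mem_nhds hyK) fun p hp => ?_)
      exact (hk0 p.1 p.2 (by rw [hρK _ hp, mul_zero])).symm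
  · by_cases ht : t * ρ y = 0
    · rwa [hk0 y t ht]
    · exact hkA y t ht

theorem foldl_eq_foldl_filter {Y κ : Type*} (k : κ → Y → Y) (p : κ → Bool) {W : Set Y}
    (hW : ∀ i, p i = false → ∀ y ∈ W, k i y = y) (x : Y) (l : List κ)
    (h : ∀ l', l' <+: l.filter p → l'.foldl (fun y i => k i y) x ∈ W) :
    l.foldl (fun y i => k i y) x = (l.filter p).foldl (fun y i => k i y) x := by
  induction l using List.reverseRecOn with
  | nil => rfl
  | append_singleton l a ih =>
    rw [List.filter_append] at h ⊢
    have ih' := ih fun l' hl' => h l' (hl'.trans (List.prefix_append _ _))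
    rw [List.foldl_append, ih', List.foldl_append, List.foldl_cons, List.foldl_nil]
    rcases hpa : p a with - | -
    · rw [List.filter_cons_of_neg (by simp [hpa])]
      exact hW a hpa _ (h _ (List.prefix_append _ _))
    · rw [List.filter_cons_of_pos hpa]
      rfl

theorem foldl_mem_of_mem {Y κ : Type*} (k : κ → Y → Y) {A : Set Y}
    (hA : ∀ i, ∀ y ∈ A, k i y ∈ A) (l : List κ) {x : Y} (hx : x ∈ A) :
    l.foldl (fun y i => k i y) x ∈ A := by
  induction l generalizing x with
  | nil => exact hx
  | cons a l ih => exact ih (hA a x hx)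

theorem foldl_mem {Y κ : Type*} (k : κ → Y → Y) {A : Set Y} (hA : ∀ i, ∀ y ∈ A, k i y ∈ A)
    {x : Y} (hx : ∀ i, k i x = x ∨ k i x ∈ A) (l : List κ) {i : κ} (hi : i ∈ l)
    (hix : k i x ∈ A) : l.foldl (fun y i => k i y) x ∈ A := by
  induction l with
  | nil => simp at hi
  | cons a l ih =>
    rw [List.foldl_cons]
    rcases hx a with h | h
    · rcases List.mem_cons.1 hi with rfl | h'
      · exact foldl_mem_of_mem k hA l hix
      · rw [h]
        exact ih h'
    · exact foldl_mem_of_mem k hA l h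

/-- A set which is locally homotopy dense in a paracompact Hausdorff space is homotopy dense. -/
theorem homotopyDense_of_cover {Y : Type*} [TopologicalSpace Y] [T2Space Y] [ParacompactSpace Y]
    (A : Set Y) (hA : ∀ y, ∃ N, IsOpen N ∧ y ∈ N ∧ HomotopyDense (Subtype.val ⁻¹' A : Set N)) :
    HomotopyDense A := by
  classical
  choose N hNo hyN hN using hA
  obtain ⟨f, hf⟩ := PartitionOfUnity.exists_isSubordinate isClosed_univ N hNo
    fun y _ => Set.mem_iUnion.2 ⟨y, hyN y⟩
  let ρ : Y → Y → I := fun i y => ⟨f i y, f.nonneg i y, f.le_one i y⟩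
  have hρ : ∀ i y, ρ i y = 0 ↔ f i y = 0 := fun i y => by
    simp only [ρ, Subtype.ext_iff, Set.Icc.coe_zero]
  choose k hkc hk0 hkρ hkA hkX using fun i => (hN i).exists_local_homotopy (hNo i) (ρ := ρ i)
    ((f i).continuous.subtype_mk _) (isClosed_tsupport (f i))
    (fun y hy => (hρ i y).2 (image_eq_zero_of_notMem_tsupport hy)) (hf i)
  let : LinearOrder Y := linearOrderOfSTO WellOrderingRel
  let gl : List Y → Y × I → Y := fun l z => l.foldl (fun y i => k i (y, z.2)) z.1
  have hglc : ∀ l, Continuous (gl l) := fun l => by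
    induction l using List.reverseRecOn with
    | nil => exact continuous_fst
    | append_singleton l a ih =>
      simp only [gl, List.foldl_append, List.foldl_cons, List.foldl_nil]
      exact (hkc a).comp (ih.prodMk continuous_snd)
  have hgl0 : ∀ l y, gl l (y, 0) = y := fun l y => by
    induction l with
    | nil => rfl
    | cons a l ih =>
      simp only [gl, List.foldl_cons, hk0] at ih ⊢
      exact ih
  let g : Finset Y → Y × I → Y := fun F => gl (F.sort (· ≤ ·))
  have hloc : ∀ x, ∃ F₀ : Finset Y, ∀ᶠ z in 𝓝 ((x, 0) : Y × I), ∀ F, F₀ ⊆ F → g F z = g F₀ z := by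
    intro x
    obtain ⟨W, hW, hfin⟩ := f.locallyFinite x
    refine ⟨hfin.toFinset, ?_⟩
    set F₀ := hfin.toFinset
    have hWk : ∀ i, i ∉ F₀ → ∀ y ∈ W, ∀ t, k i (y, t) = y := fun i hi y hy t => by
      refine hkρ i y t ((hρ i y).2 ?_)
      by_contra hne
      exact hi (hfin.mem_toFinset.2 ⟨y, hne, hy⟩)
    have hpre : ∀ᶠ z in 𝓝 ((x, 0) : Y × I), ∀ l' ∈ (F₀.sort (· ≤ ·)).inits, gl l' z ∈ W := by
      refine (Filter.eventually_all_finite (List.finite_toSet _)).2 fun l' _ => ?_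
      refine (hglc l').continuousAt.eventually_mem ?_
      rwa [hgl0]
    filter_upwards [hpre] with z hz F hF
    have hfilt : (F.sort (· ≤ ·)).filter (fun i => decide (i ∈ F₀)) = F₀.sort (· ≤ ·) := by
      refine List.Perm.eq_of_pairwise (le := (· ≤ ·)) (fun a b _ _ => le_antisymm)
        ((Finset.pairwise_sort F _).filter _) (Finset.pairwise_sort F₀ _) ?_
      refine (List.perm_ext_iff_of_nodup ((Finset.sort_nodup F _).filter _)
        (Finset.sort_nodup F₀ _)).2 fun i => ?_
      simp only [List.mem_filter, Finset.mem_sort, decide_eq_true_eq]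
      exact ⟨fun h => h.2, fun h => ⟨hF h, h⟩⟩
    have := foldl_eq_foldl_filter (fun i y => k i (y, z.2)) (fun i => decide (i ∈ F₀)) (W := W)
      (fun i hi y hy => hWk i (of_decide_eq_false hi) y hy _) z.1 (F.sort (· ≤ ·))
      (fun l' hl' => hz l' ((List.mem_inits _ _).2 (hfilt ▸ hl')))
    rw [hfilt] at this
    exact this
  let Ω : Set (Y × I) := {z | ∃ F₀, ∀ᶠ z' in 𝓝 z, ∀ F, F₀ ⊆ F → g F z' = g F₀ z'}
  have hΩ : IsOpen Ω := by
    rw [isOpen_iff_mem_nhds]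
    rintro z ⟨F₀, hF₀⟩
    filter_upwards [eventually_eventually_nhds.2 hF₀] with z' hz'
    exact ⟨F₀, hz'⟩
  obtain ⟨τ, hτ, hτ0, hτΩ⟩ := exists_continuous_mul_mem hΩ hloc
  choose! F hF using fun (z : Y × I) (hz : z ∈ Ω) => hz
  have hGc : ∀ z ∈ Ω, ContinuousAt (fun z => g (F z) z) z := fun z hz => by
    refine (hglc (Finset.sort (F z) (· ≤ ·))).continuousAt.congr ?_
    filter_upwards [hF z hz, hΩ.mem_nhds hz] with z' h1 h2
    change g (F z) z' = _
    rw [← h1 _ Finset.subset_union_left, ← (hF z' h2).self_of_nhds _ Finset.subset_union_right]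
  refine ⟨fun z => g (F (z.1, z.2 * τ z.1)) (z.1, z.2 * τ z.1), ?_, fun y => ?_, fun y t ht => ?_⟩
  · rw [continuous_iff_continuousAt]
    rintro ⟨y, t⟩
    refine ContinuousAt.comp (g := fun z => g (F z) z) (f := fun z : Y × I => (z.1, z.2 * τ z.1))
      (hGc _ (hτΩ y t)) ?_
    exact Continuous.continuousAt (by fun_prop)
  · simp only [zero_mul]
    exact hgl0 _ _
  · obtain ⟨i, hi⟩ := f.exists_pos (Set.mem_univ y)
    have hne := mul_ne_zero ht (hτ0 y)
    have h1 := (hF _ (hτΩ y t)).self_of_nhds (insert i (F (y, t * τ y))) (Finset.subset_insert _ _)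
    change g (F (y, t * τ y)) (y, t * τ y) ∈ A
    rw [← h1]
    refine foldl_mem (fun i y' => k i (y', t * τ y)) (fun i y hy => hkX i y _ hy) (fun j => ?_) _
      (i := i) ((Finset.mem_sort _).2 (Finset.mem_insert_self _ _)) ?_
    · by_cases hj : ρ j y = 0
      · exact Or.inl (hkρ j y _ hj)
      · exact Or.inr (hkA j y _ hne hj)
    · exact hkA i y _ hne fun h => hi.ne' ((hρ i y).1 h)

end LocalToGlobal

section Lavrentiev
open Filter
variable {T P Q : Type*}

/-- The pairs of limit points of two maps `f` and `g` at which the same filter converges. -/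
def limitRel [TopologicalSpace P] [TopologicalSpace Q] (f : T → P) (g : T → Q) : Set (P × Q) :=
  {z | comap f (𝓝 z.1) = comap g (𝓝 z.2) ∧ (comap f (𝓝 z.1)).NeBot}

theorem swap_mem_limitRel [TopologicalSpace P] [TopologicalSpace Q] {f : T → P} {g : T → Q}
    {z : P × Q} (hz : z ∈ limitRel f g) : z.swap ∈ limitRel g f :=
  ⟨hz.1.symm, hz.1 ▸ hz.2⟩

theorem mk_mem_limitRel [TopologicalSpace T] [TopologicalSpace P] [TopologicalSpace Q]
    {f : T → P} {g : T → Q} (hf : Topology.IsInducing f) (hg : Topology.IsInducing g) (t : T) :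
    (f t, g t) ∈ limitRel f g := by
  refine ⟨?_, ?_⟩
  · change comap f (𝓝 (f t)) = comap g (𝓝 (g t))
    rw [← hf.nhds_eq_comap, ← hg.nhds_eq_comap]
  · change (comap f (𝓝 (f t))).NeBot
    rw [← hf.nhds_eq_comap]
    infer_instance

theorem snd_mem_of_mem_limitRel [TopologicalSpace P] [TopologicalSpace Q] {f : T → P} {g : T → Q}
    {z : P × Q} (hz : z ∈ limitRel f g) {O : Set P} (hO : O ∈ 𝓝 z.1) {K : Set Q}
    (hK : IsClosed K) (hOK : f ⁻¹' O ⊆ g ⁻¹' K) : z.2 ∈ K := by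
  by_contra hh
  have h1 : f ⁻¹' O ∈ comap f (𝓝 z.1) := preimage_mem_comap hO
  have h2 : g ⁻¹' Kᶜ ∈ comap f (𝓝 z.1) := by
    rw [hz.1]
    exact preimage_mem_comap (hK.isOpen_compl.mem_nhds hh)
  have := hz.2
  obtain ⟨t, ht1, ht2⟩ := nonempty_of_mem (inter_mem h1 h2)
  exact ht2 (hOK ht1)

theorem isEmbedding_fst_limitRel [TopologicalSpace P] [TopologicalSpace Q] [T3Space Q]
    (f : T → P) (g : T → Q) : Topology.IsEmbedding fun z : limitRel f g => z.1.1 := by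
  have key : ∀ z : limitRel f g, ∀ K ∈ 𝓝 z.1.2, IsClosed K → ∃ O : Set P, z.1.1 ∈ O ∧ IsOpen O ∧
      ∀ z' : limitRel f g, z'.1.1 ∈ O → z'.1.2 ∈ K := fun z K hK hKc => by
    have h1 : g ⁻¹' K ∈ comap f (𝓝 z.1.1) := by
      rw [z.2.1]
      exact preimage_mem_comap hK
    obtain ⟨O, hO, hOK⟩ := mem_comap.1 h1
    refine ⟨interior O, mem_interior_iff_mem_nhds.2 hO, isOpen_interior, fun z' hz' => ?_⟩
    exact snd_mem_of_mem_limitRel z'.2 (mem_interior_iff_mem_nhds.1 hz') hKc hOK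
  refine ⟨Topology.isInducing_iff_nhds.2 fun z => le_antisymm ?_ ?_, fun z z' hzz' => ?_⟩
  · exact tendsto_iff_comap.1
      (continuous_fst.comp (continuous_subtype_val (p := (· ∈ limitRel f g)))).continuousAt
  · rw [nhds_subtype_eq_comap, ← tendsto_iff_comap, nhds_prod_eq]
    refine Tendsto.prodMk tendsto_comap ?_
    refine (closed_nhds_basis z.1.2).tendsto_right_iff.2 fun K hK => ?_
    obtain ⟨O, hzO, hO, hOK⟩ := key z K hK.1 hK.2
    exact Filter.mem_of_superset (preimage_mem_comap (hO.mem_nhds hzO)) hOK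
  · refine Subtype.ext (Prod.ext hzz' ?_)
    by_contra hne
    obtain ⟨K, hK, hKc, hz'K⟩ : ∃ K ∈ 𝓝 z.1.2, IsClosed K ∧ z'.1.2 ∉ K := by
      have := (closed_nhds_basis z.1.2).mem_iff.1 (isOpen_ne.mem_nhds hne)
      obtain ⟨K, hK, hKs⟩ := this
      exact ⟨K, hK.1, hK.2, fun h => hKs h rfl⟩
    obtain ⟨O, hzO, hO, hOK⟩ := key z K hK hKc
    exact hz'K (hOK z' (hzz' ▸ hzO))

theorem isEmbedding_snd_limitRel [TopologicalSpace P] [TopologicalSpace Q] [T3Space P]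
    (f : T → P) (g : T → Q) : Topology.IsEmbedding fun z : limitRel f g => z.1.2 := by
  let e : limitRel f g ≃ₜ limitRel g f :=
    (Homeomorph.prodComm P Q).subtype fun z =>
      ⟨swap_mem_limitRel, fun h => swap_mem_limitRel (z := z.swap) h⟩
  exact (isEmbedding_fst_limitRel g f).comp e.isEmbedding

theorem isGδ_fst_limitRel [MetricSpace P] [MetricSpace Q] [CompleteSpace Q]
    (f : T → P) (g : T → Q) : IsGδ (Set.range fun z : limitRel f g => z.1.1) := by
  let C : ℕ → Set P := fun n => {p | ∃ U : Set P, IsOpen U ∧ p ∈ U ∧ ∃ V : Set Q, IsOpen V ∧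
    closure (g '' (f ⁻¹' U)) ⊆ V ∧
    (∀ t ∈ f ⁻¹' U, ∀ t' ∈ f ⁻¹' U, dist (g t) (g t') ≤ 1 / (n + 1)) ∧
    ∀ t ∈ g ⁻¹' V, ∀ t' ∈ g ⁻¹' V, dist (f t) (f t') ≤ 1 / (n + 1)}
  have hC : ∀ n, IsOpen (C n) := fun n => isOpen_iff_mem_nhds.2 fun p ⟨U, hU, hpU, h⟩ =>
    Filter.mem_of_superset (hU.mem_nhds hpU) fun p' hp' => ⟨U, hU, hp', h⟩
  have heq : (Set.range fun z : limitRel f g => z.1.1) = closure (Set.range f) ∩ ⋂ n, C n := by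
    ext p
    rw [Set.mem_inter_iff, Set.mem_iInter, mem_closure_iff_frequently,
      ← comap_neBot_iff_frequently]
    constructor
    · rintro ⟨⟨⟨p, q⟩, hpq, hne⟩, rfl⟩
      refine ⟨hne, fun n => ?_⟩
      have hn : (0 : ℝ) < 1 / (n + 1) := Nat.one_div_pos_of_nat
      simp only at hpq hne ⊢
      have h1 : f ⁻¹' Metric.ball p (1 / (n + 1) / 2) ∈ comap g (𝓝 q) := by
        rw [← hpq]
        exact preimage_mem_comap (Metric.ball_mem_nhds _ (half_pos hn))
      obtain ⟨V, hV, hVf⟩ := mem_comap.1 h1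
      obtain ⟨r, hr, hrV⟩ := Metric.mem_nhds_iff.1 hV
      have hr' : 0 < min (r / 2) (1 / (n + 1) / 2) := lt_min (half_pos hr) (half_pos hn)
      have h2 : g ⁻¹' Metric.ball q (min (r / 2) (1 / (n + 1) / 2)) ∈ comap f (𝓝 p) := by
        rw [hpq]
        exact preimage_mem_comap (Metric.ball_mem_nhds _ hr')
      obtain ⟨U, hU, hUg⟩ := mem_comap.1 h2
      obtain ⟨U', hU'U, hU', hpU'⟩ := mem_nhds_iff.1 hU
      have hUg' : ∀ t ∈ f ⁻¹' U', dist (g t) q < min (r / 2) (1 / (n + 1) / 2) :=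
        fun t ht => hUg (hU'U ht)
      refine ⟨U', hU', hpU', Metric.ball q r, Metric.isOpen_ball, ?_, ?_, ?_⟩
      · refine (closure_minimal (t := Metric.closedBall q (r / 2)) ?_
          Metric.isClosed_closedBall).trans (Metric.closedBall_subset_ball (half_lt_self hr))
        rintro _ ⟨t, ht, rfl⟩
        exact (hUg' t ht).le.trans (min_le_left _ _)
      · intro t ht t' ht'
        have e1 := (hUg' t ht).le.trans (min_le_right _ _)
        have e2 := (hUg' t' ht').le.trans (min_le_right _ _)
        linarith [dist_triangle_right (g t) (g t') q]
      · intro t ht t' ht'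
        have e1 : dist (f t) p < _ := hVf (hrV ht)
        have e2 : dist (f t') p < _ := hVf (hrV ht')
        linarith [dist_triangle_right (f t) (f t') p]
    · rintro ⟨hne, hpC⟩
      have hcau : Cauchy (map g (comap f (𝓝 p))) := by
        refine Metric.cauchy_iff.2 ⟨hne.map g, fun ε hε => ?_⟩
        obtain ⟨n, hn⟩ := exists_nat_one_div_lt hε
        obtain ⟨U, hU, hpU, V, -, -, hUd, -⟩ := hpC n
        refine ⟨_, image_mem_map (preimage_mem_comap (hU.mem_nhds hpU)), ?_⟩
        rintro _ ⟨t, ht, rfl⟩ _ ⟨t', ht', rfl⟩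
        exact (hUd t ht t' ht').trans_lt hn
      obtain ⟨q, hq⟩ := cauchy_iff_exists_le_nhds.1 hcau
      refine ⟨⟨(p, q), le_antisymm (map_le_iff_le_comap.1 hq) (map_le_iff_le_comap.1 ?_), hne⟩, rfl⟩
      refine Metric.tendsto_nhds.2 fun ε hε => ?_
      obtain ⟨n, hn⟩ := exists_nat_one_div_lt (half_pos hε)
      obtain ⟨U, hU, hpU, V, hV, hUV, -, hVd⟩ := hpC n
      have hqV : q ∈ V := hUV (mem_closure_of_tendsto (f := g) (b := comap f (𝓝 p)) hq
        (Filter.mem_of_superset (preimage_mem_comap (hU.mem_nhds hpU)) fun t ht => ⟨t, ht, rfl⟩))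
      filter_upwards [preimage_mem_comap (hV.mem_nhds hqV)] with t ht
      obtain ⟨t', ht', ht'2⟩ := nonempty_of_mem (preimage_mem_comap (m := f)
        (inter_mem (hU.mem_nhds hpU) (Metric.ball_mem_nhds p (half_pos hε))))
      have e1 := hVd t ht t' (hUV (subset_closure ⟨t', ht', rfl⟩))
      have e2 : dist (f t') p < ε / 2 := ht'2
      linarith [dist_triangle (f t) (f t') p]
  rw [heq]
  exact isClosed_closure.isGδ.inter (IsGδ.iInter_of_isOpen hC)

theorem isGδ_snd_limitRel [MetricSpace P] [MetricSpace Q] [CompleteSpace P]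
    (f : T → P) (g : T → Q) : IsGδ (Set.range fun z : limitRel f g => z.1.2) := by
  convert isGδ_fst_limitRel g f using 1
  ext q
  constructor
  · rintro ⟨z, rfl⟩
    exact ⟨⟨z.1.swap, swap_mem_limitRel z.2⟩, rfl⟩
  · rintro ⟨z, rfl⟩
    exact ⟨⟨z.1.swap, swap_mem_limitRel z.2⟩, rfl⟩

theorem Topology.IsInducing.isGδ_image [TopologicalSpace P] [TopologicalSpace Q] {π : P → Q}
    (hπ : IsInducing π) (hr : IsGδ (Set.range π)) {s : Set P} (hs : IsGδ s) : IsGδ (π '' s) := by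
  obtain ⟨U, hU, rfl⟩ := isGδ_iff_eq_iInter_nat.1 hs
  choose V hV hVU using fun n => hπ.isOpen_iff.1 (hU n)
  have : π '' (⋂ n, U n) = Set.range π ∩ ⋂ n, V n := by
    simp only [← hVU, ← Set.preimage_iInter, Set.image_preimage_eq_range_inter]
  rw [this]
  exact hr.inter (IsGδ.iInter_of_isOpen hV)

end Lavrentiev

section Gluing

theorem HomotopyDense.restrict {Y : Type*} [TopologicalSpace Y] {D E : Set Y}
    (hD : HomotopyDense D) (hDE : D ⊆ E) : HomotopyDense (Subtype.val ⁻¹' D : Set E) := by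
  obtain ⟨h, hc, h0, hh⟩ := hD
  have hE : ∀ p : E × I, h (p.1.1, p.2) ∈ E := fun p => by
    by_cases ht : p.2 = 0
    · rw [ht, h0]
      exact p.1.2
    · exact hDE (hh _ _ ht)
  refine ⟨fun p => ⟨h (p.1.1, p.2), hE p⟩, Continuous.subtype_mk (by fun_prop) _, fun y => ?_,
    fun y t ht => hh _ _ ht⟩
  exact Subtype.ext (h0 _)

theorem HomotopyDense.homeomorph {Y Z : Type*} [TopologicalSpace Y] [TopologicalSpace Z]
    {D : Set Y} (hD : HomotopyDense D) (e : Y ≃ₜ Z) {D' : Set Z} (h : ∀ y ∈ D, e y ∈ D') :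
    HomotopyDense D' := by
  obtain ⟨k, hc, h0, hh⟩ := hD
  exact ⟨fun p => e (k (e.symm p.1, p.2)), by fun_prop, fun y => by simp [h0],
    fun y t ht => h _ (hh _ _ ht)⟩

theorem exists_isOpenEmbedding_range_ball {H : Type*} [NormedAddCommGroup H]
    [InnerProductSpace ℝ H] (q : H) {r : ℝ} (hr : 0 < r) :
    ∃ c : H → H, Topology.IsOpenEmbedding c ∧ Set.range c = Metric.ball q r ∧ c 0 = q := by
  refine ⟨OpenPartialHomeomorph.univBall q r, ?_, ?_, OpenPartialHomeomorph.univBall_apply_zero q r⟩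
  · exact OpenPartialHomeomorph.isOpenEmbedding _ (OpenPartialHomeomorph.univBall_source q r)
  · rw [← OpenPartialHomeomorph.univBall_target q hr, ← Set.image_univ,
      ← OpenPartialHomeomorph.univBall_source q r]
    exact (OpenPartialHomeomorph.univBall q r).image_source_eq_target

theorem EmbedsHomotopyDenselyInHilbertManifold.exists_chart {X : Type} [TopologicalSpace X]
    {U : Set X} (hUo : IsOpen U) {x : X} (hx : x ∈ U)
    (hU : EmbedsHomotopyDenselyInHilbertManifold U) :
    ∃ (H : Type) (_ : NormedAddCommGroup H) (_ : InnerProductSpace ℝ H) (_ : CompleteSpace H)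
      (_ : ¬ FiniteDimensional ℝ H) (D : Set H) (_ : HomotopyDense D) (j : D → X),
      Topology.IsOpenEmbedding j ∧ x ∈ Set.range j := by
  obtain ⟨M, _, ⟨-, -, hM⟩, A, hA, ⟨e⟩⟩ := hU
  obtain ⟨O, hO, haO, H, _, _, _, hH, V, hV, ⟨φ⟩⟩ := hM (e ⟨x, hx⟩).1
  obtain ⟨r, hr, hrV⟩ := Metric.isOpen_iff.1 hV (φ ⟨_, haO⟩).1 (φ ⟨_, haO⟩).2
  obtain ⟨b, hb, hbr, hb0⟩ := exists_isOpenEmbedding_range_ball (φ ⟨_, haO⟩).1 hr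
  have hbV : ∀ y, b y ∈ V := fun y => hrV (hbr ▸ Set.mem_range_self y)
  have hb' : Topology.IsOpenEmbedding fun y => (⟨b y, hbV y⟩ : V) :=
    Topology.IsOpenEmbedding.of_comp _ hV.isOpenEmbedding_subtypeVal hb
  let c : H → M := fun y => (φ.symm ⟨b y, hbV y⟩).1
  have hc : Topology.IsOpenEmbedding c :=
    (hO.isOpenEmbedding_subtypeVal.comp φ.symm.isOpenEmbedding).comp hb'
  have hc0 : c 0 = (e ⟨x, hx⟩).1 := by
    have : (⟨b 0, hbV 0⟩ : V) = φ ⟨_, haO⟩ := Subtype.ext hb0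
    simp only [c, this, Homeomorph.symm_apply_apply]
  refine ⟨H, _, _, ‹_›, hH, c ⁻¹' A, hA.preimage hc,
    fun d => (e.symm (A.restrictPreimage c d)).1, ?_, ⟨0, ?_⟩, ?_⟩
  · exact (hUo.isOpenEmbedding_subtypeVal.comp e.symm.isOpenEmbedding).comp (hc.restrictPreimage A)
  · change c 0 ∈ A
    rw [hc0]
    exact (e ⟨x, hx⟩).2
  · have : A.restrictPreimage c ⟨0, by change c 0 ∈ A; rw [hc0]; exact (e ⟨x, hx⟩).2⟩ =
        e ⟨x, hx⟩ := Subtype.ext hc0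
    simp only [this, Homeomorph.symm_apply_apply]

theorem exists_hilbert_nhd {P H : Type*} [MetricSpace P] [CompleteSpace P]
    [NormedAddCommGroup H] [InnerProductSpace ℝ H] [CompleteSpace H]
    (hH : ¬ FiniteDimensional ℝ H) {D : Set H} (hD : HomotopyDense D) {f : D → P}
    (hf : Topology.IsEmbedding f) {Z W A : Set P} (hW : IsOpen W) (hZW : IsGδ (Z ∩ W))
    (hZR : Z ∩ W ⊆ Set.range fun z : limitRel f (Subtype.val : D → H) => z.1.1)
    (hfZ : ∀ d, f d ∈ Z) (hfA : ∀ d, f d ∈ A) (p : Z) (hpW : p.1 ∈ W) :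
    ∃ N : Set Z, IsOpen N ∧ p ∈ N ∧ Nonempty (N ≃ₜ H) ∧
      HomotopyDense (Subtype.val ⁻¹' (Subtype.val ⁻¹' A) : Set N) := by
  set R := limitRel f (Subtype.val : D → H)
  have hπ₁ : Topology.IsEmbedding fun z : R => z.1.1 := isEmbedding_fst_limitRel _ _
  have hπ₂ : Topology.IsEmbedding fun z : R => z.1.2 := isEmbedding_snd_limitRel _ _
  have hdR : ∀ d, (f d, d.1) ∈ R := fun d =>
    mk_mem_limitRel hf.isInducing Topology.IsInducing.subtypeVal d
  obtain ⟨z₀, hz₀⟩ := hZR ⟨p.2, hpW⟩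
  have h1 : f ⁻¹' W ∈ Filter.comap (Subtype.val : D → H) (𝓝 z₀.1.2) := by
    rw [← z₀.2.1]
    refine Filter.preimage_mem_comap (hW.mem_nhds ?_)
    rw [show z₀.1.1 = p.1 from hz₀]
    exact hpW
  obtain ⟨B', hB', hB'W⟩ := Filter.mem_comap.1 h1
  obtain ⟨r, hr, hrB'⟩ := Metric.mem_nhds_iff.1 hB'
  set B := Metric.ball z₀.1.2 r
  obtain ⟨c, hc, hcB, -⟩ := exists_isOpenEmbedding_range_ball z₀.1.2 hr
  let T : Set R := {z | z.1.1 ∈ Z ∩ W ∧ z.1.2 ∈ B}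
  have hT : IsGδ T := (hZW.preimage hπ₁.continuous).inter
    (Metric.isOpen_ball.preimage hπ₂.continuous).isGδ
  let S : Set H := (fun z : R => z.1.2) '' T
  have hS : IsGδ S := hπ₂.isInducing.isGδ_image (isGδ_snd_limitRel _ _) hT
  have hDT : ∀ d : D, d.1 ∈ B → (⟨(f d, d.1), hdR d⟩ : R) ∈ T := fun d hd =>
    ⟨⟨hfZ d, hB'W (hrB' hd)⟩, hd⟩
  have hcD : c ⁻¹' D ⊆ c ⁻¹' S := fun y hy =>
    ⟨_, hDT ⟨c y, hy⟩ (by change c y ∈ Metric.ball z₀.1.2 r; rw [← hcB]; exact Set.mem_range_self y), rfl⟩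
  have hE : IsGδ (c ⁻¹' S) := hS.preimage hc.continuous
  have hcDd := hD.preimage hc
  obtain ⟨e₁⟩ := hE.nonempty_homeomorph_hilbert hH hcD hcDd
  have hcS : c '' (c ⁻¹' S) = S := by
    rw [Set.image_preimage_eq_iff, hcB]
    rintro _ ⟨z, hz, rfl⟩
    exact hz.2
  let e₂ : (c ⁻¹' S) ≃ₜ T := ((hc.isEmbedding.homeomorphImage _).trans
    (Homeomorph.setCongr hcS)).trans (hπ₂.homeomorphImage T).symm
  have he₂ : ∀ y, (e₂ y).1.1.2 = c y.1 := fun y => by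
    have : (hπ₂.homeomorphImage T) (e₂ y) = Homeomorph.setCongr hcS
        (hc.isEmbedding.homeomorphImage _ y) := by
      simp only [e₂, Homeomorph.trans_apply, Homeomorph.apply_symm_apply]
    exact congrArg Subtype.val this
  have hθ' : Topology.IsEmbedding fun z : T => (⟨z.1.1.1, z.2.1.1⟩ : Z) :=
    (hπ₁.comp Topology.IsEmbedding.subtypeVal).codRestrict Z fun z : T => z.2.1.1
  let θ : c ⁻¹' S → Z := fun y => ⟨(e₂ y).1.1.1, (e₂ y).2.1.1⟩
  have hθ : Topology.IsEmbedding θ := hθ'.comp e₂.isEmbedding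
  refine ⟨Set.range θ, ?_, ?_, ⟨hθ.toHomeomorph.symm.trans e₁⟩,
    (hcDd.restrict hcD).homeomorph hθ.toHomeomorph fun y hy => ?_⟩
  · obtain ⟨O, hO, hOB⟩ := hπ₁.isInducing.isOpen_iff.1
      (Metric.isOpen_ball (x := z₀.1.2) (ε := r) |>.preimage hπ₂.continuous)
    have : Set.range θ = Subtype.val ⁻¹' (W ∩ O) := by
      ext z
      constructor
      · rintro ⟨y, rfl⟩
        refine ⟨(e₂ y).2.1.2, ?_⟩
        have : (e₂ y).1 ∈ (fun z : R => z.1.1) ⁻¹' O := by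
          rw [hOB]
          exact (e₂ y).2.2
        exact this
      · rintro ⟨hzW, hzO⟩
        obtain ⟨z', hz'⟩ := hZR ⟨z.2, hzW⟩
        have hz'' : z'.1.1 = z.1 := hz'
        have hz'B : z' ∈ (fun z : R => z.1.2) ⁻¹' B := by
          rw [← hOB]
          change z'.1.1 ∈ O
          rw [hz'']
          exact hzO
        have hz'T : z' ∈ T := ⟨by rw [hz'']; exact ⟨z.2, hzW⟩, hz'B⟩
        refine ⟨e₂.symm ⟨z', hz'T⟩, Subtype.ext ?_⟩
        simp only [θ, Homeomorph.apply_symm_apply]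
        exact hz''
    rw [this]
    exact (hW.inter hO).preimage continuous_subtype_val
  · have hz₀' : z₀.1.1 = p.1 := hz₀
    have hz₀T : z₀ ∈ T := ⟨by rw [hz₀']; exact ⟨p.2, hpW⟩, Metric.mem_ball_self hr⟩
    refine ⟨e₂.symm ⟨z₀, hz₀T⟩, Subtype.ext ?_⟩
    simp only [θ, Homeomorph.apply_symm_apply]
    exact hz₀'
  · have hyD : c y.1 ∈ D := hy
    have : (e₂ y).1 = ⟨(f ⟨_, hyD⟩, c y.1), hdR ⟨_, hyD⟩⟩ := hπ₂.injective (he₂ y)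
    change (e₂ y).1.1.1 ∈ A
    rw [this]
    exact hfA _

theorem embedsHomotopyDensely_of_charts {X : Type} [MetricSpace X] {H : X → Type}
    [∀ x, NormedAddCommGroup (H x)] [∀ x, InnerProductSpace ℝ (H x)] [∀ x, CompleteSpace (H x)]
    (hH : ∀ x, ¬ FiniteDimensional ℝ (H x)) {D : ∀ x, Set (H x)} (hD : ∀ x, HomotopyDense (D x))
    {j : ∀ x, D x → X} (hj : ∀ x, Topology.IsOpenEmbedding (j x))
    (hx : ∀ x, x ∈ Set.range (j x)) : EmbedsHomotopyDenselyInHilbertManifold X := by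
  let P := UniformSpace.Completion X
  have hcoe : Topology.IsEmbedding ((↑) : X → P) :=
    UniformSpace.Completion.isUniformEmbedding_coe X |>.isEmbedding
  have hf : ∀ x, Topology.IsEmbedding fun d => (j x d : P) :=
    fun x => hcoe.comp (hj x).isEmbedding
  let R := fun x => limitRel (fun d => (j x d : P)) (Subtype.val : D x → H x)
  let G : X → Set P := fun x => Set.range fun z : R x => z.1.1
  have hG : ∀ x, IsGδ (G x) := fun x => isGδ_fst_limitRel _ _
  obtain ⟨v, hvo, hvU, hvf, hvj⟩ := precise_refinement (fun x => Set.range (j x))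
    (fun x => (hj x).isOpen_range)
    (Set.eq_univ_of_forall fun x => Set.mem_iUnion.2 ⟨x, hx x⟩)
  have hvV : ∀ x, ∃ V : Set P, IsOpen V ∧ ((↑) : X → P) ⁻¹' V = v x :=
    fun x => hcoe.isInducing.isOpen_iff.1 (hvo x)
  choose V hV hVv using hvV
  have hmemV : ∀ x (a : X), (a : P) ∈ V x ↔ a ∈ v x := fun x a => by rw [← hVv x]; rfl
  let Z : Set P := {p | (∃ x, p ∈ V x) ∧ (∃ W ∈ 𝓝 p, {x | (V x ∩ W).Nonempty}.Finite) ∧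
    ∀ x, p ∈ V x → p ∈ G x}
  have hXZ : ∀ a : X, (a : P) ∈ Z := fun a => by
    refine ⟨?_, ?_, fun x hax => ?_⟩
    · obtain ⟨x, hax⟩ := Set.mem_iUnion.1 (hvU ▸ Set.mem_univ a)
      exact ⟨x, (hmemV x a).2 hax⟩
    · obtain ⟨O, hO, hOf⟩ := hvf a
      rw [hcoe.nhds_eq_comap, Filter.mem_comap] at hO
      obtain ⟨W, hW, hWO⟩ := hO
      obtain ⟨W', hW'W, hW', haW'⟩ := mem_nhds_iff.1 hW
      refine ⟨W', hW'.mem_nhds haW', hOf.subset fun x (hxW : (V x ∩ W').Nonempty) => ?_⟩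
      obtain ⟨b, hb⟩ := (UniformSpace.Completion.denseRange_coe (α := X)).exists_mem_open
        ((hV x).inter hW') hxW
      exact ⟨b, (hmemV x b).1 hb.1, hWO (hW'W hb.2)⟩
    · obtain ⟨d, hd⟩ := hvj x ((hmemV x a).1 hax)
      exact ⟨⟨_, mk_mem_limitRel (hf x).isInducing Topology.IsInducing.subtypeVal d⟩,
        congrArg ((↑) : X → P) hd⟩
  have hloc : ∀ p : Z, ∃ x, ∃ N : Set Z, IsOpen N ∧ p ∈ N ∧ Nonempty (N ≃ₜ H x) ∧
      HomotopyDense (Subtype.val ⁻¹' (Subtype.val ⁻¹' Set.range ((↑) : X → P)) : Set N) := by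
    rintro ⟨p, hp⟩
    obtain ⟨⟨x, hpx⟩, ⟨W', hW', hfin⟩, hpG⟩ := id hp
    obtain ⟨W, hWW', hW, hpW⟩ := mem_nhds_iff.1 (Filter.inter_mem hW' ((hV x).mem_nhds hpx))
    have hfin' : {x | (V x ∩ W).Nonempty}.Finite := hfin.subset
      fun x (hx : (V x ∩ W).Nonempty) => hx.mono (Set.inter_subset_inter_right _
        (hWW'.trans Set.inter_subset_left))
    refine ⟨x, exists_hilbert_nhd (hH x) (hD x) (hf x) hW ?_ ?_ (fun d => hXZ _)
      (fun d => Set.mem_range_self (j x d)) ⟨p, hp⟩ hpW⟩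
    · have : Z ∩ W = W ∩ ⋂ x ∈ {x | (V x ∩ W).Nonempty}, ((V x)ᶜ ∪ G x) := by
        ext p'
        simp only [Set.mem_inter_iff, Set.mem_iInter, Set.mem_union, Set.mem_compl_iff]
        constructor
        · rintro ⟨hp', hp'W⟩
          exact ⟨hp'W, fun x' _ => (Classical.em (p' ∈ V x')).symm.imp id (hp'.2.2 x')⟩
        · rintro ⟨hp'W, hp'⟩
          exact ⟨⟨⟨x, (hWW' hp'W).2⟩, ⟨W, hW.mem_nhds hp'W, hfin'⟩, fun x' hx' =>
            (hp' x' ⟨p', hx', hp'W⟩).resolve_left fun h => h hx'⟩, hp'W⟩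
      rw [this]
      exact hW.isGδ.inter (IsGδ.biInter hfin'.countable fun x' _ =>
        (hV x').isClosed_compl.isGδ.union (hG x'))
    · rintro p' ⟨hp', hp'W⟩
      exact hp'.2.2 x (hWW' hp'W).2
  refine ⟨Z, inferInstance, ⟨inferInstance, inferInstance, fun p => ?_⟩,
    Subtype.val ⁻¹' Set.range ((↑) : X → P), homotopyDense_of_cover _ fun p => ?_, ?_⟩
  · obtain ⟨x, N, hN, hpN, ⟨e⟩, -⟩ := hloc p
    exact ⟨N, hN, hpN, H x, _, _, inferInstance, hH x, Set.univ, isOpen_univ,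
      ⟨e.trans (Homeomorph.Set.univ _).symm⟩⟩
  · obtain ⟨x, N, hN, hpN, -, h⟩ := hloc p
    exact ⟨N, hN, hpN, h⟩
  · have hi : Topology.IsEmbedding fun a : X => (⟨(a : P), hXZ a⟩ : Z) := hcoe.codRestrict Z hXZ
    refine ⟨hi.toHomeomorph.trans (Homeomorph.setCongr ?_)⟩
    ext z
    exact ⟨fun ⟨a, ha⟩ => ⟨a, congrArg Subtype.val ha⟩, fun ⟨a, ha⟩ => ⟨a, Subtype.ext ha⟩⟩

end Gluing

/-- If an ANR `X` is locally homotopy dense embeddable in Hilbert manifolds and every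
nonempty open subset of `X` has the same weight as `X`, then `X` itself is homotopy dense
embeddable in a Hilbert manifold. -/
theorem embedsHomotopyDensely_of_locally {X : Type} [TopologicalSpace X]
    (hANR : IsANR X)
    (hloc : ∀ x : X, ∃ U : Set X, IsOpen U ∧ x ∈ U ∧
      EmbedsHomotopyDenselyInHilbertManifold U)
    (hw : ∀ U : Set X, IsOpen U → U.Nonempty → tweight U = tweight X) :
    EmbedsHomotopyDenselyInHilbertManifold X := by
  have := hANR.1
  let := TopologicalSpace.metrizableSpaceMetric X
  have hchart : ∀ x : X, ∃ (H : Type) (_ : NormedAddCommGroup H) (_ : InnerProductSpace ℝ H)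
      (_ : CompleteSpace H) (_ : ¬ FiniteDimensional ℝ H) (D : Set H) (_ : HomotopyDense D)
      (j : D → X), Topology.IsOpenEmbedding j ∧ x ∈ Set.range j := fun x => by
    obtain ⟨U, hU, hxU, h⟩ := hloc x
    exact h.exists_chart hU hxU
  choose H _ _ _ hH D hD j hj hx using hchart
  exact embedsHomotopyDensely_of_charts hH hD hj hx
end
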